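/- Let 0 < s ≤ 1 and 0 < t ≤ 1, and let F ⊆ ℝ² be a circular (s,t)-Furstenberg set. Then the Hausdorff dimension of F satisfies dim_H F ≥ max{t/3 + s, (2s−1)t + s}. -/

import Mathlib

open scoped ENNReal
open MeasureTheory Metric Set


/-- the pairs `{x,y}` and `{u,v}` do not interleave -/
def NonInter (x y u v : ℝ) : Prop :=
  ¬ (min x y < min u v ∧ min u v < max x y ∧ max x y < max u v) ∧
  ¬ (min u v < min x y ∧ min x y < max u v ∧ max u v < max x y) ∧
  x ≠ u ∧ x ≠ v ∧ y ≠ u ∧ y ≠ v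

/-- truncated sign -/
noncomputable def tsgn (η u : ℝ) : ℝ := if η ≤ u then 1 else if u ≤ -η then -1 else 0

lemma tsgn_abs_lt {η u : ℝ} (h : |u| < η) : tsgn η u = 0 := by
  rw [abs_lt] at h
  unfold tsgn
  rw [if_neg (by linarith), if_neg (by linarith)]

lemma tsgn_pos {η u : ℝ} (h : η ≤ u) : tsgn η u = 1 := by
  unfold tsgn
  rw [if_pos h]

lemma tsgn_neg {η u : ℝ} (h0 : 0 < η) (h : u ≤ -η) : tsgn η u = -1 := by
  unfold tsgn
  rw [if_neg (by linarith), if_pos h]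

lemma tsgn_abs_le {η u : ℝ} : |tsgn η u| ≤ 1 := by
  unfold tsgn
  split_ifs <;> simp

lemma nonInter_dich {a a' b b' : ℝ} (h1 : NonInter a a' b b') (h2 : NonInter a b a' b')
    (n1 : a ≠ a') (n2 : b ≠ b') :
    (0 < (a' - a) * (b' - b) ∧ (b - a) * (b' - a') < 0 ∧
      ∀ l, l ≤ |a' - a| → l ≤ |b' - b| → |b - a| + |b' - a'| + 2 * l ≤ |a' - a| + |b' - b|) ∨
    ((a' - a) * (b' - b) < 0 ∧ 0 < (b - a) * (b' - a') ∧
       |a' - a| + |b' - b| ≤ |b - a| + |b' - a'|) := by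
  obtain ⟨p1, p2, p3, p4, p5, p6⟩ := h1
  obtain ⟨q1, q2, q3, q4, q5, q6⟩ := h2
  rcases lt_or_gt_of_ne n1 with h | h <;> rcases lt_or_gt_of_ne n2 with h' | h' <;>
  rcases lt_or_gt_of_ne p3 with h3 | h3 <;> rcases lt_or_gt_of_ne p6 with h6 | h6 <;>
  simp only [min_eq_left h.le, min_eq_right h.le, max_eq_left h.le, max_eq_right h.le,
    min_eq_left h'.le, min_eq_right h'.le, max_eq_left h'.le, max_eq_right h'.le,
    min_eq_left h3.le, min_eq_right h3.le, max_eq_left h3.le, max_eq_right h3.le,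
    min_eq_left h6.le, min_eq_right h6.le, max_eq_left h6.le, max_eq_right h6.le,
    not_and, not_lt] at p1 p2 q1 q2 <;>
  rcases lt_or_gt_of_ne p4 with h4 | h4 <;> rcases lt_or_gt_of_ne p5 with h5 | h5 <;>
  first
  | (exfalso; grind)
  | (left; refine ⟨by nlinarith, by nlinarith, fun l hl hl' => ?_⟩; grind)
  | (right; refine ⟨by nlinarith, by nlinarith, ?_⟩; grind)

/-- pointwise inequality -/
lemma core_pointwise {a a' b b' η l Q : ℝ} (hη : 0 < η) (hl : η ≤ l) (hl1 : l ≤ 1) (hQ : 0 ≤ Q)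
    (ha : |a' - a| ≤ 1) (hb : |b' - b| ≤ 1)
    (hD : 0 < Q → η ≤ |a' - a| → η ≤ |b' - b| → η ≤ |b - a| → η ≤ |b' - a'| →
      NonInter a a' b b' ∧ NonInter a b a' b') :
    l / 8 * ((if l ≤ |a' - a| then 1 else 0) * (if l ≤ |b' - b| then 1 else 0) * Q
      + tsgn l (a' - a) * tsgn l (b' - b) * Q)
    ≤ - (tsgn η (a' - a) * tsgn η (b' - b) * Q * (Real.exp (-|a' - a|) * Real.exp (-|b' - b|)))
      - (tsgn η (b - a) * tsgn η (b' - a') * Q * (Real.exp (-|b - a|) * Real.exp (-|b' - a'|)))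
      + 2 * ((if |a' - a| < η then 1 else 0) + (if |b' - b| < η then 1 else 0)
        + (if |b - a| < η then 1 else 0) + (if |b' - a'| < η then 1 else 0)) * Q := by
  have hex : ∀ x y : ℝ, 0 ≤ Real.exp (-|x|) * Real.exp (-|y|) ∧ Real.exp (-|x|) * Real.exp (-|y|) ≤ 1 := by
    intro x y
    refine ⟨by positivity, ?_⟩
    rw [← Real.exp_add]
    apply Real.exp_le_one_iff.2
    have := abs_nonneg x
    have := abs_nonneg y
    linarith
  have hl0 : 0 < l := by linarith
  have hts : ∀ e x y : ℝ, tsgn e x * tsgn e y ≤ 1 ∧ -1 ≤ tsgn e x * tsgn e y := by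
    intro e x y
    have h1 := @tsgn_abs_le e x
    have h2 := @tsgn_abs_le e y
    have : |tsgn e x * tsgn e y| ≤ 1 := by
      rw [abs_mul]
      exact mul_le_one₀ h1 (abs_nonneg _) h2
    rw [abs_le] at this
    exact ⟨this.2, this.1⟩
  have hind : ∀ c : Prop, ∀ [Decidable c], (0:ℝ) ≤ (if c then (1:ℝ) else 0) ∧ (if c then (1:ℝ) else 0) ≤ 1 := by
    intro c _
    split_ifs <;> norm_num
  -- crude bound on the left
  have hL : l / 8 * ((if l ≤ |a' - a| then 1 else 0) * (if l ≤ |b' - b| then 1 else 0) * Q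
      + tsgn l (a' - a) * tsgn l (b' - b) * Q) ≤ Q := by
    have e1 := hind (l ≤ |a' - a|)
    have e2 := hind (l ≤ |b' - b|)
    have e3 := hts l (a' - a) (b' - b)
    have e4 : (if l ≤ |a' - a| then (1:ℝ) else 0) * (if l ≤ |b' - b| then (1:ℝ) else 0) ≤ 1 :=
      mul_le_one₀ e1.2 e2.1 e2.2
    have : ((if l ≤ |a' - a| then (1:ℝ) else 0) * (if l ≤ |b' - b| then (1:ℝ) else 0) * Q
      + tsgn l (a' - a) * tsgn l (b' - b) * Q) ≤ 2 * Q := by nlinarith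
    nlinarith
  have hterm : ∀ e x y : ℝ, |tsgn e x * tsgn e y * Q * (Real.exp (-|x|) * Real.exp (-|y|))| ≤ Q := by
    intro e x y
    rw [abs_mul, abs_mul, abs_of_nonneg hQ, abs_of_nonneg (hex x y).1]
    have h1 : |tsgn e x * tsgn e y| ≤ 1 := abs_le.2 ⟨(hts e x y).2, (hts e x y).1⟩
    have h2 := hex x y
    have : |tsgn e x * tsgn e y| * Q ≤ 1 * Q := mul_le_mul_of_nonneg_right h1 hQ
    calc _ ≤ Q * 1 := mul_le_mul (by linarith) h2.2 h2.1 hQ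
      _ = Q := by ring
  have z1 := hind (|a' - a| < η)
  have z2 := hind (|b' - b| < η)
  have z3 := hind (|b - a| < η)
  have z4 := hind (|b' - a'| < η)
  have t1 := abs_le.1 (hterm η (a' - a) (b' - b))
  have t2 := abs_le.1 (hterm η (b - a) (b' - a'))
  by_cases c1 : |a' - a| < η
  · rw [tsgn_abs_lt c1] at t1 ⊢
    rw [if_pos c1] 
    nlinarith [mul_nonneg z2.1 hQ, mul_nonneg z3.1 hQ, mul_nonneg z4.1 hQ]
  by_cases c2 : |b' - b| < η
  · rw [tsgn_abs_lt c2] at t1 ⊢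
    rw [if_pos c2] 
    nlinarith [mul_nonneg z1.1 hQ, mul_nonneg z3.1 hQ, mul_nonneg z4.1 hQ]
  by_cases c3 : |b - a| < η
  · rw [tsgn_abs_lt c3] at t2 ⊢
    rw [if_pos c3] 
    nlinarith [mul_nonneg z2.1 hQ, mul_nonneg z1.1 hQ, mul_nonneg z4.1 hQ]
  by_cases c4 : |b' - a'| < η
  · rw [tsgn_abs_lt c4] at t2 ⊢
    rw [if_pos c4] 
    nlinarith [mul_nonneg z2.1 hQ, mul_nonneg z3.1 hQ, mul_nonneg z1.1 hQ]
  rcases hQ.eq_or_lt with hQ0 | hQ0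
  · rw [← hQ0]; simp
  push Not at c1 c2 c3 c4
  obtain ⟨m1, m2⟩ := hD hQ0 c1 c2 c3 c4
  have na : a ≠ a' := by rintro rfl; simp at c1; linarith
  have nb : b ≠ b' := by rintro rfl; simp at c2; linarith
  have hsg : ∀ e x, 0 < e → e ≤ |x| → (0 < x → tsgn e x = 1) ∧ (x < 0 → tsgn e x = -1) := by
    intro e x he hx
    constructor
    · intro h; rw [abs_of_pos h] at hx; exact tsgn_pos hx
    · intro h; rw [abs_of_neg h] at hx; exact tsgn_neg he (by linarith)
  have hprod : ∀ e x y, 0 < e → e ≤ |x| → e ≤ |y| → (0 < x * y → tsgn e x * tsgn e y = 1) ∧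
      (x * y < 0 → tsgn e x * tsgn e y = -1) := by
    intro e x y he hx hy
    constructor
    · intro h
      rcases mul_pos_iff.1 h with ⟨h1, h2⟩ | ⟨h1, h2⟩
      · rw [(hsg e x he hx).1 h1, (hsg e y he hy).1 h2]; norm_num
      · rw [(hsg e x he hx).2 h1, (hsg e y he hy).2 h2]; norm_num
    · intro h
      rcases mul_neg_iff.1 h with ⟨h1, h2⟩ | ⟨h1, h2⟩
      · rw [(hsg e x he hx).1 h1, (hsg e y he hy).2 h2]; norm_num
      · rw [(hsg e x he hx).2 h1, (hsg e y he hy).1 h2]; norm_num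
  rw [if_neg (not_lt.2 c1), if_neg (not_lt.2 c2), if_neg (not_lt.2 c3), if_neg (not_lt.2 c4)]
  rw [← Real.exp_add, ← Real.exp_add]
  rcases nonInter_dich m1 m2 na nb with ⟨s1, s2, s3⟩ | ⟨s1, s2, s3⟩
  · rw [(hprod η _ _ hη c1 c2).1 s1, (hprod η _ _ hη c3 c4).2 s2]
    by_cases g : l ≤ |a' - a| ∧ l ≤ |b' - b|
    · rw [if_pos g.1, if_pos g.2, (hprod l _ _ hl0 g.1 g.2).1 s1]
      have h3 := s3 l g.1 g.2
      have e1 : Real.exp (-|a' - a| + -|b' - b|) * (1 + 2 * l) ≤ Real.exp (-|b - a| + -|b' - a'|) := by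
        calc _ ≤ Real.exp (-|a' - a| + -|b' - b|) * Real.exp (2 * l) := by
              gcongr
              linarith [Real.add_one_le_exp (2 * l)]
          _ = Real.exp (-|a' - a| + -|b' - b| + 2 * l) := (Real.exp_add _ _).symm
          _ ≤ _ := Real.exp_le_exp.2 (by linarith)
      have e2 : (1:ℝ)/8 ≤ Real.exp (-|a' - a| + -|b' - b|) := by
        calc (1:ℝ)/8 ≤ Real.exp (-2) := by
              rw [Real.exp_neg, show (2:ℝ) = 1 + 1 by norm_num, Real.exp_add, one_div]
              apply inv_anti₀ (by positivity)
              have := Real.exp_one_lt_d9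
              nlinarith [Real.exp_pos 1]
          _ ≤ _ := Real.exp_le_exp.2 (by linarith)
      nlinarith [mul_pos hl0 hQ0]
    · have h0 : tsgn l (a' - a) * tsgn l (b' - b) = 0 ∧ (if l ≤ |a' - a| then (1:ℝ) else 0) * (if l ≤ |b' - b| then (1:ℝ) else 0) = 0 := by
        rw [not_and_or] at g
        rcases g with g | g
        · rw [if_neg g, tsgn_abs_lt (not_le.1 g)]; simp
        · rw [if_neg g, tsgn_abs_lt (not_le.1 g)]; simp
      rw [h0.1, h0.2]
      have h3 := s3 0 (abs_nonneg _) (abs_nonneg _)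
      have : Real.exp (-|a' - a| + -|b' - b|) ≤ Real.exp (-|b - a| + -|b' - a'|) :=
        Real.exp_le_exp.2 (by linarith)
      nlinarith
  · rw [(hprod η _ _ hη c1 c2).2 s1, (hprod η _ _ hη c3 c4).1 s2]
    have h0 : ((if l ≤ |a' - a| then (1:ℝ) else 0) * (if l ≤ |b' - b| then (1:ℝ) else 0) + tsgn l (a' - a) * tsgn l (b' - b)) = 0 := by
      by_cases g : l ≤ |a' - a| ∧ l ≤ |b' - b|
      · rw [if_pos g.1, if_pos g.2, (hprod l _ _ hl0 g.1 g.2).2 s1]; norm_num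
      · rw [not_and_or] at g
        rcases g with g | g
        · rw [if_neg g, tsgn_abs_lt (not_le.1 g)]; simp
        · rw [if_neg g, tsgn_abs_lt (not_le.1 g)]; simp
    rw [← add_mul, h0]
    have : Real.exp (-|b - a| + -|b' - a'|) ≤ Real.exp (-|a' - a| + -|b' - b|) :=
        Real.exp_le_exp.2 (by linarith)
    nlinarith

lemma deg_bound {α : Type*} (P : Finset α) (w : α → α → ℝ) (i : α → α → α → ℝ) (Z M W : ℝ)
    (hw : ∀ p ∈ P, ∀ q ∈ P, 0 ≤ w p q) (hi : ∀ p ∈ P, ∀ q ∈ P, ∀ q' ∈ P, 0 ≤ i p q q')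
    (hW : ∀ p ∈ P, ∀ q ∈ P, w p q ≤ W) (hW0 : 0 ≤ W) (hZ0 : 0 ≤ Z) (hM0 : 0 ≤ M)
    (hr : ∀ p ∈ P, ∑ q ∈ P, w p q ≤ Z) (hc : ∀ q ∈ P, ∑ p ∈ P, w p q ≤ Z)
    (hM : ∀ p ∈ P, ∀ q ∈ P, 0 < w p q → ∑ q' ∈ P, w p q' * i p q q' ≤ M) :
    ∑ p ∈ P, ∑ p' ∈ P, ∑ q ∈ P, ∑ q' ∈ P, i p q q' * (w p q * w p q' * w p' q * w p' q')
      ≤ P.card * (Z ^ 2 * M * W) := by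
  rw [← nsmul_eq_mul]
  apply Finset.sum_le_card_nsmul
  intro p hp
  rw [Finset.sum_comm]
  calc ∑ q ∈ P, ∑ p' ∈ P, ∑ q' ∈ P, i p q q' * (w p q * w p q' * w p' q * w p' q')
      ≤ ∑ q ∈ P, ∑ p' ∈ P, ∑ q' ∈ P, W * ((w p q * w p' q) * (w p q' * i p q q')) := by
        refine Finset.sum_le_sum fun q hq => Finset.sum_le_sum fun p' hp' => Finset.sum_le_sum fun q' hq' => ?_
        have h1 := hW p' hp' q' hq'
        have h2 : 0 ≤ (w p q * w p' q) * (w p q' * i p q q') :=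
          mul_nonneg (mul_nonneg (hw _ hp _ hq) (hw _ hp' _ hq)) (mul_nonneg (hw _ hp _ hq') (hi _ hp _ hq _ hq'))
        nlinarith
    _ = ∑ q ∈ P, W * (w p q * ((∑ p' ∈ P, w p' q) * (∑ q' ∈ P, w p q' * i p q q'))) := by
        refine Finset.sum_congr rfl fun q hq => ?_
        rw [Finset.sum_mul_sum, Finset.mul_sum, Finset.mul_sum]
        refine Finset.sum_congr rfl fun p' hp' => ?_
        rw [Finset.mul_sum, Finset.mul_sum]
        refine Finset.sum_congr rfl fun q' hq' => ?_
        ring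
    _ ≤ ∑ q ∈ P, W * (w p q * (Z * M)) := by
        refine Finset.sum_le_sum fun q hq => ?_
        rcases (hw p hp q hq).eq_or_lt with h | h
        · rw [← h]; simp
        · gcongr
          · exact Finset.sum_nonneg fun q' hq' => mul_nonneg (hw _ hp _ hq') (hi _ hp _ hq _ hq')
          · exact hc q hq
          · exact hM p hp q hq h
    _ = W * (Z * M) * ∑ q ∈ P, w p q := by
        rw [Finset.mul_sum]
        refine Finset.sum_congr rfl fun q hq => ?_
        ring
    _ ≤ W * (Z * M) * Z := by
        gcongr
        exact hr p hp
    _ = _ := by ring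

lemma sq_sum_aux {α : Type*} (P : Finset α) (u : α → α → α → ℝ) :
    ∑ p ∈ P, ∑ p' ∈ P, ∑ q ∈ P, ∑ q' ∈ P, u p q q' * u p' q q'
      = ∑ q ∈ P, ∑ q' ∈ P, (∑ p ∈ P, u p q q') ^ 2 := by
  have : ∀ q q', (∑ p ∈ P, u p q q') ^ 2 = ∑ p ∈ P, ∑ p' ∈ P, u p q q' * u p' q q' := by
    intro q q'
    rw [sq, Finset.sum_mul_sum]
  simp only [this]
  symm
  calc _ = ∑ q ∈ P, ∑ p ∈ P, ∑ q' ∈ P, ∑ p' ∈ P, u p q q' * u p' q q' :=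
        Finset.sum_congr rfl fun q _ => Finset.sum_comm
    _ = ∑ p ∈ P, ∑ q ∈ P, ∑ q' ∈ P, ∑ p' ∈ P, u p q q' * u p' q q' := Finset.sum_comm
    _ = ∑ p ∈ P, ∑ q ∈ P, ∑ p' ∈ P, ∑ q' ∈ P, u p q q' * u p' q q' :=
        Finset.sum_congr rfl fun p _ => Finset.sum_congr rfl fun q _ => Finset.sum_comm
    _ = _ := Finset.sum_congr rfl fun p _ => Finset.sum_comm

lemma core {α : Type*} (P : Finset α) (w a : α → α → ℝ) (η l Z M W : ℝ)
    (hη : 0 < η) (hl : η ≤ l) (hl1 : l ≤ 1)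
    (hw : ∀ p ∈ P, ∀ q ∈ P, 0 ≤ w p q)
    (ha : ∀ p ∈ P, ∀ q ∈ P, ∀ q' ∈ P, |a p q' - a p q| ≤ 1)
    (hD : ∀ p ∈ P, ∀ p' ∈ P, ∀ q ∈ P, ∀ q' ∈ P, 0 < w p q → 0 < w p q' → 0 < w p' q → 0 < w p' q' →
      η ≤ |a p q' - a p q| → η ≤ |a p' q' - a p' q| → η ≤ |a p' q - a p q| → η ≤ |a p' q' - a p q'| →
      NonInter (a p q) (a p q') (a p' q) (a p' q') ∧ NonInter (a p q) (a p' q) (a p q') (a p' q'))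
    (hW : ∀ p ∈ P, ∀ q ∈ P, w p q ≤ W) (hW0 : 0 ≤ W) (hZ0 : 0 ≤ Z) (hM0 : 0 ≤ M)
    (hr : ∀ p ∈ P, ∑ q ∈ P, w p q ≤ Z) (hc : ∀ q ∈ P, ∑ p ∈ P, w p q ≤ Z)
    (hM : ∀ p ∈ P, ∀ q ∈ P, 0 < w p q → ∑ q' ∈ P, w p q' * (if |a p q' - a p q| < η then 1 else 0) ≤ M)
    (hM' : ∀ q ∈ P, ∀ p ∈ P, 0 < w p q → ∑ p' ∈ P, w p' q * (if |a p' q - a p q| < η then 1 else 0) ≤ M) :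
    l * ∑ q ∈ P, ∑ q' ∈ P, (∑ p ∈ P, (if l ≤ |a p q' - a p q| then 1 else 0) * (w p q * w p q')) ^ 2
      ≤ 64 * (P.card * (Z ^ 2 * M * W)) := by
  have key : ∑ p ∈ P, ∑ p' ∈ P, ∑ q ∈ P, ∑ q' ∈ P, (
      l / 8 * (((if l ≤ |a p q' - a p q| then 1 else 0) * (w p q * w p q')) * ((if l ≤ |a p' q' - a p' q| then 1 else 0) * (w p' q * w p' q')))
      + l / 8 * ((tsgn l (a p q' - a p q) * (w p q * w p q')) * (tsgn l (a p' q' - a p' q) * (w p' q * w p' q'))))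
      ≤ ∑ p ∈ P, ∑ p' ∈ P, ∑ q ∈ P, ∑ q' ∈ P, (
      - ((tsgn η (a p q' - a p q) * (w p q * w p q') * Real.exp (-|a p q' - a p q|)) * (tsgn η (a p' q' - a p' q) * (w p' q * w p' q') * Real.exp (-|a p' q' - a p' q|)))
      - ((tsgn η (a p' q - a p q) * (w p q * w p' q) * Real.exp (-|a p' q - a p q|)) * (tsgn η (a p' q' - a p q') * (w p q' * w p' q') * Real.exp (-|a p' q' - a p q'|)))
      + 2 * ((if |a p q' - a p q| < η then 1 else 0) * (w p q * w p q' * w p' q * w p' q'))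
      + 2 * ((if |a p' q' - a p' q| < η then 1 else 0) * (w p' q * w p' q' * w p q * w p q'))
      + 2 * ((if |a p' q - a p q| < η then 1 else 0) * (w p q * w p' q * w p q' * w p' q'))
      + 2 * ((if |a p' q' - a p q'| < η then 1 else 0) * (w p q' * w p' q' * w p q * w p' q))) := by
    refine Finset.sum_le_sum fun p hp => Finset.sum_le_sum fun p' hp' =>
      Finset.sum_le_sum fun q hq => Finset.sum_le_sum fun q' hq' => ?_
    have h1 := hw p hp q hq
    have h2 := hw p hp q' hq'
    have h3 := hw p' hp' q hq
    have h4 := hw p' hp' q' hq'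
    have := core_pointwise (a := a p q) (a' := a p q') (b := a p' q) (b' := a p' q') (Q := w p q * w p q' * (w p' q * w p' q')) hη hl hl1
      (by positivity) (ha p hp q hq q' hq') (ha p' hp' q hq q' hq') (by
        intro hQ
        have e1 : 0 < w p q := h1.lt_of_ne (by rintro h; rw [← h] at hQ; simp at hQ)
        have e2 : 0 < w p q' := h2.lt_of_ne (by rintro h; rw [← h] at hQ; simp at hQ)
        have e3 : 0 < w p' q := h3.lt_of_ne (by rintro h; rw [← h] at hQ; simp at hQ)
        have e4 : 0 < w p' q' := h4.lt_of_ne (by rintro h; rw [← h] at hQ; simp at hQ)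
        exact hD p hp p' hp' q hq q' hq' e1 e2 e3 e4)
    refine le_trans (le_of_eq ?_) (this.trans (le_of_eq ?_)) <;> ring
  simp only [Finset.sum_add_distrib, Finset.sum_sub_distrib, Finset.sum_neg_distrib, ← Finset.mul_sum P _ (l / 8), ← Finset.mul_sum P _ (2 : ℝ)] at key
  have s1 := sq_sum_aux P (fun p q q' => (if l ≤ |a p q' - a p q| then 1 else 0) * (w p q * w p q'))
  have s2 := sq_sum_aux P (fun p q q' => tsgn l (a p q' - a p q) * (w p q * w p q'))
  have s3 := sq_sum_aux P (fun p q q' => tsgn η (a p q' - a p q) * (w p q * w p q') * Real.exp (-|a p q' - a p q|))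
  have s4 := sq_sum_aux P (fun q p p' => tsgn η (a p' q - a p q) * (w p q * w p' q) * Real.exp (-|a p' q - a p q|))
  have comm4 : ∀ g : α → α → α → α → ℝ, ∑ p ∈ P, ∑ p' ∈ P, ∑ q ∈ P, ∑ q' ∈ P, g p p' q q'
      = ∑ q ∈ P, ∑ q' ∈ P, ∑ p ∈ P, ∑ p' ∈ P, g p p' q q' := by
    intro g
    calc _ = ∑ p ∈ P, ∑ q ∈ P, ∑ p' ∈ P, ∑ q' ∈ P, g p p' q q' :=
          Finset.sum_congr rfl fun p _ => Finset.sum_comm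
      _ = ∑ q ∈ P, ∑ p ∈ P, ∑ p' ∈ P, ∑ q' ∈ P, g p p' q q' := Finset.sum_comm
      _ = ∑ q ∈ P, ∑ p ∈ P, ∑ q' ∈ P, ∑ p' ∈ P, g p p' q q' :=
          Finset.sum_congr rfl fun p _ => Finset.sum_congr rfl fun p _ => Finset.sum_comm
      _ = _ := Finset.sum_congr rfl fun p _ => Finset.sum_comm
  rw [s1, s2, s3, comm4 (fun p p' q q' => (tsgn η (a p' q - a p q) * (w p q * w p' q) * Real.exp (-|a p' q - a p q|)) * (tsgn η (a p' q' - a p q') * (w p q' * w p' q') * Real.exp (-|a p' q' - a p q'|))), s4] at key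
  have nn : ∀ g : α → α → ℝ, 0 ≤ ∑ q ∈ P, ∑ q' ∈ P, (g q q') ^ 2 := fun g =>
    Finset.sum_nonneg fun _ _ => Finset.sum_nonneg fun _ _ => sq_nonneg _
  have n2 := nn (fun q q' => ∑ p ∈ P, tsgn l (a p q' - a p q) * (w p q * w p q'))
  have n3 := nn (fun q q' => ∑ p ∈ P, tsgn η (a p q' - a p q) * (w p q * w p q') * Real.exp (-|a p q' - a p q|))
  have n4 := nn (fun p p' => ∑ q ∈ P, tsgn η (a p' q - a p q) * (w p q * w p' q) * Real.exp (-|a p' q - a p q|))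
  have hind : ∀ c : Prop, ∀ [Decidable c], (0:ℝ) ≤ (if c then (1:ℝ) else 0) := by
    intro c _
    split_ifs <;> norm_num
  have d1 := deg_bound P w (fun p q q' => if |a p q' - a p q| < η then 1 else 0) Z M W hw
    (fun p _ q _ q' _ => hind _) hW hW0 hZ0 hM0 hr hc hM
  have d3 := deg_bound P (fun q p => w p q) (fun q p p' => if |a p' q - a p q| < η then 1 else 0) Z M W (fun q hq p hp => hw p hp q hq)
    (fun p _ q _ q' _ => hind _) (fun q hq p hp => hW p hp q hq) hW0 hZ0 hM0 hc hr hM'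
  have d2 := d1
  rw [Finset.sum_comm] at d2
  have d4 := d3
  rw [Finset.sum_comm] at d4
  rw [comm4] at d3 d4
  have hl0 : 0 < l := by linarith
  have n2' := mul_nonneg (by positivity : 0 ≤ l / 8) n2
  linarith

/-- difference functions: three-parameter cinematic control -/
structure Jet (h h1 h2 : ℝ → ℝ) (lo hi D l0 l1 l2 : ℝ) : Prop where
  d1 : ∀ x ∈ Icc lo hi, HasDerivAt h (h1 x) x
  d2 : ∀ x ∈ Icc lo hi, HasDerivAt h1 (h2 x) x
  e0 : ∀ x ∈ Icc lo hi, |h x - l0| ≤ D / 100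
  e1 : ∀ x ∈ Icc lo hi, |h1 x - l1| ≤ D / 100
  e2 : ∀ x ∈ Icc lo hi, |h2 x - l2| ≤ D / 100
  hD : D ≤ |l0| ∨ D ≤ |l1| ∨ D ≤ |l2|
  Dpos : 0 < D

namespace Jet
variable {h h1 h2 : ℝ → ℝ} {lo hi D l0 l1 l2 : ℝ}

lemma neg (J : Jet h h1 h2 lo hi D l0 l1 l2) :
    Jet (fun x => -h x) (fun x => -h1 x) (fun x => -h2 x) lo hi D (-l0) (-l1) (-l2) where
  d1 x hx := (J.d1 x hx).neg
  d2 x hx := (J.d2 x hx).neg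
  e0 x hx := by
    have := J.e0 x hx
    rwa [show -h x - -l0 = -(h x - l0) by ring, abs_neg]
  e1 x hx := by
    have := J.e1 x hx
    rwa [show -h1 x - -l1 = -(h1 x - l1) by ring, abs_neg]
  e2 x hx := by
    have := J.e2 x hx
    rwa [show -h2 x - -l2 = -(h2 x - l2) by ring, abs_neg]
  hD := by simpa only [abs_neg] using J.hD
  Dpos := J.Dpos

lemma mvt (J : Jet h h1 h2 lo hi D l0 l1 l2) {x y : ℝ} (hx : x ∈ Icc lo hi) (hy : y ∈ Icc lo hi)
    (hxy : x < y) : ∃ c ∈ Ioo x y, c ∈ Icc lo hi ∧ h y - h x = h1 c * (y - x) := by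
  have hsub : ∀ z ∈ Icc x y, z ∈ Icc lo hi := fun z hz => ⟨hx.1.trans hz.1, hz.2.trans hy.2⟩
  obtain ⟨c, hc, e⟩ := exists_hasDerivAt_eq_slope h h1 hxy
    (fun z hz => (J.d1 z (hsub z hz)).continuousAt.continuousWithinAt)
    (fun z hz => J.d1 z (hsub z (Ioo_subset_Icc_self hz)))
  refine ⟨c, hc, hsub c (Ioo_subset_Icc_self hc), ?_⟩
  rw [e]
  field_simp [(sub_pos.2 hxy).ne']

lemma mvt1 (J : Jet h h1 h2 lo hi D l0 l1 l2) {x y : ℝ} (hx : x ∈ Icc lo hi) (hy : y ∈ Icc lo hi)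
    (hxy : x < y) : ∃ c ∈ Ioo x y, c ∈ Icc lo hi ∧ h1 y - h1 x = h2 c * (y - x) := by
  have hsub : ∀ z ∈ Icc x y, z ∈ Icc lo hi := fun z hz => ⟨hx.1.trans hz.1, hz.2.trans hy.2⟩
  obtain ⟨c, hc, e⟩ := exists_hasDerivAt_eq_slope h1 h2 hxy
    (fun z hz => (J.d2 z (hsub z hz)).continuousAt.continuousWithinAt)
    (fun z hz => J.d2 z (hsub z (Ioo_subset_Icc_self hz)))
  refine ⟨c, hc, hsub c (Ioo_subset_Icc_self hc), ?_⟩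
  rw [e]
  field_simp [(sub_pos.2 hxy).ne']

lemma small_l0 (J : Jet h h1 h2 lo hi D l0 l1 l2) {x δ : ℝ} (hx : x ∈ Icc lo hi)
    (h0 : |h x| ≤ 4 * δ) (hd : 100 * δ < D) : |l0| < D / 10 := by
  have := J.e0 x hx
  rw [abs_le] at *
  rw [abs_lt]
  constructor <;> linarith [J.Dpos]

lemma transverse (J : Jet h h1 h2 lo hi D l0 l1 l2) {x y σ δ : ℝ} (hx : x ∈ Icc lo hi)
    (hy : y ∈ Icc lo hi) (hxy : x < y) (hd : 100 * δ < D) (hσ : 0 < σ) (hσD : σ ≤ D / 20)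
    (x0 : |h x| ≤ 4 * δ) (y0 : |h y| ≤ 4 * δ) (x1 : σ ≤ h1 x) (y1 : σ ≤ h1 y) :
    (y - x) * σ ≤ 8 * δ := by
  have key : ∀ z ∈ Ioo x y, σ ≤ h1 z := by
    intro z hz
    have hzI : z ∈ Icc lo hi := ⟨hx.1.trans hz.1.le, hz.2.le.trans hy.2⟩
    have hl0 := J.small_l0 hx x0 hd
    by_cases c : D / 10 ≤ |l1|
    · have e1 := abs_le.1 (J.e1 x hx)
      have e2 := abs_le.1 (J.e1 z hzI)
      rcases le_abs.1 c with c | c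
      · linarith [J.Dpos]
      · linarith [J.Dpos]
    · have hD2 : D ≤ |l2| := by
        rcases J.hD with h | h | h
        · linarith [J.Dpos]
        · linarith [J.Dpos]
        · exact h
      obtain ⟨a, ha, haI, ea⟩ := J.mvt1 hx hzI hz.1
      obtain ⟨b, hb, hbI, eb⟩ := J.mvt1 hzI hy hz.2
      have f1 := abs_le.1 (J.e2 a haI)
      have f2 := abs_le.1 (J.e2 b hbI)
      have g1 := sub_pos.2 hz.1
      have g2 := sub_pos.2 hz.2
      rcases le_abs.1 hD2 with c | c
      · have : 0 ≤ h2 a := by linarith [J.Dpos]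
        nlinarith
      · have : h2 b ≤ 0 := by linarith [J.Dpos]
        nlinarith
  obtain ⟨c, hc, _, e⟩ := J.mvt hx hy hxy
  have := key c hc
  have h1 := abs_le.1 x0
  have h2 := abs_le.1 y0
  nlinarith [sub_pos.2 hxy]

lemma tangent (J : Jet h h1 h2 lo hi D l0 l1 l2) {x δ : ℝ} (hx : x ∈ Icc lo hi)
    (hd : 100 * δ < D) (x0 : |h x| ≤ 4 * δ) (x1 : |h1 x| ≤ D / 20) : D ≤ |l2| := by
  have hl0 := J.small_l0 hx x0 hd
  have := abs_le.1 (J.e1 x hx)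
  have x1 := abs_le.1 x1
  have : |l1| < D := by
    rw [abs_lt]
    constructor <;> linarith [J.Dpos]
  rcases J.hD with h | h | h
  · linarith [J.Dpos]
  · linarith [J.Dpos]
  · exact h

lemma convex_of (J : Jet h h1 h2 lo hi D l0 l1 l2) (hl : D ≤ l2) {x : ℝ} (hx : x ∈ Icc lo hi) :
    0.9 * D ≤ h2 x := by
  have := abs_le.1 (J.e2 x hx)
  linarith [J.Dpos]

lemma tangent_len (J : Jet h h1 h2 lo hi D l0 l1 l2) (hl : D ≤ l2) {x y σ : ℝ} (hx : x ∈ Icc lo hi)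
    (hy : y ∈ Icc lo hi) (x1 : |h1 x| ≤ σ) (y1 : |h1 y| ≤ σ) : |y - x| * D ≤ 3 * σ := by
  have key : ∀ x y, x ∈ Icc lo hi → y ∈ Icc lo hi → |h1 x| ≤ σ → |h1 y| ≤ σ → x < y → (y - x) * D ≤ 3 * σ := by
    intro x y hx hy x1 y1 hxy
    obtain ⟨c, _, hc, e⟩ := J.mvt1 hx hy hxy
    have := J.convex_of hl hc
    have g := sub_pos.2 hxy
    have x1 := abs_le.1 x1
    have y1 := abs_le.1 y1
    nlinarith [mul_pos g J.Dpos]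
  rcases lt_trichotomy x y with c | c | c
  · rw [abs_of_pos (sub_pos.2 c)]; exact key x y hx hy x1 y1 c
  · subst c; simp; linarith [abs_nonneg (h1 x)]
  · rw [abs_of_neg (sub_neg.2 c), neg_sub]; exact key y x hy hx y1 x1 c

lemma quad (J : Jet h h1 h2 lo hi D l0 l1 l2) {c : ℝ} (hc : ∀ x ∈ Icc lo hi, c ≤ h2 x) {x y : ℝ} (hx : x ∈ Icc lo hi)
    (hy : y ∈ Icc lo hi) : h x + h1 x * (y - x) + c / 2 * (y - x) ^ 2 ≤ h y := by
  have dk : ∀ z ∈ Icc lo hi, HasDerivAt (fun z => h z - h1 x * (z - x) - c / 2 * (z - x) ^ 2)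
      (h1 z - h1 x - c * (z - x)) z := by
    intro z hz
    have e1 : HasDerivAt (fun z : ℝ => z - x) 1 z := (hasDerivAt_id z).sub_const x
    have := ((J.d1 z hz).sub (e1.const_mul (h1 x))).sub ((e1.pow 2).const_mul (c / 2))
    refine this.congr_deriv ?_
    simp
    ring
  rcases lt_trichotomy x y with hxy | hxy | hxy
  · have hsub : ∀ z ∈ Icc x y, z ∈ Icc lo hi := fun z hz => ⟨hx.1.trans hz.1, hz.2.trans hy.2⟩
    obtain ⟨z, hz, e⟩ := exists_hasDerivAt_eq_slope _ _ hxy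
      (fun z hz => (dk z (hsub z hz)).continuousAt.continuousWithinAt)
      (fun z hz => dk z (hsub z (Ioo_subset_Icc_self hz)))
    rw [eq_div_iff (sub_pos.2 hxy).ne'] at e
    obtain ⟨b, hb, hbI, eb⟩ := J.mvt1 hx (hsub z (Ioo_subset_Icc_self hz)) hz.1
    have := hc b hbI
    have g : 0 ≤ h1 z - h1 x - c * (z - x) := by nlinarith [sub_pos.2 hz.1]
    nlinarith [mul_nonneg g (sub_pos.2 hxy).le]
  · subst hxy; simp
  · have hsub : ∀ z ∈ Icc y x, z ∈ Icc lo hi := fun z hz => ⟨hy.1.trans hz.1, hz.2.trans hx.2⟩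
    obtain ⟨z, hz, e⟩ := exists_hasDerivAt_eq_slope _ _ hxy
      (fun z hz => (dk z (hsub z hz)).continuousAt.continuousWithinAt)
      (fun z hz => dk z (hsub z (Ioo_subset_Icc_self hz)))
    rw [eq_div_iff (sub_pos.2 hxy).ne'] at e
    obtain ⟨b, hb, hbI, eb⟩ := J.mvt1 (hsub z (Ioo_subset_Icc_self hz)) hx hz.2
    have := hc b hbI
    have g : h1 z - h1 x - c * (z - x) ≤ 0 := by nlinarith [sub_pos.2 hz.2]
    nlinarith [mul_nonneg (neg_nonneg.2 g) (sub_pos.2 hxy).le]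

/-- sign lemma -/
lemma away (J : Jet h h1 h2 lo hi D l0 l1 l2) {d σ δ : ℝ} (hd : 0 < d) (hσ : 0 < σ)
    (hc : ∀ x ∈ Icc lo hi, 0.45 * d ≤ h2 x)
    (hδ : δ * d ≤ 2 * σ ^ 2) {x y : ℝ} (hx : x ∈ Icc lo hi)
    (hy : y ∈ Icc lo hi) (x0 : |h x| ≤ 4 * δ) (x1 : |h1 x| ≤ σ) (hxy : 40 * σ / d ≤ |y - x|) :
    4 * δ < h y := by
  have q := J.quad hc hx hy
  have x0 := abs_le.1 x0
  have e : h1 x * (y - x) ≥ - (σ * |y - x|) := by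
    have := abs_mul (h1 x) (y - x)
    have h3 := neg_abs_le (h1 x * (y - x))
    have : |h1 x| * |y - x| ≤ σ * |y - x| := mul_le_mul_of_nonneg_right x1 (abs_nonneg _)
    linarith
  rw [← sq_abs (y - x)] at q
  rw [div_le_iff₀ hd] at hxy
  set u := |y - x|
  have hu : 0 < u := by
    rcases (abs_nonneg (y - x)).eq_or_lt with h | h
    · exfalso
      have : u = 0 := h.symm
      rw [this] at hxy
      linarith
    · exact h
  have h3 : 40 * σ * u ≤ d * u ^ 2 := by nlinarith
  have h4 : 40 * σ * (40 * σ) ≤ (u * d) * (u * d) := by nlinarith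
  have h5 : 8 * δ < 0.2 * d * u ^ 2 := by
    have : 8 * (δ * d) < 0.2 * d * u ^ 2 * d := by nlinarith
    nlinarith
  linarith

lemma ivt (J : Jet h h1 h2 lo hi D l0 l1 l2) {x y : ℝ} (hx : x ∈ Icc lo hi) (hy : y ∈ Icc lo hi)
    (hxy : x < y) (hs : h x * h y < 0) : ∃ z ∈ Ioo x y, h z = 0 := by
  have hsub : ∀ z ∈ Icc x y, z ∈ Icc lo hi := fun z hz => ⟨hx.1.trans hz.1, hz.2.trans hy.2⟩
  have hcont : ContinuousOn h (Icc x y) := fun z hz => (J.d1 z (hsub z hz)).continuousAt.continuousWithinAt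
  rcases mul_neg_iff.1 hs with ⟨a, b⟩ | ⟨a, b⟩
  · obtain ⟨z, hz, e⟩ := intermediate_value_Ioo' hxy.le hcont ⟨b, a⟩
    exact ⟨z, hz, e⟩
  · obtain ⟨z, hz, e⟩ := intermediate_value_Ioo hxy.le hcont ⟨a, b⟩
    exact ⟨z, hz, e⟩

lemma no_four (J : Jet h h1 h2 lo hi D l0 l1 l2) {x y z w : ℝ} (hx : x ∈ Icc lo hi)
    (hy : y ∈ Icc lo hi) (hz : z ∈ Icc lo hi) (hw : w ∈ Icc lo hi) (xy : x < y) (yz : y < z)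
    (zw : z < w) (s1 : h x * h y < 0) (s2 : h y * h z < 0) (s3 : h z * h w < 0) : False := by
  obtain ⟨a, ha, a0⟩ := J.ivt hx hy xy s1
  obtain ⟨b, hb, b0⟩ := J.ivt hy hz yz s2
  obtain ⟨c, hc, c0⟩ := J.ivt hz hw zw s3
  have haI : a ∈ Icc lo hi := ⟨hx.1.trans ha.1.le, ha.2.le.trans hy.2⟩
  have hbI : b ∈ Icc lo hi := ⟨hy.1.trans hb.1.le, hb.2.le.trans hz.2⟩
  have hcI : c ∈ Icc lo hi := ⟨hz.1.trans hc.1.le, hc.2.le.trans hw.2⟩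
  have ab : a < b := ha.2.trans hb.1
  have bc : b < c := hb.2.trans hc.1
  obtain ⟨u, hu, uI, eu⟩ := J.mvt haI hbI ab
  obtain ⟨v, hv, vI, ev⟩ := J.mvt hbI hcI bc
  rw [a0, b0, sub_self, eq_comm, mul_eq_zero, or_iff_left (sub_pos.2 ab).ne'] at eu
  rw [c0, b0, sub_self, eq_comm, mul_eq_zero, or_iff_left (sub_pos.2 bc).ne'] at ev
  have uv : u < v := hu.2.trans hv.1
  obtain ⟨k, hk, kI, ek⟩ := J.mvt1 uI vI uv
  rw [eu, ev, sub_self, eq_comm, mul_eq_zero, or_iff_left (sub_pos.2 uv).ne'] at ek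
  have f0 := J.e0 a haI
  have f1 := J.e1 u uI
  have f2 := J.e2 k kI
  rw [a0, zero_sub, abs_neg] at f0
  rw [eu, zero_sub, abs_neg] at f1
  rw [ek, zero_sub, abs_neg] at f2
  rcases J.hD with h | h | h <;> linarith [J.Dpos]

lemma nonInter (J : Jet h h1 h2 lo hi D l0 l1 l2) {x y u v : ℝ} (hx : x ∈ Icc lo hi)
    (hy : y ∈ Icc lo hi) (hu : u ∈ Icc lo hi) (hv : v ∈ Icc lo hi) (x0 : 0 < h x) (y0 : 0 < h y)
    (u0 : h u < 0) (v0 : h v < 0) : NonInter x y u v := by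
  have m : ∀ a b, (a = x ∨ a = y) → (b = u ∨ b = v) → h a * h b < 0 ∧ h b * h a < 0 := by
    rintro a b (rfl | rfl) (rfl | rfl) <;> constructor <;> nlinarith
  have mI : ∀ a, (a = x ∨ a = y) → a ∈ Icc lo hi := by
    rintro a (rfl | rfl) <;> assumption
  have mI' : ∀ a, (a = u ∨ a = v) → a ∈ Icc lo hi := by
    rintro a (rfl | rfl) <;> assumption
  have c1 : min x y = x ∨ min x y = y := min_choice x y
  have c2 : max x y = x ∨ max x y = y := max_choice x y
  have c3 : min u v = u ∨ min u v = v := min_choice u v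
  have c4 : max u v = u ∨ max u v = v := max_choice u v
  refine ⟨?_, ?_, ?_, ?_, ?_, ?_⟩
  · rintro ⟨h1, h2, h3⟩
    exact J.no_four (mI _ c1) (mI' _ c3) (mI _ c2) (mI' _ c4) h1 h2 h3 (m _ _ c1 c3).1 (m _ _ c2 c3).2 (m _ _ c2 c4).1
  · rintro ⟨h1, h2, h3⟩
    exact J.no_four (mI' _ c3) (mI _ c1) (mI' _ c4) (mI _ c2) h1 h2 h3 (m _ _ c1 c3).2 (m _ _ c1 c4).1 (m _ _ c2 c4).2
  · rintro rfl; linarith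
  · rintro rfl; linarith
  · rintro rfl; linarith
  · rintro rfl; linarith

lemma three (J : Jet h h1 h2 lo hi D l0 l1 l2) {x y z g δ : ℝ} (hx : x ∈ Icc lo hi)
    (hy : y ∈ Icc lo hi) (hz : z ∈ Icc lo hi) (hg : 0 < g) (hg1 : g ≤ 1) (xy : g ≤ y - x) (yz : g ≤ z - y)
    (x0 : |h x| ≤ 4 * δ) (y0 : |h y| ≤ 4 * δ) (z0 : |h z| ≤ 4 * δ) : D * g ^ 2 ≤ 20 * δ := by
  have x0' := abs_le.1 x0
  have y0' := abs_le.1 y0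
  have z0' := abs_le.1 z0
  have hδ : 0 ≤ δ := by linarith [abs_nonneg (h x)]
  rcases J.hD with c | c | c
  · have : |l0| ≤ 4 * δ + D / 100 := by
      have := abs_sub_abs_le_abs_sub l0 (h x)
      have := J.e0 x hx
      rw [abs_sub_comm] at this
      linarith
    have : D ≤ 5 * δ := by linarith
    nlinarith [mul_le_mul hg1 hg1 hg.le (by norm_num), J.Dpos]
  · obtain ⟨k, hk, hkI, ek⟩ := J.mvt hx hy (by linarith)
    have e : |h1 k| * g ≤ 8 * δ := by
      have : |h1 k| * (y - x) = |h y - h x| := by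
        rw [ek, abs_mul, abs_of_pos (by linarith : 0 < y - x)]
      have h2 : |h y - h x| ≤ 8 * δ := abs_le.2 ⟨by linarith, by linarith⟩
      nlinarith [abs_nonneg (h1 k)]
    have : |l1| ≤ |h1 k| + D / 100 := by
      have := abs_sub_abs_le_abs_sub l1 (h1 k)
      have := J.e1 k hkI
      rw [abs_sub_comm] at this
      linarith
    have : D * g ≤ 10 * δ := by nlinarith [J.Dpos]
    nlinarith [mul_pos J.Dpos hg]
  · have key : ∀ {h h1 h2 : ℝ → ℝ} {l0 l1 l2 : ℝ}, Jet h h1 h2 lo hi D l0 l1 l2 → D ≤ l2 → |h x| ≤ 4 * δ → |h y| ≤ 4 * δ → |h z| ≤ 4 * δ → D * g ^ 2 ≤ 20 * δ := by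
      intro h h1 h2 l0 l1 l2 J hl x0 y0 z0
      have x0 := abs_le.1 x0
      have y0 := abs_le.1 y0
      have z0 := abs_le.1 z0
      rcases le_total 0 (h1 y) with s | s
      · have q := J.quad (fun x hx => J.convex_of hl hx) hy hz
        have : D * g ^ 2 ≤ D * (z - y) ^ 2 := by
          have := J.Dpos
          gcongr
        nlinarith [mul_nonneg s (by linarith : 0 ≤ z - y)]
      · have q := J.quad (fun x hx => J.convex_of hl hx) hy hx
        have : D * g ^ 2 ≤ D * (y - x) ^ 2 := by
          have := J.Dpos
          gcongr
        nlinarith [mul_nonneg (neg_nonneg.2 s) (by linarith : 0 ≤ y - x)]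
    rcases le_abs.1 c with c | c
    · exact key J c x0 y0 z0
    · exact key J.neg c (by simpa using x0) (by simpa using y0) (by simpa using z0)

end Jet

/-- cinematic family -/
structure Cine (f f1 f2 : (Fin 3 → ℝ) → ℝ → ℝ) (U : Set (Fin 3 → ℝ)) (lo hi : ℝ) : Prop where
  hle : lo ≤ hi
  hlen : hi - lo ≤ 1
  hd1 : ∀ u ∈ U, ∀ x ∈ Icc lo hi, HasDerivAt (f u) (f1 u x) x
  hd2 : ∀ u ∈ U, ∀ x ∈ Icc lo hi, HasDerivAt (f1 u) (f2 u x) x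
  hf1 : ∀ u ∈ U, ∀ x ∈ Icc lo hi, |f1 u x| ≤ 1
  c0 : ∀ u ∈ U, ∀ v ∈ U, ∀ x ∈ Icc lo hi, |f v x - f u x - (v 0 - u 0)| ≤ dist u v / 100
  c1 : ∀ u ∈ U, ∀ v ∈ U, ∀ x ∈ Icc lo hi, |f1 v x - f1 u x - (v 1 - u 1)| ≤ dist u v / 100
  c2 : ∀ u ∈ U, ∀ v ∈ U, ∀ x ∈ Icc lo hi, |f2 v x - f2 u x - (v 2 - u 2)| ≤ dist u v / 100

lemma Cine.jet {f f1 f2 : (Fin 3 → ℝ) → ℝ → ℝ} {U : Set (Fin 3 → ℝ)} {lo hi : ℝ}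
    (C : Cine f f1 f2 U lo hi) {u v : Fin 3 → ℝ} (hu : u ∈ U) (hv : v ∈ U) (huv : u ≠ v) :
    Jet (fun x => f v x - f u x) (fun x => f1 v x - f1 u x) (fun x => f2 v x - f2 u x) lo hi
      (dist u v) (v 0 - u 0) (v 1 - u 1) (v 2 - u 2) where
  d1 x hx := (C.hd1 v hv x hx).sub (C.hd1 u hu x hx)
  d2 x hx := (C.hd2 v hv x hx).sub (C.hd2 u hu x hx)
  e0 x hx := C.c0 u hu v hv x hx
  e1 x hx := C.c1 u hu v hv x hx
  e2 x hx := C.c2 u hu v hv x hx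
  hD := by
    by_contra hcon
    push Not at hcon
    obtain ⟨a, b, c⟩ := hcon
    have : dist u v < dist u v := by
      refine (dist_pi_lt_iff (dist_pos.2 huv)).2 fun i => ?_
      rw [Real.dist_eq, abs_sub_comm]
      fin_cases i
      · exact a
      · exact b
      · exact c
    exact lt_irrefl _ this
  Dpos := dist_pos.2 huv

/-- discretized configuration at scale `δ` -/
structure DiscHyp {β : Type*} [DecidableEq β] (f f1 f2 : (Fin 3 → ℝ) → ℝ → ℝ) (U : Set (Fin 3 → ℝ)) (lo hi : ℝ)
    (P : Finset (Fin 3 → ℝ)) (F : Finset β) (ξ y : β → ℝ) (T : (Fin 3 → ℝ) → Finset β)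
    (δ s t Λ : ℝ) : Prop where
  cine : Cine f f1 f2 U lo hi
  PU : ∀ p ∈ P, p ∈ U
  Pdiam : ∀ p ∈ P, ∀ q ∈ P, dist p q ≤ 1
  δ0 : 0 < δ
  δ1 : δ ≤ 1
  s0 : 0 < s
  s1 : s ≤ 1
  t0 : 0 < t
  t1 : t ≤ 1
  Λ1 : 10000 ≤ Λ
  TF : ∀ p ∈ P, T p ⊆ F
  ξI : ∀ x ∈ F, ξ x ∈ Icc lo hi
  near : ∀ p ∈ P, ∀ x ∈ T p, |f p (ξ x) - y x| ≤ 2 * δ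
  cntP : ∀ p ∈ P, ∀ r, δ ≤ r → ((P.filter fun q => dist p q ≤ r).card : ℝ) ≤ Λ * (r / δ) ^ t
  cntT : ∀ p ∈ P, ∀ c r, δ ≤ r → (((T p).filter fun x => |ξ x - c| ≤ r).card : ℝ) ≤ Λ * (r / δ) ^ s
  lowP : (1 / δ) ^ t ≤ Λ * P.card
  lowT : ∀ p ∈ P, (1 / δ) ^ s ≤ Λ * (T p).card

namespace DiscHyp
variable {β : Type*} [DecidableEq β] {f f1 f2 : (Fin 3 → ℝ) → ℝ → ℝ} {U : Set (Fin 3 → ℝ)} {lo hi : ℝ}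
    {P : Finset (Fin 3 → ℝ)} {F : Finset β} {ξ y : β → ℝ} {T : (Fin 3 → ℝ) → Finset β}
    {δ s t Λ : ℝ}

lemma hdiff (H : DiscHyp f f1 f2 U lo hi P F ξ y T δ s t Λ) {p q : Fin 3 → ℝ} (hp : p ∈ P) (hq : q ∈ P)
    {x : β} (xp : x ∈ T p) (xq : x ∈ T q) : |f q (ξ x) - f p (ξ x)| ≤ 4 * δ := by
  have h1 := abs_le.1 (H.near p hp x xp)
  have h2 := abs_le.1 (H.near q hq x xq)
  rw [abs_le]
  constructor <;> linarith

lemma close (H : DiscHyp f f1 f2 U lo hi P F ξ y T δ s t Λ) {p : Fin 3 → ℝ} (hp : p ∈ P) (S : Finset β)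
    (hS : ∀ x ∈ S, x ∈ T p) (r : ℝ) (hr : δ ≤ r) (hSr : ∀ x ∈ S, ∀ x' ∈ S, |ξ x - ξ x'| ≤ r) :
    (S.card : ℝ) ≤ Λ * (r / δ) ^ s := by
  rcases S.eq_empty_or_nonempty with h | ⟨x0, h0⟩
  · rw [h]
    have h0 := H.δ0
    have hΛ : 0 < Λ := by linarith [H.Λ1]
    have hr0 : 0 < r := by linarith
    simp
    positivity
  · refine le_trans ?_ (H.cntT p hp (ξ x0) r hr)
    exact_mod_cast Finset.card_le_card fun x hx => by
      rw [Finset.mem_filter]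
      exact ⟨hS x hx, hSr x hx x0 h0⟩

lemma cardT (H : DiscHyp f f1 f2 U lo hi P F ξ y T δ s t Λ) {p : Fin 3 → ℝ} (hp : p ∈ P) :
    ((T p).card : ℝ) ≤ Λ * (1 / δ) ^ s := by
  refine H.close hp (T p) (fun _ h => h) 1 H.δ1 fun x hx x' hx' => ?_
  have h1 := H.ξI x (H.TF p hp hx)
  have h2 := H.ξI x' (H.TF p hp hx')
  have := H.cine.hlen
  rw [abs_le]
  constructor <;> linarith [h1.1, h1.2, h2.1, h2.2]

/-- points of `T p ∩ T q` at which the derivative difference is at least `σ` in absolute value -/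
lemma steep (H : DiscHyp f f1 f2 U lo hi P F ξ y T δ s t Λ) {p q : Fin 3 → ℝ} (hp : p ∈ P) (hq : q ∈ P)
    {σ : ℝ} (hσ : 0 < σ) (hσd : σ ≤ dist p q / 20) (hd : 100 * δ < dist p q)
    (S : Finset β) (hSp : ∀ x ∈ S, x ∈ T p) (hSq : ∀ x ∈ S, x ∈ T q)
    (hS : ∀ x ∈ S, σ ≤ |f1 q (ξ x) - f1 p (ξ x)|) : (S.card : ℝ) ≤ 2 * (Λ * (8 / σ) ^ s) := by
  have hpq : p ≠ q := by
    rintro rfl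
    rw [dist_self] at hd
    linarith [H.δ0]
  have J := H.cine.jet (H.PU p hp) (H.PU q hq) hpq
  have hI : ∀ x ∈ S, ξ x ∈ Icc lo hi := fun x hx => H.ξI x (H.TF p hp (hSp x hx))
  have hD := H.Pdiam p hp q hq
  have hr : δ ≤ 8 * δ / σ := by
    rw [le_div_iff₀ hσ]
    nlinarith [H.δ0]
  have hrr : 8 * δ / σ / δ = 8 / σ := by
    have := H.δ0.ne'
    field_simp
  have key : ∀ {h h1 h2 : ℝ → ℝ} {l0 l1 l2 : ℝ}, Jet h h1 h2 lo hi (dist p q) l0 l1 l2 →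
      (∀ x ∈ S, |h (ξ x)| ≤ 4 * δ) → ∀ x ∈ S, ∀ x' ∈ S, σ ≤ h1 (ξ x) → σ ≤ h1 (ξ x') →
      |ξ x - ξ x'| ≤ 8 * δ / σ := by
    intro h h1 h2 l0 l1 l2 J h0 x hx x' hx' s1 s2
    rw [le_div_iff₀ hσ]
    rcases lt_trichotomy (ξ x) (ξ x') with c | c | c
    · rw [abs_sub_comm, abs_of_pos (sub_pos.2 c)]
      exact J.transverse (hI x hx) (hI x' hx') c hd hσ hσd (h0 x hx) (h0 x' hx') s1 s2
    · rw [c, sub_self, abs_zero, zero_mul]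
      linarith [H.δ0]
    · rw [abs_of_pos (sub_pos.2 c)]
      exact J.transverse (hI x' hx') (hI x hx) c hd hσ hσd (h0 x' hx') (h0 x hx) s2 s1
  have h0 : ∀ x ∈ S, |f q (ξ x) - f p (ξ x)| ≤ 4 * δ := fun x hx => H.hdiff hp hq (hSp x hx) (hSq x hx)
  have c1 := H.close hp (S.filter fun x => σ ≤ f1 q (ξ x) - f1 p (ξ x))
    (fun x hx => hSp x (Finset.mem_filter.1 hx).1) (8 * δ / σ) hr (by
      intro x hx x' hx'
      rw [Finset.mem_filter] at hx hx'
      exact key J h0 x hx.1 x' hx'.1 hx.2 hx'.2)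
  have c2 := H.close hp (S.filter fun x => ¬ σ ≤ f1 q (ξ x) - f1 p (ξ x))
    (fun x hx => hSp x (Finset.mem_filter.1 hx).1) (8 * δ / σ) hr (by
      intro x hx x' hx'
      rw [Finset.mem_filter] at hx hx'
      refine key J.neg (fun x hx => by rw [abs_neg]; exact h0 x hx) x hx.1 x' hx'.1 ?_ ?_
      · exact (le_abs.1 (hS x hx.1)).resolve_left hx.2
      · exact (le_abs.1 (hS x' hx'.1)).resolve_left hx'.2)
  rw [hrr] at c1 c2
  have := Finset.card_filter_add_card_filter_not (s := S) (fun x => σ ≤ f1 q (ξ x) - f1 p (ξ x))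
  have : (S.card : ℝ) = (S.filter fun x => σ ≤ f1 q (ξ x) - f1 p (ξ x)).card + (S.filter fun x => ¬ σ ≤ f1 q (ξ x) - f1 p (ξ x)).card := by
    exact_mod_cast this.symm
  linarith

lemma tang (H : DiscHyp f f1 f2 U lo hi P F ξ y T δ s t Λ) (m : β → ℝ) (μ d σ l : ℝ)
    (G : (Fin 3 → ℝ) → (Fin 3 → ℝ) → Finset β) (hμ : 0 < μ) (hd : 0 < d) (hσ : 0 < σ)
    (hm : ∀ x ∈ F, m x = (P.filter fun p => x ∈ T p).card)
    (hσd : 40 * σ / d ≤ l) (hl : l ≤ 1)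
    (hG : ∀ p ∈ P, ∀ q ∈ P, ∀ x ∈ G p q, x ∈ T p ∧ x ∈ T q ∧ μ ≤ m x ∧
      |f1 q (ξ x) - f1 p (ξ x)| ≤ σ ∧ d / 2 < dist p q ∧ dist p q ≤ d ∧ δ * dist p q ≤ σ ^ 2 ∧
      (σ / 2 < |f1 q (ξ x) - f1 p (ξ x)| ∨ σ ^ 2 / 4 < dist p q * δ) ∧ dist p q ≤ q 2 - p 2 ∧
      100 * δ < dist p q) :
    ∃ a : (Fin 3 → ℝ) → (Fin 3 → ℝ) → ℝ, (∀ p ∈ P, ∀ q ∈ P, ∀ x ∈ G p q, |ξ x - a p q| ≤ 6 * σ / d) ∧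
      (∀ p ∈ P, ∀ q ∈ P, ∑ x ∈ G p q, 1 / m x ≤ 3 * (Λ * (16 / σ) ^ s) / μ) ∧
      (∀ p ∈ P, ∀ q ∈ P, 0 < ∑ x ∈ G p q, 1 / m x →
        ∑ q' ∈ P, (∑ x ∈ G p q', 1 / m x) * (if |a p q' - a p q| < l then (1:ℝ) else 0) ≤ Λ * (2 * l / δ) ^ s) ∧
      l * ∑ q ∈ P, ∑ q' ∈ P, (∑ p ∈ P, (if l ≤ |a p q' - a p q| then 1 else 0) *
        ((∑ x ∈ G p q, 1 / m x) * (∑ x ∈ G p q', 1 / m x))) ^ 2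
      ≤ 64 * (P.card * ((Λ * (1 / δ) ^ s) ^ 2 * (Λ * (46 * σ / d / δ) ^ s) * (3 * (Λ * (16 / σ) ^ s) / μ))) := by
  classical
  have Λ0 : 0 < Λ := by linarith [H.Λ1]
  have δ0 := H.δ0
  let a : (Fin 3 → ℝ) → (Fin 3 → ℝ) → ℝ := fun p q => if h : (G p q).Nonempty then ξ h.choose else lo
  have aG : ∀ p q, (G p q).Nonempty → ∃ x ∈ G p q, a p q = ξ x := by
    intro p q h
    refine ⟨h.choose, h.choose_spec, ?_⟩
    simp only [a, dif_pos h]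
  have hI : ∀ p ∈ P, ∀ q ∈ P, ∀ x ∈ G p q, ξ x ∈ Icc lo hi := fun p hp q hq x hx =>
    H.ξI x (H.TF p hp (hG p hp q hq x hx).1)
  have aI : ∀ p ∈ P, ∀ q ∈ P, a p q ∈ Icc lo hi := by
    intro p hp q hq
    by_cases h : (G p q).Nonempty
    · obtain ⟨x, hx, e⟩ := aG p q h
      rw [e]
      exact hI p hp q hq x hx
    · simp only [a, dif_neg h]
      exact left_mem_Icc.2 H.cine.hle
  have hne : ∀ p q : Fin 3 → ℝ, d / 2 < dist p q → p ≠ q := by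
    rintro p q h rfl
    rw [dist_self] at h
    linarith
  have jets : ∀ p ∈ P, ∀ q ∈ P, p ≠ q → _ := fun p hp q hq h => H.cine.jet (H.PU p hp) (H.PU q hq) h
  -- all points of `G p q` are close
  have near3 : ∀ p ∈ P, ∀ q ∈ P, ∀ x ∈ G p q, ∀ x' ∈ G p q, |ξ x - ξ x'| * dist p q ≤ 3 * σ := by
    intro p hp q hq x hx x' hx'
    obtain ⟨h1, h2, h3, h4, h5, h6, h7, h8, h9, h10⟩ := hG p hp q hq x hx
    obtain ⟨i1, i2, i3, i4, i5, i6, i7, i8, i9, i10⟩ := hG p hp q hq x' hx'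
    have J := jets p hp q hq (hne p q h5)
    exact J.tangent_len h9 (hI p hp q hq x' hx') (hI p hp q hq x hx) i4 h4
  have near6 : ∀ p ∈ P, ∀ q ∈ P, ∀ x ∈ G p q, |ξ x - a p q| ≤ 6 * σ / d := by
    intro p hp q hq x hx
    obtain ⟨x', hx', e⟩ := aG p q ⟨x, hx⟩
    rw [e, le_div_iff₀ hd]
    have := near3 p hp q hq x hx x' hx'
    have h5 := (hG p hp q hq x hx).2.2.2.2.1
    nlinarith [abs_nonneg (ξ x - ξ x')]
  have mpos : ∀ p ∈ P, ∀ q ∈ P, ∀ x ∈ G p q, 0 < m x := fun p hp q hq x hx =>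
    hμ.trans_le (hG p hp q hq x hx).2.2.1
  have hW : ∀ p ∈ P, ∀ q ∈ P, ∑ x ∈ G p q, 1 / m x ≤ 3 * (Λ * (16 / σ) ^ s) / μ := by
    intro p hp q hq
    have cnt : ((G p q).card : ℝ) ≤ 3 * (Λ * (16 / σ) ^ s) := by
      rcases (G p q).eq_empty_or_nonempty with h | ⟨x0, h0⟩
      · rw [h]; simp; positivity
      have hx0 := hG p hp q hq x0 h0
      have hD := H.Pdiam p hp q hq
      have hσ' : σ / 2 ≤ dist p q / 20 := by
        rw [div_le_iff₀ hd] at hσd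
        have := hx0.2.2.2.2.1
        nlinarith
      have c1 := H.steep hp hq (half_pos hσ) hσ' hx0.2.2.2.2.2.2.2.2.2 ((G p q).filter fun x => σ / 2 < |f1 q (ξ x) - f1 p (ξ x)|)
        (fun x hx => (hG p hp q hq x (Finset.mem_filter.1 hx).1).1)
        (fun x hx => (hG p hp q hq x (Finset.mem_filter.1 hx).1).2.1)
        (fun x hx => (Finset.mem_filter.1 hx).2.le)
      rw [show 8 / (σ / 2) = 16 / σ by field_simp; norm_num] at c1
      have c2 := H.close hp ((G p q).filter fun x => ¬ σ / 2 < |f1 q (ξ x) - f1 p (ξ x)|)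
        (fun x hx => (hG p hp q hq x (Finset.mem_filter.1 hx).1).1) (16 * δ / σ) (by
          rw [le_div_iff₀ hσ]; nlinarith) (by
          intro x hx x' hx'
          rw [Finset.mem_filter] at hx hx'
          have e := near3 p hp q hq x hx.1 x' hx'.1
          have g := (hG p hp q hq x hx.1).2.2.2.2.2.2.2.1.resolve_left hx.2
          rw [le_div_iff₀ hσ]
          have e2 := abs_nonneg (ξ x - ξ x')
          have : |ξ x - ξ x'| * (σ ^ 2 / 4) ≤ 3 * σ * δ := by nlinarith
          have : |ξ x - ξ x'| * σ * σ ≤ 12 * δ * σ := by nlinarith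
          have := le_of_mul_le_mul_right this hσ
          linarith)
      rw [show 16 * δ / σ / δ = 16 / σ by field_simp] at c2
      have := Finset.card_filter_add_card_filter_not (s := G p q) (fun x => σ / 2 < |f1 q (ξ x) - f1 p (ξ x)|)
      have : ((G p q).card : ℝ) = ((G p q).filter fun x => σ / 2 < |f1 q (ξ x) - f1 p (ξ x)|).card + ((G p q).filter fun x => ¬ σ / 2 < |f1 q (ξ x) - f1 p (ξ x)|).card := by
        exact_mod_cast this.symm
      linarith
    calc ∑ x ∈ G p q, 1 / m x ≤ ∑ x ∈ G p q, 1 / μ :=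
          Finset.sum_le_sum fun x hx => one_div_le_one_div_of_le hμ (hG p hp q hq x hx).2.2.1
      _ = (G p q).card / μ := by rw [Finset.sum_const, nsmul_eq_mul]; ring
      _ ≤ _ := by gcongr
  -- row sums restricted to a set of points
  have rowgen : ∀ p ∈ P, ∀ Q ⊆ P, ∀ S : Finset β, (∀ q ∈ Q, G p q ⊆ S) → S ⊆ F →
      ∑ q ∈ Q, ∑ x ∈ G p q, 1 / m x ≤ S.card := by
    intro p hp Q hQ S hS hSF
    calc ∑ q ∈ Q, ∑ x ∈ G p q, 1 / m x = ∑ q ∈ Q, ∑ x ∈ S, if x ∈ G p q then 1 / m x else 0 := by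
          refine Finset.sum_congr rfl fun q hq => ?_
          rw [← Finset.sum_filter]
          refine Finset.sum_congr ?_ fun _ _ => rfl
          ext x
          rw [Finset.mem_filter]
          exact ⟨fun h => ⟨hS q hq h, h⟩, fun h => h.2⟩
      _ = ∑ x ∈ S, ∑ q ∈ Q, if x ∈ G p q then 1 / m x else 0 := Finset.sum_comm
      _ ≤ ∑ x ∈ S, 1 := by
          refine Finset.sum_le_sum fun x hx => ?_
          rw [← Finset.sum_filter, Finset.sum_const, nsmul_eq_mul]
          rcases (Q.filter fun q => x ∈ G p q).eq_empty_or_nonempty with h | ⟨q, h⟩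
          · rw [h]; simp
          · rw [Finset.mem_filter] at h
            have hm0 := mpos p hp q (hQ h.1) x h.2
            rw [mul_one_div, div_le_one hm0, hm x (hSF hx)]
            exact_mod_cast Finset.card_le_card fun q' hq' => by
              rw [Finset.mem_filter] at hq' ⊢
              exact ⟨hQ hq'.1, (hG p hp q' (hQ hq'.1) x hq'.2).2.1⟩
      _ = S.card := by simp
  have colgen : ∀ q ∈ P, ∀ Q ⊆ P, ∀ S : Finset β, (∀ p ∈ Q, G p q ⊆ S) → S ⊆ F →
      ∑ p ∈ Q, ∑ x ∈ G p q, 1 / m x ≤ S.card := by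
    intro q hq Q hQ S hS hSF
    calc ∑ p ∈ Q, ∑ x ∈ G p q, 1 / m x = ∑ p ∈ Q, ∑ x ∈ S, if x ∈ G p q then 1 / m x else 0 := by
          refine Finset.sum_congr rfl fun p hp => ?_
          rw [← Finset.sum_filter]
          refine Finset.sum_congr ?_ fun _ _ => rfl
          ext x
          rw [Finset.mem_filter]
          exact ⟨fun h => ⟨hS p hp h, h⟩, fun h => h.2⟩
      _ = ∑ x ∈ S, ∑ p ∈ Q, if x ∈ G p q then 1 / m x else 0 := Finset.sum_comm
      _ ≤ ∑ x ∈ S, 1 := by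
          refine Finset.sum_le_sum fun x hx => ?_
          rw [← Finset.sum_filter, Finset.sum_const, nsmul_eq_mul]
          rcases (Q.filter fun p => x ∈ G p q).eq_empty_or_nonempty with h | ⟨p, h⟩
          · rw [h]; simp
          · rw [Finset.mem_filter] at h
            have hm0 := mpos p (hQ h.1) q hq x h.2
            rw [mul_one_div, div_le_one hm0, hm x (hSF hx)]
            exact_mod_cast Finset.card_le_card fun q' hq' => by
              rw [Finset.mem_filter] at hq' ⊢
              exact ⟨hQ hq'.1, (hG q' (hQ hq'.1) q hq x hq'.2).1⟩
      _ = S.card := by simp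
  have hη0 : 0 < 40 * σ / d := by positivity
  have hrad : δ ≤ 46 * σ / d ∨ ∀ p ∈ P, ∀ q ∈ P, G p q = ∅ := by
    by_cases h : ∃ p ∈ P, ∃ q ∈ P, (G p q).Nonempty
    · left
      obtain ⟨p, hp, q, hq, x, hx⟩ := h
      obtain ⟨h1, h2, h3, h4, h5, h6, h7, h8, h9, h10⟩ := hG p hp q hq x hx
      have hD := H.Pdiam p hp q hq
      rw [le_div_iff₀ hd]
      have e1 : σ ^ 2 ≥ δ ^ 2 := by nlinarith
      have e2 : δ ≤ σ := by nlinarith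
      nlinarith
    · right
      intro p hp q hq
      by_contra h2
      exact h ⟨p, hp, q, hq, Finset.nonempty_iff_ne_empty.2 h2⟩
  have wnn : ∀ p ∈ P, ∀ q ∈ P, 0 ≤ ∑ x ∈ G p q, 1 / m x := fun p hp q hq =>
    Finset.sum_nonneg fun x hx => (one_div_pos.2 (mpos p hp q hq x hx)).le
  have wpos : ∀ p q, 0 < ∑ x ∈ G p q, 1 / m x → (G p q).Nonempty := by
    intro p q h
    rw [Finset.nonempty_iff_ne_empty]
    intro h2
    rw [h2] at h
    simp at h
  have hη46 : ∀ p ∈ P, ∀ q ∈ P, ∀ x ∈ G p q, ∀ c, |a p q - c| < 40 * σ / d → |ξ x - c| ≤ 46 * σ / d := by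
    intro p hp q hq x hx c hc
    have := near6 p hp q hq x hx
    calc |ξ x - c| ≤ |ξ x - a p q| + |a p q - c| := abs_sub_le _ _ _
      _ ≤ 6 * σ / d + 40 * σ / d := by linarith
      _ = _ := by ring
  refine ⟨a, near6, hW, ?_, ?_⟩
  · intro p hp q hq w0
    rcases hrad with hrad | hrad
    · refine le_trans ?_ (H.cntT p hp (a p q) (2 * l) (by
        have : 46 * σ / d = 46 / 40 * (40 * σ / d) := by ring
        linarith))
      have : ∑ q' ∈ P, (∑ x ∈ G p q', 1 / m x) * (if |a p q' - a p q| < l then (1:ℝ) else 0)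
          = ∑ q' ∈ P.filter (fun q' => |a p q' - a p q| < l), ∑ x ∈ G p q', 1 / m x := by
        rw [Finset.sum_filter]
        refine Finset.sum_congr rfl fun q' _ => ?_
        split_ifs <;> simp
      rw [this]
      refine rowgen p hp _ (Finset.filter_subset _ _) _ ?_ ((Finset.filter_subset _ _).trans (H.TF p hp))
      intro q' hq' x hx
      rw [Finset.mem_filter] at hq' ⊢
      refine ⟨(hG p hp q' hq'.1 x hx).1, ?_⟩
      have e := near6 p hp q' hq'.1 x hx
      have e2 : 6 * σ / d = 6 / 40 * (40 * σ / d) := by ring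
      have := abs_sub_le (ξ x) (a p q') (a p q)
      linarith [hq'.2]
    · rw [hrad p hp q hq] at w0
      simp at w0
  refine core P (fun p q => ∑ x ∈ G p q, 1 / m x) a (40 * σ / d) l _ _ _ hη0 hσd hl wnn ?_ ?_ hW
    (by positivity) (by positivity) (by positivity) ?_ ?_ ?_ ?_
  · intro p hp q hq q' hq'
    have h1 := aI p hp q hq
    have h2 := aI p hp q' hq'
    have := H.cine.hlen
    rw [abs_le]
    constructor <;> linarith [h1.1, h1.2, h2.1, h2.2]
  · intro p hp p' hp' q hq q' hq' w1 w2 w3 w4 g1 g2 g3 g4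
    obtain ⟨x1, hx1, e1⟩ := aG _ _ (wpos _ _ w1)
    obtain ⟨x2, hx2, e2⟩ := aG _ _ (wpos _ _ w2)
    obtain ⟨x3, hx3, e3⟩ := aG _ _ (wpos _ _ w3)
    obtain ⟨x4, hx4, e4⟩ := aG _ _ (wpos _ _ w4)
    have I1 := aI p hp q hq
    have I2 := aI p hp q' hq'
    have I3 := aI p' hp' q hq
    have I4 := aI p' hp' q' hq'
    -- generic: tangency data
    have data : ∀ p ∈ P, ∀ q ∈ P, (G p q).Nonempty → |f q (a p q) - f p (a p q)| ≤ 4 * δ ∧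
        ∀ z ∈ Icc lo hi, 40 * σ / d ≤ |z - a p q| → 4 * δ < f q z - f p z := by
      intro p hp q hq hn
      obtain ⟨x, hx, e⟩ := aG p q hn
      obtain ⟨h1, h2, h3, h4, h5, h6, h7, h8, h9, h10⟩ := hG p hp q hq x hx
      have J := jets p hp q hq (hne p q h5)
      have h0 := H.hdiff hp hq h1 h2
      rw [e]
      refine ⟨h0, fun z hz hzx => ?_⟩
      exact J.away hd hσ (fun x hx => by have := J.convex_of h9 hx; nlinarith) (by nlinarith)
        (hI p hp q hq x hx) hz h0 h4 hzx
    obtain ⟨a1, b1⟩ := data p hp q hq (wpos _ _ w1)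
    obtain ⟨a2, b2⟩ := data p hp q' hq' (wpos _ _ w2)
    obtain ⟨a3, b3⟩ := data p' hp' q hq (wpos _ _ w3)
    obtain ⟨a4, b4⟩ := data p' hp' q' hq' (wpos _ _ w4)
    have a1 := abs_le.1 a1
    have a2 := abs_le.1 a2
    have a3 := abs_le.1 a3
    have a4 := abs_le.1 a4
    have g1' := g1
    have g2' := g2
    have g3' := g3
    have g4' := g4
    rw [abs_sub_comm] at g1' g2' g3' g4'
    have npp : p' ≠ p := by rintro rfl; rw [sub_self, abs_zero] at g3; linarith
    have nqq : q ≠ q' := by rintro rfl; rw [sub_self, abs_zero] at g1; linarith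
    constructor
    · refine (jets p' hp' p hp npp).nonInter I1 I2 I3 I4 ?_ ?_ ?_ ?_
      · have := b3 (a p q) I1 g3'; linarith
      · have := b4 (a p q') I2 g4'; linarith
      · have := b1 (a p' q) I3 g3; linarith
      · have := b2 (a p' q') I4 g4; linarith
    · refine (jets q hq q' hq' nqq).nonInter I1 I3 I2 I4 ?_ ?_ ?_ ?_
      · have := b2 (a p q) I1 g1'; linarith
      · have := b4 (a p' q) I3 g2'; linarith
      · have := b1 (a p q') I2 g1; linarith
      · have := b3 (a p' q') I4 g2; linarith
  · intro p hp
    refine (rowgen p hp P subset_rfl (T p) (fun q hq x hx => (hG p hp q hq x hx).1) (H.TF p hp)).trans (H.cardT hp)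
  · intro q hq
    refine (colgen q hq P subset_rfl (T q) (fun p hp x hx => (hG p hp q hq x hx).2.1) (H.TF q hq)).trans (H.cardT hq)
  · intro p hp q hq w0
    rcases hrad with hrad | hrad
    · refine le_trans ?_ (H.cntT p hp (a p q) (46 * σ / d) hrad)
      have : ∑ q' ∈ P, (∑ x ∈ G p q', 1 / m x) * (if |a p q' - a p q| < 40 * σ / d then (1:ℝ) else 0)
          = ∑ q' ∈ P.filter (fun q' => |a p q' - a p q| < 40 * σ / d), ∑ x ∈ G p q', 1 / m x := by
        rw [Finset.sum_filter]
        refine Finset.sum_congr rfl fun q' _ => ?_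
        split_ifs <;> simp
      rw [this]
      refine rowgen p hp _ (Finset.filter_subset _ _) _ ?_ ((Finset.filter_subset _ _).trans (H.TF p hp))
      intro q' hq' x hx
      rw [Finset.mem_filter] at hq' ⊢
      exact ⟨(hG p hp q' hq'.1 x hx).1, hη46 p hp q' hq'.1 x hx _ hq'.2⟩
    · rw [hrad p hp q hq] at w0
      simp at w0
  · intro q hq p hp w0
    rcases hrad with hrad | hrad
    · refine le_trans ?_ (H.cntT q hq (a p q) (46 * σ / d) hrad)
      have : ∑ p' ∈ P, (∑ x ∈ G p' q, 1 / m x) * (if |a p' q - a p q| < 40 * σ / d then (1:ℝ) else 0)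
          = ∑ p' ∈ P.filter (fun p' => |a p' q - a p q| < 40 * σ / d), ∑ x ∈ G p' q, 1 / m x := by
        rw [Finset.sum_filter]
        refine Finset.sum_congr rfl fun q' _ => ?_
        split_ifs <;> simp
      rw [this]
      refine colgen q hq _ (Finset.filter_subset _ _) _ ?_ ((Finset.filter_subset _ _).trans (H.TF q hq))
      intro q' hq' x hx
      rw [Finset.mem_filter] at hq' ⊢
      exact ⟨(hG q' hq'.1 q hq x hx).2.1, hη46 q' hq'.1 q hq x hx _ hq'.2⟩
    · rw [hrad p hp q hq] at w0
      simp at w0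

end DiscHyp

namespace DiscHyp
variable {β : Type*} [DecidableEq β] {f f1 f2 : (Fin 3 → ℝ) → ℝ → ℝ} {U : Set (Fin 3 → ℝ)} {lo hi : ℝ}
    {P : Finset (Fin 3 → ℝ)} {F : Finset β} {ξ y : β → ℝ} {T : (Fin 3 → ℝ) → Finset β}
    {δ s t Λ : ℝ}

lemma rpow_le_self_mul {c x s : ℝ} (hc : 1 ≤ c) (hx : 0 ≤ x) (hs0 : 0 ≤ s) (hs : s ≤ 1) : (c * x) ^ s ≤ c * x ^ s := by
  rw [Real.mul_rpow (by linarith) hx]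
  have : c ^ s ≤ c ^ (1:ℝ) := Real.rpow_le_rpow_of_exponent_le hc hs
  rw [Real.rpow_one] at this
  gcongr

set_option maxHeartbeats 1600000 in
lemma tang_final (H : DiscHyp f f1 f2 U lo hi P F ξ y T δ s t Λ) (hts : t ≤ s) (m : β → ℝ) (μ d σ l : ℝ)
    (G : (Fin 3 → ℝ) → (Fin 3 → ℝ) → Finset β) (hμ : 0 < μ) (hd : δ ≤ d) (hσ : 0 < σ)
    (hm : ∀ x ∈ F, m x = (P.filter fun p => x ∈ T p).card)
    (hσd : 40 * σ / d ≤ l) (hl : l ≤ 1) (hls : l ^ s ≤ 1 / Λ ^ 5)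
    (hG : ∀ p ∈ P, ∀ q ∈ P, ∀ x ∈ G p q, x ∈ T p ∧ x ∈ T q ∧ μ ≤ m x ∧
      |f1 q (ξ x) - f1 p (ξ x)| ≤ σ ∧ d / 2 < dist p q ∧ dist p q ≤ d ∧ δ * dist p q ≤ σ ^ 2 ∧
      (σ / 2 < |f1 q (ξ x) - f1 p (ξ x)| ∨ σ ^ 2 / 4 < dist p q * δ) ∧ dist p q ≤ q 2 - p 2 ∧
      100 * δ < dist p q)
    (hY : P.card * (1 / δ) ^ s ≤ 4 * Λ ^ 3 * ∑ p ∈ P, ∑ q ∈ P, ∑ x ∈ G p q, 1 / m x) :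
    μ * l ≤ Λ ^ 20 := by
  classical
  have Λ1 := H.Λ1
  have Λ0 : 0 < Λ := by linarith [H.Λ1]
  have δ0 := H.δ0
  have d0 : 0 < d := by linarith
  have s0 := H.s0
  have hl0 : 0 < l := lt_of_lt_of_le (by positivity) hσd
  obtain ⟨a, a6, aW, anear, acore⟩ := H.tang m μ d σ l G hμ d0 hσ hm hσd hl hG
  set w : (Fin 3 → ℝ) → (Fin 3 → ℝ) → ℝ := fun p q => ∑ x ∈ G p q, 1 / m x with hw
  change ∀ p ∈ P, ∀ q ∈ P, w p q ≤ _ at aW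
  change ∀ p ∈ P, ∀ q ∈ P, 0 < w p q → ∑ q' ∈ P, w p q' * _ ≤ _ at anear
  change l * ∑ q ∈ P, ∑ q' ∈ P, (∑ p ∈ P, _ * (w p q * w p q')) ^ 2 ≤ _ at acore
  change _ ≤ 4 * Λ ^ 3 * ∑ p ∈ P, ∑ q ∈ P, w p q at hY
  have wnn : ∀ p ∈ P, ∀ q ∈ P, 0 ≤ w p q := fun p hp q hq =>
    Finset.sum_nonneg fun x hx => (one_div_pos.2 (hμ.trans_le (hG p hp q hq x hx).2.2.1)).le
  have wpos : ∀ p q, 0 < w p q → (G p q).Nonempty := by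
    intro p q h
    rw [Finset.nonempty_iff_ne_empty]
    intro h2
    simp only [hw, h2] at h
    simp at h
  set E := (1 / δ) ^ s with hE
  have E0 : 0 < E := by positivity
  set N : ℝ := (P.card : ℝ) with hN
  have N0 : 0 < N := by
    have h1 := H.lowP
    have h2 : 0 < (1 / δ) ^ t := by positivity
    by_contra h
    have : N = 0 := le_antisymm (not_lt.1 h) (by positivity)
    rw [← hN, this] at h1
    linarith
  set Y := ∑ p ∈ P, ∑ q ∈ P, w p q with hYdef
  -- lower bound for Ch
  set B : (Fin 3 → ℝ) → (Fin 3 → ℝ) → ℝ := fun q q' => ∑ p ∈ P, (if l ≤ |a p q' - a p q| then 1 else 0) * (w p q * w p q') with hB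
  have hnear : Λ * (2 * l / δ) ^ s ≤ 2 * E / Λ ^ 4 := by
    have h1 : (2 * l / δ) ^ s ≤ 2 * (l ^ s * E) := by
      rw [show 2 * l / δ = 2 * (l * (1 / δ)) by ring, hE, ← Real.mul_rpow hl0.le (by positivity)]
      exact rpow_le_self_mul (by norm_num) (by positivity) H.s0.le H.s1
    calc Λ * (2 * l / δ) ^ s ≤ Λ * (2 * (1 / Λ ^ 5 * E)) := by gcongr; exact h1.trans (by gcongr)
      _ = _ := by field_simp
  have Y1 : N * E ≤ 4 * Λ ^ 3 * Y := hY
  have Y0 : 0 < Y := by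
    by_contra h
    have : 0 < N * E := by positivity
    have : 4 * Λ ^ 3 * Y ≤ 0 := mul_nonpos_of_nonneg_of_nonpos (by positivity) (not_lt.1 h)
    linarith
  have hCh : Y ^ 2 ≤ 2 * N * ∑ q ∈ P, ∑ q' ∈ P, B q q' := by
    have e1 : Y ^ 2 ≤ N * ∑ p ∈ P, (∑ q ∈ P, w p q) ^ 2 := by
      simpa using sq_sum_le_card_mul_sum_sq (s := P) (f := fun p => ∑ q ∈ P, w p q)
    have e2 : ∑ p ∈ P, (∑ q ∈ P, w p q) ^ 2 = ∑ q ∈ P, ∑ q' ∈ P, B q q' +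
        ∑ p ∈ P, ∑ q ∈ P, w p q * ∑ q' ∈ P, w p q' * (if |a p q' - a p q| < l then (1:ℝ) else 0) := by
      have : ∑ q ∈ P, ∑ q' ∈ P, B q q' = ∑ p ∈ P, ∑ q ∈ P, ∑ q' ∈ P, (if l ≤ |a p q' - a p q| then 1 else 0) * (w p q * w p q') := by
        simp only [hB]
        calc _ = ∑ q ∈ P, ∑ p ∈ P, ∑ q' ∈ P, (if l ≤ |a p q' - a p q| then 1 else 0) * (w p q * w p q') :=
              Finset.sum_congr rfl fun _ _ => Finset.sum_comm
          _ = _ := Finset.sum_comm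
      rw [this, ← Finset.sum_add_distrib]
      refine Finset.sum_congr rfl fun p _ => ?_
      rw [sq, Finset.sum_mul_sum, ← Finset.sum_add_distrib]
      refine Finset.sum_congr rfl fun q _ => ?_
      rw [Finset.mul_sum, ← Finset.sum_add_distrib]
      refine Finset.sum_congr rfl fun q' _ => ?_
      by_cases h : l ≤ |a p q' - a p q|
      · rw [if_pos h, if_neg (not_lt.2 h)]; ring
      · rw [if_neg h, if_pos (not_le.1 h)]; ring
    have e3 : ∑ p ∈ P, ∑ q ∈ P, w p q * ∑ q' ∈ P, w p q' * (if |a p q' - a p q| < l then (1:ℝ) else 0)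
        ≤ Y * (2 * E / Λ ^ 4) := by
      rw [hYdef, Finset.sum_mul]
      refine Finset.sum_le_sum fun p hp => ?_
      rw [Finset.sum_mul]
      refine Finset.sum_le_sum fun q hq => ?_
      rcases (wnn p hp q hq).eq_or_lt with h | h
      · rw [← h]; simp
      · exact mul_le_mul_of_nonneg_left ((anear p hp q hq h).trans hnear) h.le
    have e4 : N * (Y * (2 * E / Λ ^ 4)) ≤ Y ^ 2 / 2 := by
      have : N * (2 * E / Λ ^ 4) ≤ Y / 2 := by
        have h3 : N * E / Λ ^ 4 * 16 ≤ N * E / Λ ^ 3 := by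
          rw [div_mul_eq_mul_div, div_le_div_iff₀ (by positivity) (by positivity)]
          have : 0 < N * E * Λ ^ 3 := by positivity
          nlinarith
        have h4 : N * E / Λ ^ 3 ≤ 4 * Y := by
          rw [div_le_iff₀ (by positivity)]
          linarith
        have : N * (2 * E / Λ ^ 4) = 2 * (N * E / Λ ^ 4) := by ring
        linarith
      nlinarith
    rw [e2] at e1
    nlinarith
  -- Cauchy-Schwarz
  set R := (P ×ˢ P).filter (fun z => dist z.1 z.2 ≤ 2 * d) with hR
  have hB0 : ∀ q ∈ P, ∀ q' ∈ P, ¬ dist q q' ≤ 2 * d → B q q' = 0 := by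
    intro q hq q' hq' h
    refine Finset.sum_eq_zero fun p hp => ?_
    by_contra h0
    have h1 : w p q ≠ 0 := fun h => h0 (by rw [h]; ring)
    have h2 : w p q' ≠ 0 := fun h => h0 (by rw [h]; ring)
    obtain ⟨x, hx⟩ := wpos p q ((wnn p hp q hq).lt_of_ne h1.symm)
    obtain ⟨x', hx'⟩ := wpos p q' ((wnn p hp q' hq').lt_of_ne h2.symm)
    have d1 := (hG p hp q hq x hx).2.2.2.2.2.1
    have d2 := (hG p hp q' hq' x' hx').2.2.2.2.2.1
    have := dist_triangle_left q q' p
    exact h (by linarith)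
  have hRsum : ∀ g : ((Fin 3 → ℝ)) → (Fin 3 → ℝ) → ℝ, (∀ q ∈ P, ∀ q' ∈ P, ¬ dist q q' ≤ 2 * d → g q q' = 0) →
      ∑ q ∈ P, ∑ q' ∈ P, g q q' = ∑ z ∈ R, g z.1 z.2 := by
    intro g hg
    rw [← Finset.sum_product', hR, Finset.sum_filter]
    refine Finset.sum_congr rfl fun z hz => ?_
    rw [Finset.mem_product] at hz
    split_ifs with h
    · rfl
    · exact hg _ hz.1 _ hz.2 h
  have hRcard : (R.card : ℝ) ≤ N * (Λ * (2 * d / δ) ^ t) := by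
    rw [Finset.card_filter, Finset.sum_product]
    push_cast
    rw [hN, ← nsmul_eq_mul]
    refine Finset.sum_le_card_nsmul _ _ _ fun q hq => ?_
    refine le_trans (le_of_eq ?_) (H.cntP q hq (2 * d) (by linarith))
    rw [Finset.card_filter]
    push_cast
    rfl
  have hCS : (∑ q ∈ P, ∑ q' ∈ P, B q q') ^ 2 ≤ N * (Λ * (2 * d / δ) ^ t) * ∑ q ∈ P, ∑ q' ∈ P, (B q q') ^ 2 := by
    rw [hRsum B hB0, hRsum (fun q q' => (B q q') ^ 2) (fun q hq q' hq' h => by simp only [hB0 q hq q' hq' h]; norm_num)]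
    calc _ ≤ (R.card : ℝ) * ∑ z ∈ R, (B z.1 z.2) ^ 2 := sq_sum_le_card_mul_sum_sq
      _ ≤ _ := by
        gcongr
  change l * ∑ q ∈ P, ∑ q' ∈ P, (B q q') ^ 2 ≤ _ at acore
  set Ch := ∑ q ∈ P, ∑ q' ∈ P, B q q' with hChdef
  set S2 := ∑ q ∈ P, ∑ q' ∈ P, (B q q') ^ 2 with hS2
  clear_value Ch S2 Y B w
  -- the exponents
  have hexp : (2 * d / δ) ^ t * ((46 * σ / d / δ) ^ s * (16 / σ) ^ s) ≤ 1472 * E ^ 2 := by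
    have h1 : (2 * d / δ) ^ t ≤ 2 * (d / δ) ^ s := by
      rw [show 2 * d / δ = 2 * (d / δ) by ring]
      refine (rpow_le_self_mul (by norm_num) (by positivity) H.t0.le H.t1).trans ?_
      have : 1 ≤ d / δ := by rw [le_div_iff₀ δ0]; linarith
      have := Real.rpow_le_rpow_of_exponent_le this hts
      linarith
    have h2 : (46 * σ / d / δ) ^ s * (16 / σ) ^ s ≤ 736 * (1 / (d * δ)) ^ s := by
      rw [← Real.mul_rpow (by positivity) (by positivity)]
      rw [show 46 * σ / d / δ * (16 / σ) = 736 * (1 / (d * δ)) by field_simp; norm_num]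
      exact rpow_le_self_mul (by norm_num) (by positivity) H.s0.le H.s1
    have h3 : (d / δ) ^ s * (1 / (d * δ)) ^ s = E ^ 2 := by
      rw [← Real.mul_rpow (by positivity) (by positivity), hE, sq, ← Real.mul_rpow (by positivity) (by positivity)]
      congr 1
      field_simp
    calc _ ≤ (2 * (d / δ) ^ s) * (736 * (1 / (d * δ)) ^ s) := by gcongr
      _ = 1472 * ((d / δ) ^ s * (1 / (d * δ)) ^ s) := by ring
      _ = _ := by rw [h3]
  have hfin : l * Ch ^ 2 ≤ 64 * 3 * 1472 * N ^ 2 * Λ ^ 5 * E ^ 4 / μ := by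
    calc l * Ch ^ 2 ≤ l * (N * (Λ * (2 * d / δ) ^ t) * S2) := by gcongr
      _ = N * (Λ * (2 * d / δ) ^ t) * (l * S2) := by ring
      _ ≤ N * (Λ * (2 * d / δ) ^ t) * (64 * (N * ((Λ * E) ^ 2 * (Λ * (46 * σ / d / δ) ^ s) * (3 * (Λ * (16 / σ) ^ s) / μ)))) := by gcongr
      _ = 64 * 3 * N ^ 2 * Λ ^ 5 * E ^ 2 / μ * ((2 * d / δ) ^ t * ((46 * σ / d / δ) ^ s * (16 / σ) ^ s)) := by ring
      _ ≤ 64 * 3 * N ^ 2 * Λ ^ 5 * E ^ 2 / μ * (1472 * E ^ 2) := by gcongr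
      _ = _ := by ring
  have hChlow : N * E ^ 2 ≤ 32 * Λ ^ 6 * Ch := by
    have h1 : (N * E) ^ 2 ≤ (4 * Λ ^ 3 * Y) ^ 2 := by gcongr
    have h2 : (N * E) ^ 2 ≤ 16 * Λ ^ 6 * (2 * N * Ch) := by
      calc _ ≤ 16 * Λ ^ 6 * Y ^ 2 := by rw [show 16 * Λ ^ 6 * Y ^ 2 = (4 * Λ ^ 3 * Y) ^ 2 by ring]; exact h1
        _ ≤ _ := by gcongr
    have h3 : N * (N * E ^ 2) ≤ N * (32 * Λ ^ 6 * Ch) := by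
      calc _ = (N * E) ^ 2 := by ring
        _ ≤ _ := h2
        _ = _ := by ring
    exact le_of_mul_le_mul_left h3 N0
  rw [le_div_iff₀ hμ] at hfin
  have h5 : (N * E ^ 2) ^ 2 ≤ (32 * Λ ^ 6 * Ch) ^ 2 := by gcongr
  have h6 : (μ * l) * (N ^ 2 * E ^ 4) ≤ (1024 * (64 * 3 * 1472) * Λ ^ 17) * (N ^ 2 * E ^ 4) := by
    calc (μ * l) * (N ^ 2 * E ^ 4) = (μ * l) * (N * E ^ 2) ^ 2 := by ring
      _ ≤ (μ * l) * (32 * Λ ^ 6 * Ch) ^ 2 := by gcongr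
      _ = 1024 * Λ ^ 12 * (l * Ch ^ 2 * μ) := by ring
      _ ≤ 1024 * Λ ^ 12 * (64 * 3 * 1472 * N ^ 2 * Λ ^ 5 * E ^ 4) := by gcongr
      _ = _ := by ring
  have h7 := le_of_mul_le_mul_right h6 (by positivity)
  calc μ * l ≤ 1024 * (64 * 3 * 1472) * Λ ^ 17 := h7
    _ ≤ Λ ^ 3 * Λ ^ 17 := by
        have : (10000:ℝ) ^ 3 ≤ Λ ^ 3 := by gcongr
        gcongr
        linarith
    _ = _ := by ring

end DiscHyp

lemma dyadic_exists (k : ℕ) (D : ℝ) (h1 : (1 / 2 : ℝ) ^ k ≤ D) (h2 : D ≤ 1) :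
    ∃ i, i ≤ k ∧ (1 / 2 : ℝ) ^ i / 2 < D ∧ D ≤ (1 / 2 : ℝ) ^ i := by
  induction k with
  | zero => exact ⟨0, le_rfl, by norm_num at h1 ⊢; linarith, by simpa using h2⟩
  | succ k ih =>
    by_cases h : (1 / 2 : ℝ) ^ k ≤ D
    · obtain ⟨i, hi, h3⟩ := ih h
      exact ⟨i, by omega, h3⟩
    · by_cases h' : D = (1 / 2 : ℝ) ^ (k + 1)
      · exact ⟨k + 1, le_rfl, by rw [h']; have : 0 < (1 / 2 : ℝ) ^ (k + 1) := by positivity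
                                 linarith, h'.le⟩
      · refine ⟨k, by omega, ?_, (not_le.1 h).le⟩
        have : (1 / 2 : ℝ) ^ (k + 1) < D := lt_of_le_of_ne h1 (Ne.symm h')
        rw [pow_succ] at this
        linarith

namespace DiscHyp
variable {β : Type*} [DecidableEq β] {f f1 f2 : (Fin 3 → ℝ) → ℝ → ℝ} {U : Set (Fin 3 → ℝ)} {lo hi : ℝ}
    {P : Finset (Fin 3 → ℝ)} {F : Finset β} {ξ y : β → ℝ} {T : (Fin 3 → ℝ) → Finset β}
    {δ s t Λ : ℝ}

lemma card_pos (H : DiscHyp f f1 f2 U lo hi P F ξ y T δ s t Λ) : (0:ℝ) < P.card := by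
  have h1 := H.lowP
  have δ0 := H.δ0
  have h2 : 0 < (1 / δ) ^ t := by positivity
  by_contra h
  have : (P.card : ℝ) = 0 := le_antisymm (not_lt.1 h) (by positivity)
  rw [this] at h1
  linarith

/-- total mass of ordered triples -/
lemma mass (H : DiscHyp f f1 f2 U lo hi P F ξ y T δ s t Λ) (m : β → ℝ) (X μ : ℝ)
    (hm : ∀ x ∈ F, m x = (P.filter fun p => x ∈ T p).card)
    (hX : X = ∑ p ∈ P, ((T p).card : ℝ)) (hμ : 0 < μ) (hμX : μ * F.card = X / 2) :
    X / 4 ≤ ∑ z ∈ (P ×ˢ P ×ˢ F).filter (fun z => z.2.2 ∈ T z.1 ∧ z.2.2 ∈ T z.2.1 ∧ μ ≤ m z.2.2 ∧ z.1 2 ≤ z.2.1 2),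
      1 / m z.2.2 := by
  classical
  set A : (Fin 3 → ℝ) → (Fin 3 → ℝ) → β → ℝ := fun p q x => if x ∈ T p ∧ x ∈ T q ∧ μ ≤ m x ∧ p 2 ≤ q 2 then 1 / m x else 0 with hA
  have e0 : ∑ z ∈ (P ×ˢ P ×ˢ F).filter (fun z => z.2.2 ∈ T z.1 ∧ z.2.2 ∈ T z.2.1 ∧ μ ≤ m z.2.2 ∧ z.1 2 ≤ z.2.1 2),
      1 / m z.2.2 = ∑ p ∈ P, ∑ q ∈ P, ∑ x ∈ F, A p q x := by
    rw [Finset.sum_filter, Finset.sum_product]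
    refine Finset.sum_congr rfl fun p _ => ?_
    rw [Finset.sum_product]
  rw [e0]
  have hXm : X = ∑ x ∈ F, m x := by
    have : ∀ p ∈ P, ((T p).card : ℝ) = ∑ x ∈ F, if x ∈ T p then (1:ℝ) else 0 := by
      intro p hp
      rw [← Finset.sum_filter, Finset.sum_const, nsmul_eq_mul, mul_one]
      congr 2
      ext x
      rw [Finset.mem_filter]
      exact ⟨fun h => ⟨H.TF p hp h, h⟩, fun h => h.2⟩
    rw [hX, Finset.sum_congr rfl this, Finset.sum_comm]
    refine Finset.sum_congr rfl fun x hx => ?_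
    rw [hm x hx, ← Finset.sum_filter, Finset.sum_const, nsmul_eq_mul, mul_one]
  have e1 : X / 2 ≤ ∑ p ∈ P, ∑ q ∈ P, ∑ x ∈ F, if x ∈ T p ∧ x ∈ T q ∧ μ ≤ m x then 1 / m x else 0 := by
    have : ∑ p ∈ P, ∑ q ∈ P, ∑ x ∈ F, (if x ∈ T p ∧ x ∈ T q ∧ μ ≤ m x then 1 / m x else 0)
        = ∑ x ∈ F, ∑ p ∈ P, ∑ q ∈ P, (if x ∈ T p ∧ x ∈ T q ∧ μ ≤ m x then 1 / m x else 0) := by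
      calc _ = ∑ p ∈ P, ∑ x ∈ F, ∑ q ∈ P, (if x ∈ T p ∧ x ∈ T q ∧ μ ≤ m x then 1 / m x else 0) :=
            Finset.sum_congr rfl fun _ _ => Finset.sum_comm
        _ = _ := Finset.sum_comm
    rw [this]
    have hlow : ∑ x ∈ F, (m x - μ) = X / 2 := by
      rw [Finset.sum_sub_distrib, ← hXm, Finset.sum_const, nsmul_eq_mul]
      linarith
    rw [← hlow]
    refine Finset.sum_le_sum fun x hx => ?_
    by_cases c : μ ≤ m x
    · have hm0 : 0 < m x := hμ.trans_le c
      have : ∀ p q, (if x ∈ T p ∧ x ∈ T q ∧ μ ≤ m x then 1 / m x else 0) = (if x ∈ T p then 1 else 0) * ((if x ∈ T q then 1 else 0) * (1 / m x)) := by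
        intro p q
        by_cases h1 : x ∈ T p <;> by_cases h2 : x ∈ T q <;> simp [h1, h2, c]
      simp only [this]
      rw [← Finset.sum_mul_sum, ← Finset.sum_mul]
      have e : ∑ p ∈ P, (if x ∈ T p then (1:ℝ) else 0) = m x := by
        rw [← Finset.sum_filter, Finset.sum_const, nsmul_eq_mul, mul_one, hm x hx]
      rw [e]
      have : m x * (m x * (1 / m x)) = m x := by field_simp
      rw [this]
      linarith
    · have : 0 ≤ ∑ p ∈ P, ∑ q ∈ P, (if x ∈ T p ∧ x ∈ T q ∧ μ ≤ m x then 1 / m x else 0) := by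
        refine Finset.sum_nonneg fun p _ => Finset.sum_nonneg fun q _ => ?_
        rw [if_neg (fun h => c h.2.2)]
      linarith
  have e2 : ∑ p ∈ P, ∑ q ∈ P, ∑ x ∈ F, (if x ∈ T p ∧ x ∈ T q ∧ μ ≤ m x then 1 / m x else 0)
      ≤ ∑ p ∈ P, ∑ q ∈ P, ∑ x ∈ F, (A p q x + A q p x) := by
    refine Finset.sum_le_sum fun p _ => Finset.sum_le_sum fun q _ => Finset.sum_le_sum fun x hx => ?_
    have Ann : ∀ p q, 0 ≤ A p q x := by
      intro p q
      simp only [hA]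
      split_ifs with h
      · exact (one_div_pos.2 (hμ.trans_le h.2.2.1)).le
      · exact le_rfl
    have a1 := Ann p q
    have a2 := Ann q p
    by_cases h : x ∈ T p ∧ x ∈ T q ∧ μ ≤ m x
    · rw [if_pos h]
      rcases le_total (p 2) (q 2) with c | c
      · have : A p q x = 1 / m x := if_pos ⟨h.1, h.2.1, h.2.2, c⟩
        linarith
      · have : A q p x = 1 / m x := if_pos ⟨h.2.1, h.1, h.2.2, c⟩
        linarith
    · rw [if_neg h]; linarith
  have e3 : ∑ p ∈ P, ∑ q ∈ P, ∑ x ∈ F, (A p q x + A q p x) = 2 * ∑ p ∈ P, ∑ q ∈ P, ∑ x ∈ F, A p q x := by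
    simp only [Finset.sum_add_distrib]
    rw [two_mul]
    congr 1
    exact Finset.sum_comm
  linarith

lemma steep_num {X μ κ Λ N A B E : ℝ} (Λ0 : 0 < Λ) (κ0 : 0 < κ) (N0 : 0 < N)
    (h : X * μ ≤ N * (Λ * A * (2 * (Λ * B))) * (4 * Λ ^ 2)) (hexp : A * B ≤ 16 / κ * E) (hNE : N * E ≤ Λ * X) :
    X * (μ * κ) ≤ X * (128 * Λ ^ 5) := by
  calc X * (μ * κ) = X * μ * κ := by ring
    _ ≤ N * (Λ * A * (2 * (Λ * B))) * (4 * Λ ^ 2) * κ := mul_le_mul_of_nonneg_right h κ0.le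
    _ = 8 * Λ ^ 4 * κ * N * (A * B) := by ring
    _ ≤ 8 * Λ ^ 4 * κ * N * (16 / κ * E) := by gcongr
    _ = 128 * Λ ^ 4 * (N * E) := by field_simp; ring
    _ ≤ 128 * Λ ^ 4 * (Λ * X) := by gcongr
    _ = _ := by ring

set_option maxHeartbeats 1600000 in
lemma mu_bound (H : DiscHyp f f1 f2 U lo hi P F ξ y T δ s t Λ) (hts : t ≤ s) (k : ℕ)
    (hk : δ = (1 / 2) ^ k) (hkΛ : (k : ℝ) + 2 ≤ Λ) (m : β → ℝ) (X μ l κ : ℝ)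
    (hm : ∀ x ∈ F, m x = (P.filter fun p => x ∈ T p).card)
    (hX : X = ∑ p ∈ P, ((T p).card : ℝ)) (hμ : 0 < μ) (hμX : μ * F.card = X / 2)
    (hl0 : 0 < l) (hl1 : l ≤ 1) (hls : l ^ s ≤ 1 / Λ ^ 5) (hκ : κ = l / Λ) :
    μ * κ ^ 2 ≤ 4 * Λ ^ 3 ∨ μ * κ ≤ 128 * Λ ^ 5 ∨ μ * l ≤ Λ ^ 20 := by
  classical
  have δ0 := H.δ0
  have Λ1 := H.Λ1
  have Λ0 : 0 < Λ := by linarith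
  have s0 := H.s0
  have t0 := H.t0
  have κ0 : 0 < κ := by rw [hκ]; positivity
  have κl : κ * 10000 ≤ l := by
    rw [hκ, div_mul_eq_mul_div, div_le_iff₀ Λ0]
    nlinarith
  have κs : κ ≤ 1 / 10000 := by linarith
  set E := (1 / δ) ^ s with hE
  have E0 : 0 < E := by positivity
  have N0 := H.card_pos
  have hNE : P.card * E ≤ Λ * X := by
    rw [hX, Finset.mul_sum, ← nsmul_eq_mul]
    exact Finset.card_nsmul_le_sum _ _ _ fun p hp => H.lowT p hp
  have X0 : 0 < X := by
    have : 0 < P.card * E := by positivity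
    by_contra h
    have : Λ * X ≤ 0 := mul_nonpos_of_nonneg_of_nonpos Λ0.le (not_lt.1 h)
    linarith
  set S := (P ×ˢ P ×ˢ F).filter (fun z => z.2.2 ∈ T z.1 ∧ z.2.2 ∈ T z.2.1 ∧ μ ≤ m z.2.2 ∧ z.1 2 ≤ z.2.1 2) with hS
  have hmass := H.mass m X μ hm hX hμ hμX
  rw [← hS] at hmass
  have memS : ∀ z ∈ S, z.1 ∈ P ∧ z.2.1 ∈ P ∧ z.2.2 ∈ F ∧ z.2.2 ∈ T z.1 ∧ z.2.2 ∈ T z.2.1 ∧ μ ≤ m z.2.2 ∧ z.1 2 ≤ z.2.1 2 := by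
    intro z hz
    rw [hS, Finset.mem_filter, Finset.mem_product, Finset.mem_product] at hz
    exact ⟨hz.1.1, hz.1.2.1, hz.1.2.2, hz.2⟩
  let dd : (Fin 3 → ℝ) × (Fin 3 → ℝ) × β → ℝ := fun z => dist z.1 z.2.1
  let hh : (Fin 3 → ℝ) × (Fin 3 → ℝ) × β → ℝ := fun z => |f1 z.2.1 (ξ z.2.2) - f1 z.1 (ξ z.2.2)|
  have hclass : ∀ z ∈ S, ∃ c : ℕ × ℕ, c ∈ (Finset.range (k + 2) ×ˢ Finset.range (k + 2)) ∧
      ((c.1 = 0 ∧ dd z ≤ δ / κ ^ 2) ∨ ∃ i, c.1 = i + 1 ∧ δ / κ ^ 2 < dd z ∧ (1 / 2 : ℝ) ^ i / 2 < dd z ∧ dd z ≤ (1 / 2 : ℝ) ^ i ∧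
        ((c.2 = 0 ∧ κ * dd z < hh z) ∨ ∃ j, c.2 = j + 1 ∧ hh z ≤ κ * dd z ∧
          (1 / 2 : ℝ) ^ j / 2 < max (hh z) (√(dd z * δ)) ∧ max (hh z) (√(dd z * δ)) ≤ (1 / 2 : ℝ) ^ j)) := by
    intro z hz
    obtain ⟨h1, h2, h3, h4, h5, h6, h7⟩ := memS z hz
    have hD1 : dd z ≤ 1 := H.Pdiam _ h1 _ h2
    by_cases c1 : dd z ≤ δ / κ ^ 2
    · exact ⟨(0, 0), by simp, Or.inl ⟨rfl, c1⟩⟩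
    push Not at c1
    have hδD : δ < dd z := by
      refine lt_of_le_of_lt ?_ c1
      rw [le_div_iff₀ (by positivity)]
      have : κ ^ 2 ≤ 1 := by nlinarith
      exact mul_le_of_le_one_right δ0.le this
    obtain ⟨i, hi, i1, i2⟩ := dyadic_exists k (dd z) (by rw [← hk]; exact hδD.le) hD1
    by_cases c2 : κ * dd z < hh z
    · exact ⟨(i + 1, 0), by simp; omega, Or.inr ⟨i, rfl, c1, i1, i2, Or.inl ⟨rfl, c2⟩⟩⟩
    push Not at c2
    have hsq : δ ≤ √(dd z * δ) := by
      apply Real.le_sqrt_of_sq_le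
      nlinarith
    have hsq2 : √(dd z * δ) ≤ 1 := by
      rw [Real.sqrt_le_one]
      nlinarith [H.δ1]
    have hD0 : 0 < dd z := δ0.trans hδD
    obtain ⟨j, hj, j1, j2⟩ := dyadic_exists k (max (hh z) (√(dd z * δ))) (by rw [← hk]; exact hsq.trans (le_max_right _ _))
      (max_le (c2.trans (by nlinarith)) hsq2)
    exact ⟨(i + 1, j + 1), by simp; omega, Or.inr ⟨i, rfl, c1, i1, i2, Or.inr ⟨j, rfl, c2, j1, j2⟩⟩⟩
  choose! cl hcl1 hcl2 using hclass
  have hcardC : (((Finset.range (k + 2) ×ˢ Finset.range (k + 2)).card : ℕ) : ℝ) ≤ Λ ^ 2 := by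
    rw [Finset.card_product, Finset.card_range]
    push_cast
    nlinarith
  obtain ⟨c, hcC, hc⟩ := Finset.exists_le_sum_fiber_of_maps_to_of_nsmul_le_sum (b := X / (4 * Λ ^ 2)) (w := fun z => 1 / m z.2.2) hcl1 ⟨(0, 0), by simp⟩ (by
    refine le_trans ?_ hmass
    rw [nsmul_eq_mul]
    calc _ ≤ Λ ^ 2 * (X / (4 * Λ ^ 2)) := by gcongr
      _ = X / 4 := by field_simp)
  set S' := S.filter (fun z => cl z = c) with hS'
  have memS' : ∀ z ∈ S', z ∈ S ∧ cl z = c := fun z hz => Finset.mem_filter.1 hz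
  clear_value S'
  rw [div_le_iff₀ (by positivity)] at hc
  have hcμ : ∑ z ∈ S', 1 / m z.2.2 ≤ S'.card / μ := by
    calc ∑ z ∈ S', 1 / m z.2.2 ≤ ∑ z ∈ S', 1 / μ :=
          Finset.sum_le_sum fun z hz => one_div_le_one_div_of_le hμ (memS z (memS' z hz).1).2.2.2.2.2.1
      _ = S'.card / μ := by rw [Finset.sum_const, nsmul_eq_mul]; ring
  have hcard' : X * μ ≤ S'.card * (4 * Λ ^ 2) := by
    have : X ≤ S'.card / μ * (4 * Λ ^ 2) := hc.trans (by gcongr)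
    rw [div_mul_eq_mul_div, le_div_iff₀ hμ] at this
    exact this
  rcases hc1 : c.1 with _ | i
  · left
    have sub : S' ⊆ P.biUnion fun p => (({p} : Finset (Fin 3 → ℝ)) ×ˢ (P.filter fun q => dist p q ≤ δ / κ ^ 2) ×ˢ T p) := by
      intro z hz
      obtain ⟨h1, h2⟩ := memS' z hz
      have h3 := memS z h1
      have h4 : dd z ≤ δ / κ ^ 2 := by
        rcases hcl2 z h1 with h | ⟨i, h, _⟩
        · exact h.2
        · rw [h2, hc1] at h; omega
      rw [Finset.mem_biUnion]
      refine ⟨z.1, h3.1, ?_⟩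
      simp only [Finset.mem_product, Finset.mem_singleton, Finset.mem_filter]
      exact ⟨trivial, ⟨h3.2.1, h4⟩, h3.2.2.2.1⟩
    have hcd : (S'.card : ℝ) ≤ Λ / κ ^ 2 * X := by
      calc (S'.card : ℝ) ≤ ∑ p ∈ P, ((({p} : Finset (Fin 3 → ℝ)) ×ˢ (P.filter fun q => dist p q ≤ δ / κ ^ 2) ×ˢ T p).card : ℝ) := by
            exact_mod_cast (Finset.card_le_card sub).trans Finset.card_biUnion_le
        _ ≤ ∑ p ∈ P, (Λ / κ ^ 2 * (T p).card) := by
            refine Finset.sum_le_sum fun p hp => ?_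
            rw [Finset.card_product, Finset.card_product, Finset.card_singleton, one_mul]
            push_cast
            gcongr
            have h1 : (1:ℝ) ≤ 1 / κ ^ 2 := by
              rw [le_div_iff₀ (by positivity)]; nlinarith
            refine (H.cntP p hp (δ / κ ^ 2) ?_).trans ?_
            · rw [div_eq_mul_one_div]; nlinarith
            · rw [show δ / κ ^ 2 / δ = 1 / κ ^ 2 by field_simp]
              have : (1 / κ ^ 2) ^ t ≤ (1 / κ ^ 2) ^ (1:ℝ) := Real.rpow_le_rpow_of_exponent_le h1 H.t1
              rw [Real.rpow_one] at this
              calc _ ≤ Λ * (1 / κ ^ 2) := by gcongr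
                _ = _ := by ring
        _ = _ := by rw [← Finset.mul_sum, hX]
    have h5 : X * μ ≤ Λ / κ ^ 2 * X * (4 * Λ ^ 2) := hcard'.trans (by gcongr)
    have h6 : X * (μ * κ ^ 2) ≤ X * (4 * Λ ^ 3) := by
      calc X * (μ * κ ^ 2) = X * μ * κ ^ 2 := by ring
        _ ≤ Λ / κ ^ 2 * X * (4 * Λ ^ 2) * κ ^ 2 := by gcongr
        _ = _ := by field_simp
    exact le_of_mul_le_mul_left h6 X0
  · have hik : i ≤ k := by
      rw [Finset.mem_product, Finset.mem_range, hc1] at hcC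
      omega
    set d := (1 / 2 : ℝ) ^ i with hd
    have hd0 : 0 < d := by positivity
    have hδd : δ ≤ d := by
      rw [hk, hd]
      exact pow_le_pow_of_le_one (by norm_num) (by norm_num) hik
    have R100 : 100 * δ ≤ δ / κ ^ 2 := by
      rw [le_div_iff₀ (by positivity)]
      have : κ ^ 2 ≤ 1 / 100 := by nlinarith
      nlinarith
    right
    rcases hc2 : c.2 with _ | j
    · left
      have info : ∀ z ∈ S', z ∈ S ∧ δ / κ ^ 2 < dd z ∧ d / 2 < dd z ∧ dd z ≤ d ∧ κ * dd z < hh z := by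
        intro z hz
        obtain ⟨h1, h2⟩ := memS' z hz
        rcases hcl2 z h1 with h | ⟨i', h, g1, g2, g3, ⟨_, g4⟩ | ⟨j', h', _⟩⟩
        · rw [h2, hc1] at h; omega
        · rw [h2, hc1] at h
          have : i' = i := by omega
          subst this
          exact ⟨h1, g1, g2, g3, g4⟩
        · rw [h2, hc2] at h'; omega
      have sub : S' ⊆ P.biUnion fun p => (P.filter fun q => dist p q ≤ d).biUnion fun q =>
          (({p} : Finset (Fin 3 → ℝ)) ×ˢ ({q} : Finset (Fin 3 → ℝ)) ×ˢ (F.filter fun x => (p, q, x) ∈ S')) := by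
        intro z hz
        have h1 := info z hz
        have h3 := memS z h1.1
        rw [Finset.mem_biUnion]
        refine ⟨z.1, h3.1, ?_⟩
        rw [Finset.mem_biUnion]
        refine ⟨z.2.1, Finset.mem_filter.2 ⟨h3.2.1, h1.2.2.2.1⟩, ?_⟩
        simp only [Finset.mem_product, Finset.mem_singleton, Finset.mem_filter]
        exact ⟨trivial, trivial, h3.2.2.1, hz⟩
      have pair : ∀ p ∈ P, ∀ q ∈ P, ((F.filter fun x => (p, q, x) ∈ S').card : ℝ) ≤ 2 * (Λ * (16 / (κ * d)) ^ s) := by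
        intro p hp q hq
        rcases (F.filter fun x => (p, q, x) ∈ S').eq_empty_or_nonempty with h | ⟨x0, h0⟩
        · rw [h]; simp; positivity
        · have i0 := info _ (Finset.mem_filter.1 h0).2
          simp only [dd, hh] at i0
          have := H.steep hp hq (σ := κ * d / 2) (by positivity) (by nlinarith) (by linarith)
            (F.filter fun x => (p, q, x) ∈ S')
            (fun x hx => (memS _ (info _ (Finset.mem_filter.1 hx).2).1).2.2.2.1)
            (fun x hx => (memS _ (info _ (Finset.mem_filter.1 hx).2).1).2.2.2.2.1)
            (fun x hx => by
              have := info _ (Finset.mem_filter.1 hx).2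
              simp only [dd, hh] at this
              nlinarith)
          rwa [show 8 / (κ * d / 2) = 16 / (κ * d) by field_simp; norm_num] at this
      have hcd : (S'.card : ℝ) ≤ P.card * (Λ * (d / δ) ^ t * (2 * (Λ * (16 / (κ * d)) ^ s))) := by
        refine le_trans (Nat.cast_le.2 ((Finset.card_le_card sub).trans Finset.card_biUnion_le)) ?_
        push_cast
        rw [← nsmul_eq_mul (P.card)]
        refine Finset.sum_le_card_nsmul _ _ _ fun p hp => ?_
        refine le_trans (Nat.cast_le.2 Finset.card_biUnion_le) ?_
        push_cast
        refine le_trans (Finset.sum_le_card_nsmul _ _ (2 * (Λ * (16 / (κ * d)) ^ s)) fun q hq => ?_) ?_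
        · rw [Finset.card_product, Finset.card_product, Finset.card_singleton, Finset.card_singleton, one_mul, one_mul]
          exact pair p hp q (Finset.mem_filter.1 hq).1
        · rw [nsmul_eq_mul]
          gcongr
          exact H.cntP p hp d hδd
      have hexp : (d / δ) ^ t * (16 / (κ * d)) ^ s ≤ 16 / κ * E := by
        have h1 : (d / δ) ^ t ≤ (d / δ) ^ s :=
          Real.rpow_le_rpow_of_exponent_le (by rw [le_div_iff₀ δ0]; linarith) hts
        have h2 : (16 / (κ * d)) ^ s ≤ 16 / κ * (1 / d) ^ s := by
          rw [show 16 / (κ * d) = 16 / κ * (1 / d) by field_simp]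
          exact rpow_le_self_mul (by rw [le_div_iff₀ κ0]; linarith) (by positivity) s0.le H.s1
        have h3 : (d / δ) ^ s * (1 / d) ^ s = E := by
          rw [← Real.mul_rpow (by positivity) (by positivity), hE]
          congr 1
          field_simp
        calc _ ≤ (d / δ) ^ s * (16 / κ * (1 / d) ^ s) := by gcongr
          _ = 16 / κ * ((d / δ) ^ s * (1 / d) ^ s) := by ring
          _ = _ := by rw [h3]
      have h50 : X * μ ≤ P.card * (Λ * (d / δ) ^ t * (2 * (Λ * (16 / (κ * d)) ^ s))) * (4 * Λ ^ 2) :=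
        hcard'.trans (mul_le_mul_of_nonneg_right hcd (by positivity))
      have h5 := steep_num Λ0 κ0 N0 h50 hexp hNE
      exact le_of_mul_le_mul_left h5 X0
    · right
      set σ := (1 / 2 : ℝ) ^ j with hσ
      have σ0 : 0 < σ := by positivity
      have info : ∀ z ∈ S', z ∈ S ∧ δ / κ ^ 2 < dd z ∧ d / 2 < dd z ∧ dd z ≤ d ∧ hh z ≤ κ * dd z ∧
          σ / 2 < max (hh z) (√(dd z * δ)) ∧ max (hh z) (√(dd z * δ)) ≤ σ := by
        intro z hz
        obtain ⟨h1, h2⟩ := memS' z hz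
        rcases hcl2 z h1 with h | ⟨i', h, g1, g2, g3, ⟨h', _⟩ | ⟨j', h', g4, g5, g6⟩⟩
        · rw [h2, hc1] at h; omega
        · rw [h2, hc2] at h'; omega
        · rw [h2, hc1] at h
          rw [h2, hc2] at h'
          have : i' = i := by omega
          subst this
          have : j' = j := by omega
          subst this
          exact ⟨h1, g1, g2, g3, g4, g5, g6⟩
      set G : (Fin 3 → ℝ) → (Fin 3 → ℝ) → Finset β := fun p q => F.filter fun x => (p, q, x) ∈ S' with hGd
      have hsum : ∑ z ∈ S', 1 / m z.2.2 = ∑ p ∈ P, ∑ q ∈ P, ∑ x ∈ G p q, 1 / m x := by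
        have : S' = (P ×ˢ P ×ˢ F).filter (fun z => z ∈ S') := by
          ext z
          rw [Finset.mem_filter, Finset.mem_product, Finset.mem_product]
          exact ⟨fun h => ⟨⟨(memS z (memS' z h).1).1, (memS z (memS' z h).1).2.1, (memS z (memS' z h).1).2.2.1⟩, h⟩, fun h => h.2⟩
        conv_lhs => rw [this]
        rw [Finset.sum_filter, Finset.sum_product]
        refine Finset.sum_congr rfl fun p _ => ?_
        rw [Finset.sum_product]
        refine Finset.sum_congr rfl fun q _ => ?_
        rw [hGd, Finset.sum_filter]
      rw [hsum] at hc
      have maxle : ∀ z ∈ S', σ ≤ 2 * κ * dd z := by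
        intro z hz
        obtain ⟨h1, h2, h3, h4, h5, h6, h7⟩ := info z hz
        have hD0 : 0 < dd z := by linarith
        have : √(dd z * δ) ≤ κ * dd z := by
          apply Real.sqrt_le_iff.2 ⟨by positivity, ?_⟩
          rw [div_lt_iff₀ (by positivity)] at h2
          nlinarith
        have := max_le h5 this
        linarith
      have hne : S'.Nonempty := by
        rw [Finset.nonempty_iff_ne_empty]
        intro h
        rw [h] at hcard'
        simp at hcard'
        have : 0 < X * μ := by positivity
        linarith
      obtain ⟨z0, hz0⟩ := hne
      refine H.tang_final hts m μ d σ l G hμ hδd σ0 hm ?_ hl1 hls ?_ ?_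
      · rw [div_le_iff₀ hd0]
        have := maxle z0 hz0
        have := (info z0 hz0).2.2.2.1
        nlinarith
      · intro p hp q hq x hx
        have hz := (Finset.mem_filter.1 hx).2
        obtain ⟨h1, h2, h3, h4, h5, h6, h7⟩ := info _ hz
        obtain ⟨_, _, g3, g4, g5, g6, g7⟩ := memS _ h1
        simp only [dd, hh] at h2 h3 h4 h5 h6 h7
        simp only at g3 g4 g5 g6 g7
        have hpq : p ≠ q := by rintro rfl; rw [dist_self] at h3; linarith
        have J := H.cine.jet (H.PU p hp) (H.PU q hq) hpq
        have hD := J.tangent (H.ξI x g3) (by linarith) (H.hdiff hp hq g4 g5) (by nlinarith)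
        rw [abs_of_nonneg (by linarith)] at hD
        refine ⟨g4, g5, g6, (le_max_left _ _).trans h7, h3, h4, ?_, ?_, hD, by linarith⟩
        · have := (le_max_right _ _).trans h7
          rw [Real.sqrt_le_iff] at this
          linarith [this.2]
        · rcases lt_max_iff.1 h6 with h | h
          · exact Or.inl h
          · right
            rw [Real.lt_sqrt (by positivity)] at h
            linarith
      · have h8 : P.card * E ≤ Λ * ((∑ p ∈ P, ∑ q ∈ P, ∑ x ∈ G p q, 1 / m x) * (4 * Λ ^ 2)) := hNE.trans (by gcongr)
        calc _ ≤ _ := h8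
          _ = _ := by ring

set_option maxHeartbeats 1600000 in
lemma disc2 (H : DiscHyp f f1 f2 U lo hi P F ξ y T δ s t Λ) (hts : t ≤ s) (k : ℕ)
    (hk : δ = (1 / 2) ^ k) (hkΛ : (k : ℝ) + 2 ≤ Λ) (n : ℕ) (hn : 1 ≤ n * s) :
    (1 / δ) ^ (s + t) ≤ Λ ^ (23 + 10 * n) * F.card := by
  classical
  have δ0 := H.δ0
  have Λ1 := H.Λ1
  have Λ0 : 0 < Λ := by linarith
  have N0 := H.card_pos
  set X : ℝ := ∑ p ∈ P, ((T p).card : ℝ) with hX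
  have hNE : P.card * (1 / δ) ^ s ≤ Λ * X := by
    rw [hX, Finset.mul_sum, ← nsmul_eq_mul]
    exact Finset.card_nsmul_le_sum _ _ _ fun p hp => H.lowT p hp
  have hE2 : (1 / δ) ^ (s + t) ≤ Λ ^ 2 * X := by
    rw [Real.rpow_add (by positivity)]
    calc (1 / δ) ^ s * (1 / δ) ^ t ≤ (1 / δ) ^ s * (Λ * P.card) := by gcongr; exact H.lowP
      _ = Λ * (P.card * (1 / δ) ^ s) := by ring
      _ ≤ Λ * (Λ * X) := by gcongr
      _ = _ := by ring
  have X0 : 0 < X := by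
    have : 0 < (1 / δ) ^ (s + t) := by positivity
    by_contra h
    have : Λ ^ 2 * X ≤ 0 := mul_nonpos_of_nonneg_of_nonpos (by positivity) (not_lt.1 h)
    linarith
  have F0 : (0:ℝ) < F.card := by
    rw [Nat.cast_pos, Finset.card_pos]
    by_contra h
    rw [Finset.not_nonempty_iff_eq_empty] at h
    have : X = 0 := Finset.sum_eq_zero fun p hp => by
      have := H.TF p hp
      rw [h, Finset.subset_empty] at this
      rw [this]; simp
    linarith
  clear_value X
  obtain ⟨μ, hμ0, hμX⟩ : ∃ μ : ℝ, 0 < μ ∧ μ * F.card = X / 2 :=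
    ⟨X / 2 / F.card, by positivity, div_mul_cancel₀ _ F0.ne'⟩
  have hL1 : 1 ≤ Λ ^ (5 * n) := one_le_pow₀ (by linarith)
  have := H.mu_bound hts k hk hkΛ (fun x => ((P.filter fun p => x ∈ T p).card : ℝ)) X μ (1 / Λ ^ (5 * n)) (1 / Λ ^ (5 * n) / Λ)
    (fun x hx => rfl) hX hμ0 hμX (by positivity) (by rw [div_le_one (by positivity)]; exact hL1) (by
      rw [Real.div_rpow (by norm_num) (by positivity), Real.one_rpow]
      apply one_div_le_one_div_of_le (by positivity)
      rw [← Real.rpow_natCast, ← Real.rpow_natCast, ← Real.rpow_mul (by positivity)]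
      apply Real.rpow_le_rpow_of_exponent_le (by linarith)
      push_cast
      linarith) rfl
  have hμΛ : μ ≤ Λ ^ (20 + 10 * n) := by
    have big : ∀ a b : ℕ, a ≤ b → Λ ^ a ≤ Λ ^ b := fun a b h => pow_le_pow_right₀ (by linarith) h
    rcases this with h | h | h
    · have e : μ ≤ 4 * Λ ^ 3 * (Λ ^ (5 * n) * Λ) ^ 2 := by
        have e1 : μ * (1 / Λ ^ (5 * n) / Λ) ^ 2 = μ / (Λ ^ (5 * n) * Λ) ^ 2 := by field_simp
        rw [e1, div_le_iff₀ (by positivity)] at h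
        exact h
      calc μ ≤ 4 * Λ ^ 3 * (Λ ^ (5 * n) * Λ) ^ 2 := e
        _ ≤ Λ * Λ ^ 3 * (Λ ^ (5 * n) * Λ) ^ 2 := by gcongr; linarith
        _ = Λ ^ (6 + 10 * n) := by ring
        _ ≤ _ := big _ _ (by omega)
    · have e : μ ≤ 128 * Λ ^ 5 * (Λ ^ (5 * n) * Λ) := by
        have e1 : μ * (1 / Λ ^ (5 * n) / Λ) = μ / (Λ ^ (5 * n) * Λ) := by field_simp
        rw [e1, div_le_iff₀ (by positivity)] at h
        exact h
      calc μ ≤ 128 * Λ ^ 5 * (Λ ^ (5 * n) * Λ) := e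
        _ ≤ Λ * Λ ^ 5 * (Λ ^ (5 * n) * Λ) := by gcongr; linarith
        _ = Λ ^ (7 + 5 * n) := by ring
        _ ≤ _ := big _ _ (by omega)
    · rw [mul_one_div, div_le_iff₀ (by positivity)] at h
      calc μ ≤ Λ ^ 20 * Λ ^ (5 * n) := h
        _ = Λ ^ (20 + 5 * n) := by ring
        _ ≤ _ := big _ _ (by omega)
  calc (1 / δ) ^ (s + t) ≤ Λ ^ 2 * X := hE2
    _ = Λ ^ 2 * (2 * μ * F.card) := by rw [show X = 2 * (μ * F.card) by linarith]; ring
    _ ≤ Λ ^ 2 * (Λ * Λ ^ (20 + 10 * n) * F.card) := by gcongr; linarith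
    _ = _ := by ring

end DiscHyp

lemma Jet.three' {h h1 h2 : ℝ → ℝ} {lo hi D l0 l1 l2 : ℝ} (J : Jet h h1 h2 lo hi D l0 l1 l2) {x y z g δ : ℝ} (hx : x ∈ Icc lo hi)
    (hy : y ∈ Icc lo hi) (hz : z ∈ Icc lo hi) (hg : 0 < g) (hg1 : g ≤ 1) (xy : g ≤ |x - y|) (yz : g ≤ |y - z|) (xz : g ≤ |x - z|)
    (x0 : |h x| ≤ 4 * δ) (y0 : |h y| ≤ 4 * δ) (z0 : |h z| ≤ 4 * δ) : D * g ^ 2 ≤ 20 * δ := by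
  rcases le_abs'.1 xy with a | a <;> rcases le_abs'.1 yz with b | b <;> rcases le_abs'.1 xz with c | c
  · exact J.three hx hy hz hg hg1 (by linarith) (by linarith) x0 y0 z0
  · exact J.three hx hy hz hg hg1 (by linarith) (by linarith) x0 y0 z0
  · exact J.three hx hz hy hg hg1 (by linarith) (by linarith) x0 z0 y0
  · exact J.three hz hx hy hg hg1 (by linarith) (by linarith) z0 x0 y0
  · exact J.three hy hx hz hg hg1 (by linarith) (by linarith) y0 x0 z0
  · exact J.three hy hz hx hg hg1 (by linarith) (by linarith) y0 z0 x0
  · exact J.three hz hy hx hg hg1 (by linarith) (by linarith) z0 y0 x0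
  · exact J.three hz hy hx hg hg1 (by linarith) (by linarith) z0 y0 x0

lemma trip_count {β : Type*} (T : Finset β) (G : β → β → Prop) [DecidableRel G] (b : ℝ)
    (hb : ∀ x ∈ T, ((T.filter fun y => ¬ G x y).card : ℝ) ≤ b) :
    (T.card : ℝ) ^ 3 ≤ (∑ x ∈ T, ∑ y ∈ T, ∑ z ∈ T, if G x y ∧ G y z ∧ G x z then (1:ℝ) else 0) + 3 * T.card ^ 2 * b := by
  have hb' : ∀ x ∈ T, (∑ y ∈ T, if ¬ G x y then (1:ℝ) else 0) ≤ b := by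
    intro x hx
    rw [← Finset.sum_filter, Finset.sum_const, nsmul_eq_mul, mul_one]
    exact hb x hx
  have e : (T.card : ℝ) ^ 3 = ∑ x ∈ T, ∑ y ∈ T, ∑ z ∈ T, (1:ℝ) := by
    simp; ring
  have h1 : ∑ x ∈ T, ∑ y ∈ T, ∑ z ∈ T, (if ¬ G x y then (1:ℝ) else 0) ≤ T.card ^ 2 * b := by
    have : ∀ x ∈ T, ∑ y ∈ T, ∑ z ∈ T, (if ¬ G x y then (1:ℝ) else 0) ≤ T.card * b := by
      intro x hx
      rw [Finset.sum_comm, ← nsmul_eq_mul]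
      exact Finset.sum_le_card_nsmul _ _ _ fun _ _ => hb' x hx
    calc _ ≤ T.card • (T.card * b) := Finset.sum_le_card_nsmul _ _ _ this
      _ = _ := by rw [nsmul_eq_mul]; ring
  have h2 : ∑ x ∈ T, ∑ y ∈ T, ∑ z ∈ T, (if ¬ G y z then (1:ℝ) else 0) ≤ T.card ^ 2 * b := by
    have : ∀ x ∈ T, ∑ y ∈ T, ∑ z ∈ T, (if ¬ G y z then (1:ℝ) else 0) ≤ T.card * b := by
      intro x hx
      rw [← nsmul_eq_mul]
      exact Finset.sum_le_card_nsmul _ _ _ fun y hy => hb' y hy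
    calc _ ≤ T.card • (T.card * b) := Finset.sum_le_card_nsmul _ _ _ this
      _ = _ := by rw [nsmul_eq_mul]; ring
  have h3 : ∑ x ∈ T, ∑ y ∈ T, ∑ z ∈ T, (if ¬ G x z then (1:ℝ) else 0) ≤ T.card ^ 2 * b := by
    have : ∀ x ∈ T, ∑ y ∈ T, ∑ z ∈ T, (if ¬ G x z then (1:ℝ) else 0) ≤ T.card * b := by
      intro x hx
      rw [← nsmul_eq_mul]
      exact Finset.sum_le_card_nsmul _ _ _ fun y hy => hb' x hx
    calc _ ≤ T.card • (T.card * b) := Finset.sum_le_card_nsmul _ _ _ this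
      _ = _ := by rw [nsmul_eq_mul]; ring
  have h4 : ∑ x ∈ T, ∑ y ∈ T, ∑ z ∈ T, (1:ℝ) ≤ ∑ x ∈ T, ∑ y ∈ T, ∑ z ∈ T, ((if G x y ∧ G y z ∧ G x z then (1:ℝ) else 0)
      + (if ¬ G x y then (1:ℝ) else 0) + (if ¬ G y z then (1:ℝ) else 0) + (if ¬ G x z then (1:ℝ) else 0)) := by
    refine Finset.sum_le_sum fun x _ => Finset.sum_le_sum fun y _ => Finset.sum_le_sum fun z _ => ?_
    by_cases a : G x y <;> by_cases b : G y z <;> by_cases c : G x z <;> simp [a, b, c]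
  simp only [Finset.sum_add_distrib] at h4
  rw [e]
  linarith

namespace DiscHyp
variable {β : Type*} [DecidableEq β] {f f1 f2 : (Fin 3 → ℝ) → ℝ → ℝ} {U : Set (Fin 3 → ℝ)} {lo hi : ℝ}
    {P : Finset (Fin 3 → ℝ)} {F : Finset β} {ξ y : β → ℝ} {T : (Fin 3 → ℝ) → Finset β}
    {δ s t Λ : ℝ}

lemma disc1_aux (H : DiscHyp f f1 f2 U lo hi P F ξ y T δ s t Λ) (g : ℝ) (hδg : δ ≤ g) (hg1 : g ≤ 1)
    (hgs : g ^ s ≤ 1 / Λ ^ 4) : (1 / δ) ^ (3 * s + t) * g ^ 2 ≤ Λ ^ 6 * (F.card : ℝ) ^ 3 := by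
  classical
  have δ0 := H.δ0
  have Λ1 := H.Λ1
  have Λ0 : 0 < Λ := by linarith
  have g0 : 0 < g := by linarith
  have t0 := H.t0
  set E := (1 / δ) ^ s with hE
  have E0 : 0 < E := by positivity
  let G : β → β → Prop := fun x y => g < |ξ x - ξ y|
  have low : ∀ p ∈ P, (E / Λ) ^ 3 / 2 ≤ ∑ x ∈ T p, ∑ y ∈ T p, ∑ z ∈ T p, if G x y ∧ G y z ∧ G x z then (1:ℝ) else 0 := by
    intro p hp
    have hT : E / Λ ≤ (T p).card := by
      rw [div_le_iff₀ Λ0, mul_comm]; exact H.lowT p hp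
    have := trip_count (T p) G (E / Λ / 6) (fun x hx => by
      have e : ((T p).filter fun y => ¬ G x y) = (T p).filter fun y => |ξ y - ξ x| ≤ g := by
        apply Finset.filter_congr
        intro y _
        simp only [G, not_lt, abs_sub_comm]
      rw [e]
      refine (H.cntT p hp (ξ x) g hδg).trans ?_
      rw [div_eq_mul_one_div g, Real.mul_rpow g0.le (by positivity), ← hE]
      calc Λ * (g ^ s * E) ≤ Λ * (1 / Λ ^ 4 * E) := by gcongr
        _ = E / Λ * (1 / Λ ^ 2) := by field_simp
        _ ≤ E / Λ * (1 / 6) := by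
            gcongr
            nlinarith
        _ = _ := by ring)
    have h1 : (T p).card ^ 2 * (E / Λ) ≤ ((T p).card : ℝ) ^ 3 := by
      rw [pow_succ _ 2]; gcongr
    have h2 : (E / Λ) ^ 3 ≤ ((T p).card : ℝ) ^ 3 := by gcongr
    linarith
  have up : ∀ x ∈ F, ∀ y ∈ F, ∀ z ∈ F, (∑ p ∈ P, if (x ∈ T p ∧ y ∈ T p ∧ z ∈ T p) ∧ G x y ∧ G y z ∧ G x z then (1:ℝ) else 0) ≤ 20 * Λ / g ^ 2 := by
    intro x hx y hy z hz
    rw [← Finset.sum_filter, Finset.sum_const, nsmul_eq_mul, mul_one]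
    rcases (P.filter fun p => (x ∈ T p ∧ y ∈ T p ∧ z ∈ T p) ∧ G x y ∧ G y z ∧ G x z).eq_empty_or_nonempty with h | ⟨p0, h0⟩
    · rw [h]; simp; positivity
    · rw [Finset.mem_filter] at h0
      obtain ⟨hp0, ⟨x0, y0, z0⟩, g1, g2, g3⟩ := h0
      have g21 : g ^ 2 ≤ 1 := by nlinarith
      have hr : δ ≤ 20 * δ / g ^ 2 := by
        rw [le_div_iff₀ (by positivity)]; nlinarith
      calc _ ≤ ((P.filter fun q => dist p0 q ≤ 20 * δ / g ^ 2).card : ℝ) := by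
            refine Nat.cast_le.2 (Finset.card_le_card fun q hq => ?_)
            rw [Finset.mem_filter] at hq ⊢
            refine ⟨hq.1, ?_⟩
            obtain ⟨hq, ⟨x1, y1, z1⟩, _⟩ := hq
            by_cases hpq : p0 = q
            · rw [hpq, dist_self]; positivity
            rw [le_div_iff₀ (by positivity)]
            exact (H.cine.jet (H.PU _ hp0) (H.PU _ hq) hpq).three' (H.ξI x hx) (H.ξI y hy) (H.ξI z hz) g0 hg1 g1.le g2.le g3.le
              (H.hdiff hp0 hq x0 x1) (H.hdiff hp0 hq y0 y1) (H.hdiff hp0 hq z0 z1)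
        _ ≤ Λ * (20 * δ / g ^ 2 / δ) ^ t := H.cntP p0 hp0 _ hr
        _ ≤ Λ * (20 * δ / g ^ 2 / δ) ^ (1:ℝ) := by
            gcongr
            · rw [le_div_iff₀ δ0]; linarith
            · exact H.t1
        _ = _ := by rw [Real.rpow_one]; field_simp
  have key : P.card * ((E / Λ) ^ 3 / 2) ≤ F.card ^ 3 * (20 * Λ / g ^ 2) := by
    calc P.card * ((E / Λ) ^ 3 / 2) ≤ ∑ p ∈ P, ∑ x ∈ T p, ∑ y ∈ T p, ∑ z ∈ T p, (if G x y ∧ G y z ∧ G x z then (1:ℝ) else 0) := by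
          rw [← nsmul_eq_mul]
          exact Finset.card_nsmul_le_sum _ _ _ low
      _ = ∑ p ∈ P, ∑ x ∈ F, ∑ y ∈ F, ∑ z ∈ F, (if (x ∈ T p ∧ y ∈ T p ∧ z ∈ T p) ∧ G x y ∧ G y z ∧ G x z then (1:ℝ) else 0) := by
          refine Finset.sum_congr rfl fun p hp => ?_
          have sub : ∀ φ : β → ℝ, ∑ x ∈ T p, φ x = ∑ x ∈ F, if x ∈ T p then φ x else 0 := by
            intro φ
            rw [← Finset.sum_filter]
            congr 1
            ext x
            rw [Finset.mem_filter]
            exact ⟨fun h => ⟨H.TF p hp h, h⟩, fun h => h.2⟩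
          rw [sub]
          refine Finset.sum_congr rfl fun x _ => ?_
          by_cases hx : x ∈ T p
          · rw [if_pos hx, sub]
            refine Finset.sum_congr rfl fun y _ => ?_
            by_cases hy : y ∈ T p
            · rw [if_pos hy, sub]
              refine Finset.sum_congr rfl fun z _ => ?_
              by_cases hz : z ∈ T p <;> simp [hx, hy, hz]
            · simp [hy]
          · simp [hx]
      _ = ∑ x ∈ F, ∑ y ∈ F, ∑ z ∈ F, ∑ p ∈ P, (if (x ∈ T p ∧ y ∈ T p ∧ z ∈ T p) ∧ G x y ∧ G y z ∧ G x z then (1:ℝ) else 0) := by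
          rw [Finset.sum_comm]
          refine Finset.sum_congr rfl fun x _ => ?_
          rw [Finset.sum_comm]
          refine Finset.sum_congr rfl fun y _ => ?_
          rw [Finset.sum_comm]
      _ ≤ ∑ x ∈ F, ∑ y ∈ F, ∑ z ∈ F, (20 * Λ / g ^ 2) := 
          Finset.sum_le_sum fun x hx => Finset.sum_le_sum fun y hy => Finset.sum_le_sum fun z hz => up x hx y hy z hz
      _ = _ := by simp; ring
  have e3 : (1 / δ) ^ (3 * s + t) = E ^ 3 * (1 / δ) ^ t := by
    rw [Real.rpow_add (by positivity), hE, ← Real.rpow_natCast, ← Real.rpow_mul (by positivity)]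
    congr 2
    push_cast
    ring
  have lowP := H.lowP
  clear_value E
  rw [e3]
  set N : ℝ := (P.card : ℝ)
  set M : ℝ := (F.card : ℝ)
  have M0 : 0 ≤ M := Nat.cast_nonneg _
  clear_value N M
  calc E ^ 3 * (1 / δ) ^ t * g ^ 2 ≤ E ^ 3 * (Λ * N) * g ^ 2 := by gcongr
    _ = 2 * Λ ^ 4 * g ^ 2 * (N * ((E / Λ) ^ 3 / 2)) := by field_simp
    _ ≤ 2 * Λ ^ 4 * g ^ 2 * (M ^ 3 * (20 * Λ / g ^ 2)) := by gcongr
    _ = 40 * Λ ^ 5 * M ^ 3 := by field_simp; ring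
    _ ≤ Λ * Λ ^ 5 * M ^ 3 := by gcongr; linarith
    _ = _ := by ring

lemma disc1 (H : DiscHyp f f1 f2 U lo hi P F ξ y T δ s t Λ) (n : ℕ) (hn : 1 ≤ n * s) :
    (1 / δ) ^ (3 * s + t) ≤ Λ ^ (6 + 16 * n) * (F.card : ℝ) ^ 3 := by
  have δ0 := H.δ0
  have Λ1 := H.Λ1
  have Λ0 : 0 < Λ := by linarith
  have hL1 : 1 ≤ Λ ^ (4 * n) := one_le_pow₀ (by linarith)
  have F1 : (1:ℝ) ≤ F.card := by
    have N0 := H.card_pos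
    rw [Nat.cast_pos, Finset.card_pos] at N0
    obtain ⟨p, hp⟩ := N0
    have h1 := H.lowT p hp
    have : 0 < (1 / δ) ^ s := by positivity
    have : 0 < (T p).card := by
      by_contra h
      have : (T p).card = 0 := by omega
      rw [this, Nat.cast_zero, mul_zero] at h1
      linarith
    have h2 := Finset.card_le_card (H.TF p hp)
    have : 1 ≤ F.card := by omega
    exact_mod_cast this
  have F3 : (1:ℝ) ≤ (F.card:ℝ) ^ 3 := one_le_pow₀ F1
  by_cases c : δ ≤ 1 / Λ ^ (4 * n)
  · have := H.disc1_aux (1 / Λ ^ (4 * n)) c (by rw [div_le_one (by positivity)]; exact hL1) (by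
      rw [Real.div_rpow (by norm_num) (by positivity), Real.one_rpow]
      apply one_div_le_one_div_of_le (by positivity)
      rw [← Real.rpow_natCast, ← Real.rpow_natCast, ← Real.rpow_mul (by positivity)]
      apply Real.rpow_le_rpow_of_exponent_le (by linarith)
      push_cast
      linarith)
    rw [one_div_pow, mul_one_div, div_le_iff₀ (by positivity)] at this
    calc _ ≤ _ := this
      _ = Λ ^ (6 + 8 * n) * (F.card : ℝ) ^ 3 := by ring
      _ ≤ _ := by gcongr <;> first | linarith | omega
  · push Not at c
    have h1 : 1 / δ ≤ Λ ^ (4 * n) := by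
      rw [div_lt_iff₀ (by positivity)] at c
      rw [div_le_iff₀ δ0]; linarith
    calc (1 / δ) ^ (3 * s + t) ≤ (1 / δ) ^ (4:ℝ) := by
          apply Real.rpow_le_rpow_of_exponent_le
          · rw [le_div_iff₀ δ0]; linarith [H.δ1]
          · linarith [H.s1, H.t1]
      _ = (1 / δ) ^ 4 := by rw [← Real.rpow_natCast]; norm_num
      _ ≤ (Λ ^ (4 * n)) ^ 4 := by gcongr
      _ = Λ ^ (16 * n) * 1 := by ring
      _ ≤ Λ ^ (6 + 16 * n) * (F.card : ℝ) ^ 3 := by gcongr <;> first | linarith | omega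

end DiscHyp

/-- Hausdorff content -/
noncomputable def cont {X : Type*} [EMetricSpace X] (s : ℝ) : OuterMeasure X :=
  OuterMeasure.boundedBy fun S => ediam S ^ s

lemma cont_zero {X : Type*} [EMetricSpace X] [MeasurableSpace X] [BorelSpace X] {s : ℝ} (hs : 0 < s) {A : Set X}
    (h : cont s A = 0) : μH[s] A = 0 := by
  rw [Measure.hausdorffMeasure_apply]
  simp only [ENNReal.iSup_eq_zero]
  intro r hr
  by_contra hne
  have hpos := pos_iff_ne_zero.2 hne
  set I := ⨅ t : ℕ → Set X, ⨅ (_ : A ⊆ ⋃ n, t n), ⨅ (_ : ∀ n : ℕ, ediam (t n) ≤ r), ∑' n : ℕ, ⨆ (_ : (t n).Nonempty), ediam (t n) ^ s with hI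
  have hlt : cont s A < min I (r ^ s) := by
    rw [h]
    exact lt_min hpos (ENNReal.rpow_pos_of_nonneg hr hs.le)
  rw [cont, OuterMeasure.boundedBy_apply] at hlt
  simp only [iInf_lt_iff] at hlt
  obtain ⟨t, ht, hlt⟩ := hlt
  have hd : ∀ n, ediam (t n) ≤ r := by
    intro n
    rcases (t n).eq_empty_or_nonempty with h0 | h0
    · rw [h0]; simp
    · have h1 : (⨆ (_ : (t n).Nonempty), ediam (t n) ^ s) ≤ ∑' n : ℕ, ⨆ (_ : (t n).Nonempty), ediam (t n) ^ s :=
        ENNReal.le_tsum n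
      rw [iSup_pos h0] at h1
      exact (ENNReal.rpow_le_rpow_iff hs).1 (h1.trans (hlt.le.trans (min_le_right _ _)))
  have : I ≤ ∑' n : ℕ, ⨆ (_ : (t n).Nonempty), ediam (t n) ^ s := by
    rw [hI]
    exact iInf_le_of_le t (iInf_le_of_le ht (iInf_le_of_le hd le_rfl))
  exact absurd (hlt.trans_le (min_le_left _ _)) (not_lt.2 this)

lemma cont_pos {X : Type*} [EMetricSpace X] {s : ℝ} (hs : 0 < s) {A : Set X}
    (h : ENNReal.ofReal s < dimH A) : 0 < cont s A := by
  borelize X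
  rw [pos_iff_ne_zero]
  intro h0
  have h1 := cont_zero hs h0
  have h2 : μH[((Real.toNNReal s : NNReal) : ℝ)] A = ⊤ := hausdorffMeasure_of_lt_dimH h
  rw [Real.coe_toNNReal s hs.le, h1] at h2
  simp at h2

lemma cont_pig : ∃ c0 : ℝ, 0 < c0 ∧ c0 ≤ 1 ∧ ∀ {X : Type} [EMetricSpace X] (s κ : ℝ) (A : Set X) (B : ℕ → Set X), 0 < κ →
    ENNReal.ofReal κ ≤ cont s A → A ⊆ ⋃ k, B k → ∃ k : ℕ, ENNReal.ofReal (κ * (c0 / ((k:ℝ) + 1) ^ 2)) ≤ cont s (A ∩ B k) := by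
  have hsum : Summable fun k : ℕ => 1 / ((k:ℝ) + 1) ^ 2 := by
    have := (summable_nat_add_iff 1).2 (Real.summable_one_div_nat_pow.2 (one_lt_two))
    simpa using this
  set S := ∑' k : ℕ, 1 / ((k:ℝ) + 1) ^ 2 with hS
  have S0 : 0 ≤ S := tsum_nonneg fun k => by positivity
  refine ⟨1 / (S + 1), by positivity, by rw [div_le_one (by positivity)]; linarith, ?_⟩
  intro X _ s κ A B hκ hA hAB
  by_contra! hcon
  have h1 : cont s A ≤ ∑' k, cont s (A ∩ B k) := by
    calc cont s A ≤ cont s (⋃ k, A ∩ B k) := measure_mono (by rw [← inter_iUnion]; exact subset_inter le_rfl hAB)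
      _ ≤ _ := measure_iUnion_le _
  have h2 : ∑' k, cont s (A ∩ B k) ≤ ∑' k : ℕ, ENNReal.ofReal (κ * (1 / (S + 1) / ((k:ℝ) + 1) ^ 2)) :=
    ENNReal.tsum_le_tsum fun k => (hcon k).le
  have e : ∀ k : ℕ, κ * (1 / (S + 1) / ((k:ℝ) + 1) ^ 2) = (κ / (S + 1)) * (1 / ((k:ℝ) + 1) ^ 2) := by
    intro k; field_simp
  simp only [e] at h2
  rw [← ENNReal.ofReal_tsum_of_nonneg (fun k => by positivity) (hsum.mul_left _), tsum_mul_left, ← hS] at h2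
  have h3 := (hA.trans h1).trans h2
  rw [ENNReal.ofReal_le_ofReal_iff (by positivity), div_mul_eq_mul_div, le_div_iff₀ (by positivity)] at h3
  nlinarith

/-- dyadic cell index -/
noncomputable def dcell {d : ℕ} (j : ℕ) (x : Fin d → ℝ) : Fin d → ℤ := fun i => ⌊2 ^ j * x i⌋

lemma dcell_mono {d : ℕ} {i j : ℕ} (hij : i ≤ j) {x y : Fin d → ℝ} (h : dcell j x = dcell j y) : dcell i x = dcell i y := by
  have key : ∀ z : ℝ, ⌊2 ^ i * z⌋ = ⌊2 ^ j * z⌋ / ((2 ^ (j - i) : ℕ) : ℤ) := by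
    intro z
    rw [← Int.floor_div_natCast]
    congr 1
    have : (2:ℝ) ^ j = 2 ^ i * 2 ^ (j - i) := by rw [← pow_add]; congr 1; omega
    rw [this]
    push_cast
    field_simp
  funext a
  have := congrFun h a
  simp only [dcell] at this ⊢
  rw [key, key, this]

lemma dcell_dist {d : ℕ} {j : ℕ} {x y : Fin d → ℝ} (h : dcell j x = dcell j y) : dist x y ≤ (1 / 2) ^ j := by
  rw [dist_pi_le_iff (by positivity)]
  intro a
  have := congrFun h a
  simp only [dcell] at this
  have h1 := Int.abs_sub_lt_one_of_floor_eq_floor this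
  rw [← mul_sub, abs_mul, abs_of_pos (by positivity)] at h1
  rw [Real.dist_eq, one_div_pow, le_div_iff₀ (by positivity)]
  linarith

lemma dcell_ediam {d : ℕ} {j : ℕ} (v : Fin d → ℤ) : ediam {z : Fin d → ℝ | dcell j z = v} ≤ ENNReal.ofReal ((1 / 2) ^ j) := by
  refine ediam_le fun x hx y hy => ?_
  rw [edist_dist]
  exact ENNReal.ofReal_le_ofReal (dcell_dist (hx.trans hy.symm))

/-- admissible sets -/
def Adm {d : ℕ} (A : Set (Fin d → ℝ)) (k : ℕ) (s : ℝ) (T : Finset (Fin d → ℝ)) : Prop :=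
  (T : Set (Fin d → ℝ)) ⊆ A ∧ ∀ j ≤ k, ∀ v, (T.filter fun x => dcell j x = v).card ≤ ⌈(2:ℝ) ^ (((k:ℝ) - j) * s)⌉₊

lemma adm_exists {d : ℕ} (A : Set (Fin d → ℝ)) (k : ℕ) (s κ : ℝ) (hs : 0 < s) (hA : ENNReal.ofReal κ ≤ cont s A) :
    ∃ T, Adm A k s T ∧ κ * 2 ^ (k * s) ≤ T.card := by
  classical
  by_contra! hcon
  set N : ℕ → ℕ := fun j => ⌈(2:ℝ) ^ (((k:ℝ) - j) * s)⌉₊ with hN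
  have N1 : ∀ j, 1 ≤ N j := fun j => Nat.one_le_iff_ne_zero.2 (Nat.ceil_pos.2 (by positivity)).ne'
  have Nk : N k = 1 := by simp [hN]
  obtain ⟨T, hT, hmax⟩ : ∃ T, Adm A k s T ∧ ∀ T', Adm A k s T' → T'.card ≤ T.card := by
    let S : Set ℕ := {n | ∃ T, Adm A k s T ∧ T.card = n}
    have hS : S.Nonempty := ⟨0, ∅, ⟨by simp, by simp⟩, rfl⟩
    have hb : BddAbove S := by
      refine ⟨⌈κ * 2 ^ (k * s)⌉₊, ?_⟩
      rintro n ⟨T, hT, rfl⟩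
      exact_mod_cast (hcon T hT).le.trans (Nat.le_ceil _)
    obtain ⟨T, hT, h⟩ := Nat.sSup_mem hS hb
    exact ⟨T, hT, fun T' hT' => h ▸ le_csSup hb ⟨T', hT', rfl⟩⟩
  let sat : (Fin d → ℝ) → ℕ → Prop := fun a j => j ≤ k ∧ N j ≤ (T.filter fun x => dcell j x = dcell j a).card
  have hsat : ∀ a ∈ A, ∃ j, sat a j := by
    intro a ha
    by_cases haT : a ∈ T
    · refine ⟨k, le_rfl, ?_⟩
      rw [Nk, Nat.one_le_iff_ne_zero, Finset.card_ne_zero]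
      exact ⟨a, Finset.mem_filter.2 ⟨haT, rfl⟩⟩
    · by_contra! hno
      have : Adm A k s (insert a T) := by
        refine ⟨?_, fun j hj v => ?_⟩
        · rw [Finset.coe_insert]
          exact insert_subset ha hT.1
        · rw [Finset.filter_insert]
          split_ifs with hv
          · have h1 := hno j
            simp only [sat, not_and, not_le] at h1
            have h2 := h1 hj
            rw [hv] at h2
            exact (Finset.card_insert_le _ _).trans h2
          · exact hT.2 j hj v
      have h2 := hmax _ this
      rw [Finset.card_insert_of_notMem haT] at h2
      omega
  let J : (Fin d → ℝ) → ℕ := fun a => if h : ∃ j, sat a j then Nat.find h else 0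
  have J1 : ∀ a ∈ A, sat a (J a) := by
    intro a ha
    have h := hsat a ha
    simp only [J, dif_pos h]
    exact Nat.find_spec h
  have J2 : ∀ a j, sat a j → J a ≤ j := by
    intro a j haj
    have h : ∃ j, sat a j := ⟨j, haj⟩
    simp only [J, dif_pos h]
    exact Nat.find_min' h haj
  have satc : ∀ a b i, dcell i a = dcell i b → sat a i → sat b i := by
    intro a b i h h1
    simp only [sat] at h1 ⊢
    rwa [← h]
  let φ : (Fin d → ℝ) → ℕ × (Fin d → ℤ) := fun x => (J x, dcell (J x) x)
  have cover : A ⊆ ⋃ c ∈ T.image φ, {z | dcell c.1 z = c.2} := by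
    intro a ha
    have h1 := J1 a ha
    obtain ⟨x, hx⟩ : (T.filter fun x => dcell (J a) x = dcell (J a) a).Nonempty := by
      rw [← Finset.card_pos]
      have := N1 (J a)
      have := h1.2
      omega
    rw [Finset.mem_filter] at hx
    have h2 : J x ≤ J a := J2 x _ (satc a x _ hx.2.symm h1)
    simp only [mem_iUnion]
    refine ⟨φ x, Finset.mem_image_of_mem _ hx.1, ?_⟩
    exact dcell_mono h2 hx.2.symm
  have fib : ∀ c ∈ T.image φ, ENNReal.ofReal ((2:ℝ) ^ (-(c.1:ℝ) * s)) ≤ ENNReal.ofReal ((2:ℝ) ^ (-(k:ℝ) * s) * (T.filter fun x => φ x = c).card) := by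
    intro c hc
    apply ENNReal.ofReal_le_ofReal
    obtain ⟨x0, hx0, rfl⟩ := Finset.mem_image.1 hc
    have hxA := hT.1 hx0
    have h1 := J1 x0 hxA
    have h2 : (T.filter fun x => dcell (J x0) x = dcell (J x0) x0) ⊆ T.filter fun x => φ x = φ x0 := by
      intro x hx
      rw [Finset.mem_filter] at hx ⊢
      refine ⟨hx.1, ?_⟩
      have a1 : J x ≤ J x0 := J2 x _ (satc x0 x _ hx.2.symm h1)
      have a2 : J x0 ≤ J x := J2 x0 _ (satc x x0 _ (dcell_mono a1 hx.2) (J1 x (hT.1 hx.1)))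
      have a3 : J x = J x0 := le_antisymm a1 a2
      simp only [φ, a3, hx.2]
    have h3 : (2:ℝ) ^ (((k:ℝ) - J x0) * s) ≤ (T.filter fun x => φ x = φ x0).card := by
      calc _ ≤ (N (J x0) : ℝ) := Nat.le_ceil _
        _ ≤ _ := by exact_mod_cast h1.2.trans (Finset.card_le_card h2)
    calc (2:ℝ) ^ (-((φ x0).1:ℝ) * s) = (2:ℝ) ^ (-(k:ℝ) * s) * (2:ℝ) ^ (((k:ℝ) - J x0) * s) := by
          rw [← Real.rpow_add (by norm_num)]; congr 1; simp only [φ]; ring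
      _ ≤ _ := by gcongr
  have h5 : cont s A ≤ ENNReal.ofReal ((2:ℝ) ^ (-(k:ℝ) * s) * T.card) := by
    calc cont s A ≤ cont s (⋃ c ∈ T.image φ, {z | dcell c.1 z = c.2}) := measure_mono cover
      _ ≤ ∑ c ∈ T.image φ, cont s {z : Fin d → ℝ | dcell c.1 z = c.2} := measure_biUnion_finset_le _ _
      _ ≤ ∑ c ∈ T.image φ, ENNReal.ofReal ((2:ℝ) ^ (-(c.1:ℝ) * s)) := by
          refine Finset.sum_le_sum fun c _ => ?_
          refine (OuterMeasure.boundedBy_le _).trans ?_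
          calc _ ≤ ENNReal.ofReal ((1 / 2) ^ c.1) ^ s := ENNReal.rpow_le_rpow (dcell_ediam _) hs.le
            _ = _ := by
              rw [ENNReal.ofReal_rpow_of_pos (by positivity)]
              congr 1
              rw [Real.rpow_mul (by norm_num), Real.rpow_neg (by norm_num), Real.rpow_natCast]
              simp
      _ ≤ ∑ c ∈ T.image φ, ENNReal.ofReal ((2:ℝ) ^ (-(k:ℝ) * s) * (T.filter fun x => φ x = c).card) := Finset.sum_le_sum fib
      _ = _ := by
          rw [← ENNReal.ofReal_sum_of_nonneg (fun c _ => by positivity), ← Finset.mul_sum]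
          congr 2
          rw [Finset.card_eq_sum_card_image φ T]
          push_cast
          rfl
  have h6 := hA.trans h5
  rw [ENNReal.ofReal_le_ofReal_iff (by positivity)] at h6
  have h7 := hcon T hT
  have h8 : (2:ℝ) ^ (-(k:ℝ) * s) * 2 ^ (k * s) = 1 := by
    rw [← Real.rpow_add (by norm_num)]; simp
  have h9 : (0:ℝ) < 2 ^ ((k:ℝ) * s) := by positivity
  have : κ * 2 ^ ((k:ℝ) * s) ≤ (2:ℝ) ^ (-(k:ℝ) * s) * T.card * 2 ^ (k * s) := by gcongr
  have : (2:ℝ) ^ (-(k:ℝ) * s) * T.card * 2 ^ (k * s) = T.card := by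
    rw [mul_right_comm, h8, one_mul]
  linarith

lemma dcell_near {d j : ℕ} {x c : Fin d → ℝ} (h : dist x c ≤ (1 / 2) ^ j) :
    dcell j x ∈ Fintype.piFinset fun i => Finset.Icc (dcell j c i - 1) (dcell j c i + 1) := by
  rw [Fintype.mem_piFinset]
  intro i
  have h1 : |x i - c i| ≤ (1 / 2) ^ j := (dist_le_pi_dist x c i).trans h
  have h2 : |2 ^ j * x i - 2 ^ j * c i| ≤ 1 := by
    rw [← mul_sub, abs_mul, abs_of_pos (by positivity)]
    rw [one_div_pow, le_div_iff₀ (by positivity)] at h1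
    linarith
  rw [abs_le] at h2
  rw [Finset.mem_Icc]
  simp only [dcell]
  constructor
  · rw [← Int.floor_sub_one]
    exact Int.floor_le_floor (by linarith)
  · rw [← Int.floor_add_one]
    exact Int.floor_le_floor (by linarith)

lemma card_near {d : ℕ} (v : Fin d → ℤ) : (Fintype.piFinset fun i => Finset.Icc (v i - 1) (v i + 1)).card = 3 ^ d := by
  rw [Fintype.card_piFinset]
  have : ∀ i, (Finset.Icc (v i - 1) (v i + 1)).card = 3 := by
    intro i; rw [Int.card_Icc]; omega
  simp [this]

lemma adm_ball0 {d : ℕ} {A : Set (Fin d → ℝ)} {k : ℕ} {s : ℝ} {T : Finset (Fin d → ℝ)} (hs : 0 ≤ s) (hT : Adm A k s T)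
    (c : Fin d → ℝ) (j : ℕ) (hj : j ≤ k) :
    ((T.filter fun x => dist x c ≤ (1 / 2) ^ j).card : ℝ) ≤ 2 * 3 ^ d * ((1 / 2) ^ j * 2 ^ k) ^ s := by
  classical
  have h1 := Finset.card_le_mul_card_image_of_maps_to (s := T.filter fun x => dist x c ≤ (1 / 2) ^ j) (f := dcell j)
    (t := Fintype.piFinset fun i => Finset.Icc (dcell j c i - 1) (dcell j c i + 1))
    (fun x hx => dcell_near (Finset.mem_filter.1 hx).2) ⌈(2:ℝ) ^ (((k:ℝ) - j) * s)⌉₊ (fun v _ =>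
      (Finset.card_le_card (Finset.filter_subset_filter _ (Finset.filter_subset _ _))).trans (hT.2 j hj v))
  rw [card_near] at h1
  have h2 : (2:ℝ) ^ (((k:ℝ) - j) * s) = ((1 / 2) ^ j * 2 ^ k) ^ s := by
    rw [Real.rpow_mul (by norm_num)]
    congr 1
    rw [Real.rpow_sub (by norm_num), Real.rpow_natCast, Real.rpow_natCast, one_div_pow]
    field_simp
  have h3 : (1:ℝ) ≤ (2:ℝ) ^ (((k:ℝ) - j) * s) := by
    apply Real.one_le_rpow (by norm_num)
    apply mul_nonneg _ hs
    rw [sub_nonneg]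
    exact_mod_cast hj
  have h4 : (⌈(2:ℝ) ^ (((k:ℝ) - j) * s)⌉₊ : ℝ) ≤ 2 * (2:ℝ) ^ (((k:ℝ) - j) * s) := by
    have := Nat.ceil_lt_add_one (a := (2:ℝ) ^ (((k:ℝ) - j) * s)) (by positivity)
    linarith
  calc ((T.filter fun x => dist x c ≤ (1 / 2) ^ j).card : ℝ) ≤ (⌈(2:ℝ) ^ (((k:ℝ) - j) * s)⌉₊ : ℝ) * 3 ^ d := by exact_mod_cast h1
    _ ≤ 2 * (2:ℝ) ^ (((k:ℝ) - j) * s) * 3 ^ d := by gcongr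
    _ = _ := by rw [h2]; ring

lemma adm_ball {d : ℕ} {A : Set (Fin d → ℝ)} {k : ℕ} {s : ℝ} {T : Finset (Fin d → ℝ)} (hs : 0 ≤ s) (hs1 : s ≤ 1) (hT : Adm A k s T)
    (hA : ∀ x ∈ A, ∀ y ∈ A, dist x y ≤ 1) (c : Fin d → ℝ) (r : ℝ) (hr : (1 / 2) ^ k ≤ r) :
    ((T.filter fun x => dist x c ≤ r).card : ℝ) ≤ 4 * 3 ^ d * (r * 2 ^ k) ^ s := by
  classical
  have h20 : (0:ℝ) < (1 / 2) ^ k := by positivity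
  have r0 : 0 < r := by linarith
  by_cases h1 : r ≤ 1
  · obtain ⟨i, hik, i1, i2⟩ := dyadic_exists k r hr h1
    calc ((T.filter fun x => dist x c ≤ r).card : ℝ) ≤ (T.filter fun x => dist x c ≤ (1 / 2) ^ i).card := by
          refine Nat.cast_le.2 (Finset.card_le_card fun x hx => ?_)
          rw [Finset.mem_filter] at hx ⊢
          exact ⟨hx.1, hx.2.trans i2⟩
      _ ≤ 2 * 3 ^ d * ((1 / 2) ^ i * 2 ^ k) ^ s := adm_ball0 hs hT c i hik
      _ ≤ 2 * 3 ^ d * (2 * (r * 2 ^ k)) ^ s := by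
          have h3 : (1 / 2 : ℝ) ^ i ≤ 2 * r := by linarith
          have h4 : (1 / 2 : ℝ) ^ i * 2 ^ k ≤ 2 * (r * 2 ^ k) := by
            rw [← mul_assoc]
            exact mul_le_mul_of_nonneg_right h3 (by positivity)
          exact mul_le_mul_of_nonneg_left (Real.rpow_le_rpow (by positivity) h4 hs) (by positivity)
      _ ≤ 2 * 3 ^ d * (2 * (r * 2 ^ k) ^ s) := by
          gcongr
          exact DiscHyp.rpow_le_self_mul (by norm_num) (by positivity) hs hs1
      _ = _ := by ring
  · push Not at h1
    rcases (T.filter fun x => dist x c ≤ r).eq_empty_or_nonempty with h | ⟨x0, h0⟩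
    · rw [h]; simp; positivity
    · have hx0 := (Finset.mem_filter.1 h0).1
      calc ((T.filter fun x => dist x c ≤ r).card : ℝ) ≤ (T.filter fun x => dist x x0 ≤ (1 / 2) ^ 0).card := by
            refine Nat.cast_le.2 (Finset.card_le_card fun x hx => ?_)
            rw [Finset.mem_filter] at hx ⊢
            refine ⟨hx.1, ?_⟩
            rw [pow_zero]
            exact hA _ (hT.1 hx.1) _ (hT.1 hx0)
        _ ≤ 2 * 3 ^ d * ((1 / 2) ^ 0 * 2 ^ k) ^ s := adm_ball0 hs hT x0 0 (by omega)
        _ ≤ 4 * 3 ^ d * (r * 2 ^ k) ^ s := by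
            rw [pow_zero]
            gcongr
            norm_num

lemma adm_inj {d : ℕ} {A : Set (Fin d → ℝ)} {k : ℕ} {s : ℝ} {T : Finset (Fin d → ℝ)} (hT : Adm A k s T) :
    Set.InjOn (dcell k) (T : Set (Fin d → ℝ)) := by
  classical
  intro x hx y hy h
  have h1 := hT.2 k le_rfl (dcell k x)
  rw [sub_self, zero_mul, Real.rpow_zero, Nat.ceil_one, Finset.card_le_one] at h1
  exact h1 x (Finset.mem_filter.2 ⟨hx, rfl⟩) y (Finset.mem_filter.2 ⟨hy, h.symm⟩)

/-- covers of sets of small dimension, organized by dyadic scale -/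
lemma cover_levels {d : ℕ} (F : Set (Fin d → ℝ)) (σ : ℝ) (hσ : 0 < σ) (hF : dimH F < ENNReal.ofReal σ) (k0 : ℕ) :
    ∃ (E : ℕ → Set (Fin d → ℝ)) (Q : ℕ → Finset (Fin d → ℤ)), F ⊆ ⋃ k, E k ∧ (∀ k, k < k0 → E k = ∅) ∧
      (∀ k, ∀ z ∈ E k, dcell k z ∈ Q k) ∧ ∀ k, ((Q k).card : ℝ) ≤ 3 ^ d * 2 ^ (k * σ) := by
  classical
  have h0 : μH[σ] F = 0 := by
    have : μH[((Real.toNNReal σ : NNReal) : ℝ)] F = 0 := hausdorffMeasure_of_dimH_lt hF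
    rwa [Real.coe_toNNReal σ hσ.le] at this
  rw [Measure.hausdorffMeasure_apply] at h0
  simp only [ENNReal.iSup_eq_zero] at h0
  have h1 := h0 (ENNReal.ofReal ((1 / 2) ^ k0)) (ENNReal.ofReal_pos.2 (by positivity))
  have h2 : (⨅ t : ℕ → Set (Fin d → ℝ), ⨅ (_ : F ⊆ ⋃ n, t n), ⨅ (_ : ∀ n : ℕ, ediam (t n) ≤ ENNReal.ofReal ((1 / 2) ^ k0)),
      ∑' n : ℕ, ⨆ (_ : (t n).Nonempty), ediam (t n) ^ σ) < ENNReal.ofReal ((1/2) ^ σ / 2) := by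
    rw [h1]; exact ENNReal.ofReal_pos.2 (by positivity)
  simp only [iInf_lt_iff] at h2
  obtain ⟨t, ht, htd, hsum⟩ := h2
  have lev : ∀ n, ∃ i, k0 ≤ i ∧ ediam (t n) ≤ ENNReal.ofReal ((1 / 2) ^ i) ∧
      ENNReal.ofReal (((1 / 2) ^ i) ^ σ) ≤ ENNReal.ofReal (2 ^ σ) * ediam (t n) ^ σ + ENNReal.ofReal ((1 / 2) ^ n / 4) := by
    intro n
    have hfin : ediam (t n) ≠ ⊤ := ((htd n).trans_lt ENNReal.ofReal_lt_top).ne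
    obtain ⟨D, hD0, hD⟩ : ∃ D : ℝ, 0 ≤ D ∧ ediam (t n) = ENNReal.ofReal D :=
      ⟨(ediam (t n)).toReal, ENNReal.toReal_nonneg, (ENNReal.ofReal_toReal hfin).symm⟩
    have hDk : D ≤ (1 / 2) ^ k0 := by
      have := htd n
      rwa [hD, ENNReal.ofReal_le_ofReal_iff (by positivity)] at this
    rw [hD]
    rcases hD0.eq_or_lt with hz | hpos
    · obtain ⟨i, hi⟩ := exists_pow_lt_of_lt_one (show (0:ℝ) < (1 / 2) ^ n / 4 by positivity) (show ((1/2:ℝ) ^ σ) < 1 from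
        Real.rpow_lt_one (by norm_num) (by norm_num) hσ)
      refine ⟨max i k0, le_max_right _ _, ?_, ?_⟩
      · rw [← hz]; simp
      · refine le_trans ?_ le_add_self
        apply ENNReal.ofReal_le_ofReal
        refine le_trans ?_ hi.le
        rw [← Real.rpow_natCast, ← Real.rpow_natCast, ← Real.rpow_mul (by norm_num), ← Real.rpow_mul (by norm_num)]
        apply Real.rpow_le_rpow_of_exponent_ge (by norm_num) (by norm_num)
        rw [mul_comm σ]
        gcongr
        exact le_max_left _ _
    · obtain ⟨k, hk⟩ := exists_pow_lt_of_lt_one hpos (show (1/2:ℝ) < 1 by norm_num)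
      obtain ⟨i, -, i1, i2⟩ := dyadic_exists k D hk.le (hDk.trans (pow_le_one₀ (by norm_num) (by norm_num)))
      refine ⟨i, ?_, ENNReal.ofReal_le_ofReal i2, ?_⟩
      · by_contra hlt
        have : i + 1 ≤ k0 := by omega
        have h3 : (1 / 2 : ℝ) ^ k0 ≤ (1 / 2) ^ (i + 1) := pow_le_pow_of_le_one (by norm_num) (by norm_num) this
        rw [pow_succ] at h3
        linarith
      · refine le_trans ?_ le_self_add
        rw [ENNReal.ofReal_rpow_of_pos hpos, ← ENNReal.ofReal_mul (by positivity), ← Real.mul_rpow (by norm_num) hpos.le]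
        apply ENNReal.ofReal_le_ofReal
        exact Real.rpow_le_rpow (by positivity) (by linarith) hσ.le
  choose j hj1 hj2 hj3 using lev
  have hw : ∀ n, ediam (t n) ^ σ ≤ ⨆ (_ : (t n).Nonempty), ediam (t n) ^ σ := by
    intro n
    rcases (t n).eq_empty_or_nonempty with h | h
    · rw [h]; simp [hσ]
    · rw [iSup_pos h]
  have hgeo : ∑' n : ℕ, ENNReal.ofReal ((1 / 2) ^ n / 4) ≤ ENNReal.ofReal (1 / 2) := by
    rw [← ENNReal.ofReal_tsum_of_nonneg (fun n => by positivity) (by exact summable_geometric_two.div_const 4)]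
    rw [tsum_div_const, tsum_geometric_two]
    apply ENNReal.ofReal_le_ofReal
    norm_num
  have htot : ∑' n, ENNReal.ofReal (((1 / 2) ^ j n) ^ σ) ≤ 1 := by
    calc _ ≤ ∑' n, (ENNReal.ofReal (2 ^ σ) * (⨆ (_ : (t n).Nonempty), ediam (t n) ^ σ) + ENNReal.ofReal ((1 / 2) ^ n / 4)) :=
          ENNReal.tsum_le_tsum fun n => (hj3 n).trans (by gcongr; exact hw n)
      _ = ENNReal.ofReal (2 ^ σ) * (∑' n, ⨆ (_ : (t n).Nonempty), ediam (t n) ^ σ) + ∑' n : ℕ, ENNReal.ofReal ((1 / 2) ^ n / 4) := by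
          rw [ENNReal.tsum_add, ENNReal.tsum_mul_left]
      _ ≤ ENNReal.ofReal (2 ^ σ) * ENNReal.ofReal ((1/2) ^ σ / 2) + ENNReal.ofReal (1 / 2) := by
          gcongr
      _ = 1 := by
          rw [← ENNReal.ofReal_mul (by positivity), ← ENNReal.ofReal_add (by positivity) (by norm_num), ← ENNReal.ofReal_one]
          congr 1
          rw [← mul_div_assoc, ← Real.mul_rpow (by norm_num) (by norm_num)]
          norm_num
  have hcard : ∀ k, ∀ S : Finset ℕ, (∀ n ∈ S, j n = k) → (S.card : ℝ) ≤ 2 ^ (k * σ) := by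
    intro k S hS
    have h3 : ∑ n ∈ S, ENNReal.ofReal (((1 / 2) ^ j n) ^ σ) ≤ 1 := (ENNReal.sum_le_tsum S).trans htot
    rw [← ENNReal.ofReal_sum_of_nonneg (fun n _ => by positivity), ENNReal.ofReal_le_one] at h3
    rw [Finset.sum_congr rfl (fun n hn => by rw [hS n hn]), Finset.sum_const, nsmul_eq_mul] at h3
    have h4 : (((1 / 2 : ℝ) ^ k) ^ σ) = 1 / 2 ^ ((k:ℝ) * σ) := by
      rw [Real.rpow_mul (by norm_num), Real.rpow_natCast, one_div_pow, Real.div_rpow (by norm_num) (by positivity), Real.one_rpow]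
    rw [h4, mul_one_div, div_le_one (by positivity)] at h3
    exact h3
  have hfinS : ∀ k, {n | j n = k}.Finite := by
    intro k
    by_contra h
    obtain ⟨S, hS, hc⟩ := Set.Infinite.exists_subset_card_eq h (⌈(2:ℝ) ^ (k * σ)⌉₊ + 1)
    have h5 := hcard k S fun n hn => hS hn
    rw [hc] at h5
    push_cast at h5
    linarith [Nat.le_ceil ((2:ℝ) ^ (k * σ))]
  let p : ℕ → (Fin d → ℝ) := fun n => if h : (t n).Nonempty then h.some else 0
  refine ⟨fun k => ⋃ n ∈ {n | j n = k}, t n, fun k => (hfinS k).toFinset.biUnion fun n =>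
    Fintype.piFinset fun i => Finset.Icc (dcell k (p n) i - 1) (dcell k (p n) i + 1), ?_, ?_, ?_, ?_⟩
  · intro z hz
    obtain ⟨n, hn⟩ := mem_iUnion.1 (ht hz)
    simp only [mem_iUnion]
    exact ⟨j n, n, rfl, hn⟩
  · intro k hk
    ext z
    simp only [mem_iUnion, mem_setOf_eq, mem_empty_iff_false, iff_false]
    rintro ⟨n, hn, _⟩
    have := hj1 n
    omega
  · intro k z hz
    simp only [mem_iUnion] at hz
    obtain ⟨n, hn, hz⟩ := hz
    rw [Finset.mem_biUnion]
    refine ⟨n, by simpa using hn, dcell_near ?_⟩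
    have hne : (t n).Nonempty := ⟨z, hz⟩
    have hp : p n ∈ t n := by
      simp only [p, dif_pos hne]
      exact hne.some_mem
    have h3 := (edist_le_ediam_of_mem hz hp).trans (hj2 n)
    rw [edist_dist, ENNReal.ofReal_le_ofReal_iff (by positivity)] at h3
    have hn' : j n = k := hn
    rwa [hn'] at h3
  · intro k
    have h3 : ((hfinS k).toFinset.biUnion fun n =>
      Fintype.piFinset fun i => Finset.Icc (dcell k (p n) i - 1) (dcell k (p n) i + 1)).card ≤ (hfinS k).toFinset.card * 3 ^ d :=
      Finset.card_biUnion_le_card_mul _ _ _ fun n _ => (card_near _).le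
    have h4 := hcard k (hfinS k).toFinset (fun n hn => by simpa using hn)
    calc _ ≤ ((hfinS k).toFinset.card : ℝ) * 3 ^ d := by exact_mod_cast h3
      _ ≤ 2 ^ (k * σ) * 3 ^ d := by gcongr
      _ = _ := by ring

lemma Cine.lip {f f1 f2 : (Fin 3 → ℝ) → ℝ → ℝ} {U : Set (Fin 3 → ℝ)} {lo hi : ℝ} (C : Cine f f1 f2 U lo hi)
    {p : Fin 3 → ℝ} (hp : p ∈ U) {x y : ℝ} (hx : x ∈ Icc lo hi) (hy : y ∈ Icc lo hi) : |f p x - f p y| ≤ |x - y| := by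
  have := Convex.norm_image_sub_le_of_norm_hasDerivWithin_le (f := f p) (f' := f1 p) (s := Icc lo hi) (C := 1)
    (fun x hx => (C.hd1 p hp x hx).hasDerivWithinAt) (fun x hx => C.hf1 p hp x hx) (convex_Icc lo hi) hy hx
  simpa using this

lemma mk_disc {f f1 f2 : (Fin 3 → ℝ) → ℝ → ℝ} {U : Set (Fin 3 → ℝ)} {lo hi : ℝ} (C : Cine f f1 f2 U lo hi)
    {K : Set (Fin 3 → ℝ)} (hKU : K ⊆ U) (hK : ∀ p ∈ K, ∀ q ∈ K, dist p q ≤ 1) (A : (Fin 3 → ℝ) → Set (Fin 2 → ℝ))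
    (hA : ∀ p ∈ K, ∀ z ∈ A p, z 0 ∈ Icc lo hi ∧ z 1 = f p (z 0)) {s t κ Λ : ℝ} (s0 : 0 < s) (s1 : s ≤ 1) (t0 : 0 < t) (t1 : t ≤ 1)
    (hκ : 0 < κ) (k : ℕ) (Q : Finset (Fin 2 → ℤ)) (hQ : ∀ p ∈ K, ∀ z ∈ A p, dcell k z ∈ Q)
    (hAc : ∀ p ∈ K, ENNReal.ofReal κ ≤ cont s (A p)) (hKc : ENNReal.ofReal κ ≤ cont t K) (hΛ : 10000 ≤ Λ) (hΛκ : 1 ≤ Λ * κ) :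
    ∃ P ξ y T, DiscHyp f f1 f2 U lo hi P Q ξ y T ((1 / 2) ^ k) s t Λ := by
  classical
  obtain ⟨P, hP, hPc⟩ := adm_exists K k t κ t0 hKc
  have hT : ∀ p ∈ K, ∃ T, Adm (A p) k s T ∧ κ * 2 ^ (k * s) ≤ T.card := fun p hp => adm_exists (A p) k s κ s0 (hAc p hp)
  choose! T0 hT0 hT0c using hT
  set δ : ℝ := (1 / 2) ^ k with hδ
  have δ0 : 0 < δ := by positivity
  have hδ2 : ∀ r : ℝ, r * 2 ^ k = r / δ := by
    intro r; rw [hδ, one_div_pow]; field_simp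
  have hδ3 : ∀ r : ℝ, (1 / δ) ^ r = 2 ^ (k * r) := by
    intro r
    rw [Real.rpow_mul (by norm_num), Real.rpow_natCast, hδ, one_div_pow, one_div_one_div]
  have hcell : ∀ (z : Fin 2 → ℝ) i, |(dcell k z i : ℝ) * δ - z i| ≤ δ := by
    intro z i
    have h1 := Int.floor_le (2 ^ k * z i)
    have h2 := Int.lt_floor_add_one (2 ^ k * z i)
    have h3 : (2:ℝ) ^ k * δ = 1 := by rw [hδ, ← mul_pow]; norm_num
    have e : (dcell k z i : ℝ) * δ - z i = ((⌊2 ^ k * z i⌋ : ℝ) - 2 ^ k * z i) * δ := by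
      simp only [dcell]
      linear_combination z i * h3
    rw [e, abs_mul, abs_of_pos δ0]
    have : |(⌊2 ^ k * z i⌋ : ℝ) - 2 ^ k * z i| ≤ 1 := by rw [abs_le]; constructor <;> linarith
    nlinarith
  have hle := C.hle
  let ξ : (Fin 2 → ℤ) → ℝ := fun v => max lo (min hi (v 0 * δ))
  let y : (Fin 2 → ℤ) → ℝ := fun v => v 1 * δ
  have hξI : ∀ v, ξ v ∈ Icc lo hi := fun v => ⟨le_max_left _ _, max_le hle (min_le_left _ _)⟩
  have hξ : ∀ z : Fin 2 → ℝ, z 0 ∈ Icc lo hi → |ξ (dcell k z) - z 0| ≤ δ := by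
    intro z hz
    have e : z 0 = max lo (min hi (z 0)) := by rw [min_eq_right hz.2, max_eq_right hz.1]
    refine le_trans ?_ (hcell z 0)
    simp only [ξ]
    conv_lhs => rw [e]
    have h1 := abs_max_sub_max_le_abs (min hi ((dcell k z 0 : ℝ) * δ)) (min hi (z 0)) lo
    have h2 := abs_min_sub_min_le_max hi ((dcell k z 0 : ℝ) * δ) hi (z 0)
    rw [max_comm lo, max_comm lo]
    refine h1.trans (h2.trans ?_)
    rw [sub_self, abs_zero]
    exact max_le (abs_nonneg _) le_rfl
  have hAd : ∀ p ∈ K, ∀ z ∈ A p, ∀ w ∈ A p, dist z w ≤ |z 0 - w 0| := by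
    intro p hp z hz w hw
    rw [dist_pi_le_iff (abs_nonneg _)]
    intro i
    fin_cases i
    · exact le_rfl
    · have h1 := hA p hp z hz
      have h2 := hA p hp w hw
      simp only [Fin.mk_one, Real.dist_eq]
      rw [h1.2, h2.2]
      exact C.lip (hKU hp) h1.1 h2.1
  refine ⟨P, ξ, y, fun p => (T0 p).image (dcell k), ?_⟩
  have hPK : ∀ p ∈ P, p ∈ K := fun p hp => hP.1 hp
  refine ⟨C, fun p hp => hKU (hPK p hp), fun p hp q hq => hK p (hPK p hp) q (hPK q hq), δ0, 
    pow_le_one₀ (by norm_num) (by norm_num), s0, s1, t0, t1, hΛ, ?_, fun v _ => hξI v, ?_, ?_, ?_, ?_, ?_⟩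
  · intro p hp v hv
    obtain ⟨z, hz, rfl⟩ := Finset.mem_image.1 hv
    exact hQ p (hPK p hp) z ((hT0 p (hPK p hp)).1 hz)
  · intro p hp v hv
    obtain ⟨z, hz, rfl⟩ := Finset.mem_image.1 hv
    have hz' := hA p (hPK p hp) z ((hT0 p (hPK p hp)).1 hz)
    have h1 := C.lip (hKU (hPK p hp)) (hξI (dcell k z)) hz'.1
    have h2 := hcell z 1
    have h3 := hξ z hz'.1
    rw [← hz'.2] at h1
    have h1b := abs_le.1 (h1.trans h3)
    have h2b := abs_le.1 h2
    simp only [y]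
    rw [abs_le]
    constructor <;> linarith [h1b.1, h1b.2, h2b.1, h2b.2]
  · intro p hp r hr
    have h1 := adm_ball t0.le t1 hP hK p r hr
    rw [hδ2] at h1
    have e : (P.filter fun q => dist p q ≤ r) = P.filter fun q => dist q p ≤ r := by simp only [dist_comm]
    rw [e]
    refine h1.trans ?_
    have : (0:ℝ) < r := by linarith
    gcongr
    linarith
  · intro p hp c r hr
    have hpK := hPK p hp
    have r0 : (0:ℝ) < r := by linarith
    rcases (((T0 p).image (dcell k)).filter fun x => |ξ x - c| ≤ r).eq_empty_or_nonempty with h | ⟨v0, h0⟩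
    · rw [h]; simp; positivity
    · rw [Finset.mem_filter, Finset.mem_image] at h0
      obtain ⟨⟨z0, hz0, rfl⟩, hv0⟩ := h0
      have h1 := adm_ball s0.le s1 (hT0 p hpK) (fun z hz w hw => (hAd p hpK z hz w hw).trans (by
        have a1 := (hA p hpK z hz).1
        have a2 := (hA p hpK w hw).1
        have := C.hlen
        rw [abs_le]; constructor <;> linarith [a1.1, a1.2, a2.1, a2.2])) z0 (4 * r) (by linarith)
      have sub : (((T0 p).image (dcell k)).filter fun x => |ξ x - c| ≤ r) ⊆ ((T0 p).filter fun x => dist x z0 ≤ 4 * r).image (dcell k) := by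
        intro v hv
        rw [Finset.mem_filter, Finset.mem_image] at hv
        obtain ⟨⟨z, hz, rfl⟩, hv⟩ := hv
        refine Finset.mem_image_of_mem _ (Finset.mem_filter.2 ⟨hz, ?_⟩)
        refine (hAd p hpK z ((hT0 p hpK).1 hz) z0 ((hT0 p hpK).1 hz0)).trans ?_
        have b1 := abs_le.1 (hξ z (hA p hpK z ((hT0 p hpK).1 hz)).1)
        have b2 := abs_le.1 (hξ z0 (hA p hpK z0 ((hT0 p hpK).1 hz0)).1)
        have b3 := abs_le.1 hv
        have b4 := abs_le.1 hv0
        rw [abs_le]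
        constructor <;> linarith [b1.1, b1.2, b2.1, b2.2, b3.1, b3.2, b4.1, b4.2]
      calc _ ≤ (((T0 p).filter fun x => dist x z0 ≤ 4 * r).card : ℝ) := 
            Nat.cast_le.2 ((Finset.card_le_card sub).trans Finset.card_image_le)
        _ ≤ 4 * 3 ^ 2 * (4 * r * 2 ^ k) ^ s := h1
        _ = 4 * 3 ^ 2 * (4 * (r / δ)) ^ s := by rw [← hδ2]; ring_nf
        _ ≤ 4 * 3 ^ 2 * (4 * (r / δ) ^ s) := by
            gcongr
            exact DiscHyp.rpow_le_self_mul (by norm_num) (by positivity) s0.le s1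
        _ = 144 * (r / δ) ^ s := by ring
        _ ≤ Λ * (r / δ) ^ s := by gcongr; linarith
  · rw [hδ3]
    have Λ0 : 0 < Λ := by linarith
    calc (2:ℝ) ^ (k * t) ≤ Λ * κ * 2 ^ (k * t) := le_mul_of_one_le_left (by positivity) hΛκ
      _ = Λ * (κ * 2 ^ (k * t)) := by ring
      _ ≤ _ := by gcongr
  · intro p hp
    rw [hδ3, Finset.card_image_of_injOn (adm_inj (hT0 p (hPK p hp)))]
    have Λ0 : 0 < Λ := by linarith
    calc (2:ℝ) ^ (k * s) ≤ Λ * κ * 2 ^ (k * s) := le_mul_of_one_le_left (by positivity) hΛκ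
      _ = Λ * (κ * 2 ^ (k * s)) := by ring
      _ ≤ _ := by gcongr; exact hT0c p (hPK p hp)

lemma poly_exp (C a : ℝ) (ha : 0 < a) (m : ℕ) : ∃ k0 : ℕ, ∀ k : ℕ, k0 ≤ k → C * ((k:ℝ) + 1) ^ m < 2 ^ (k * a) := by
  set r : ℝ := 2 ^ (-a) with hr
  have r0 : 0 < r := by positivity
  have r1 : r < 1 := by
    rw [hr]; exact Real.rpow_lt_one_of_one_lt_of_neg (by norm_num) (by linarith)
  have h := tendsto_pow_const_mul_const_pow_of_abs_lt_one m (r := r) (by rw [abs_of_pos r0]; exact r1)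
  have h2 := (h.comp (Filter.tendsto_add_atTop_nat 1)).const_mul (C / r)
  rw [mul_zero] at h2
  have h3 := h2.eventually (gt_mem_nhds (show (0:ℝ) < 1 by norm_num))
  obtain ⟨k0, hk0⟩ := Filter.eventually_atTop.1 h3
  refine ⟨k0, fun k hk => ?_⟩
  have h4 := hk0 k hk
  simp only [Function.comp] at h4
  push_cast at h4
  have h5 : (2:ℝ) ^ (k * a) * r ^ k = 1 := by
    rw [hr, ← Real.rpow_natCast, ← Real.rpow_mul (by norm_num), ← Real.rpow_add (by norm_num)]
    rw [show (k:ℝ) * a + -a * k = 0 by ring, Real.rpow_zero]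
  have h6 : C / r * (((k:ℝ) + 1) ^ m * r ^ (k + 1)) = C * ((k:ℝ) + 1) ^ m * r ^ k := by
    rw [pow_succ]; field_simp
  rw [h6] at h4
  have h7 := h4.trans_eq h5.symm
  exact lt_of_mul_lt_mul_right h7 (by positivity)

lemma loc_core {f f1 f2 : (Fin 3 → ℝ) → ℝ → ℝ} {U : Set (Fin 3 → ℝ)} {lo hi : ℝ} (C : Cine f f1 f2 U lo hi)
    {K : Set (Fin 3 → ℝ)} (hKU : K ⊆ U) (hK : ∀ p ∈ K, ∀ q ∈ K, dist p q ≤ 1) (F : Set (Fin 2 → ℝ)) (A : (Fin 3 → ℝ) → Set (Fin 2 → ℝ))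
    (hAF : ∀ p ∈ K, A p ⊆ F)
    (hA : ∀ p ∈ K, ∀ z ∈ A p, z 0 ∈ Icc lo hi ∧ z 1 = f p (z 0)) {s t σ : ℝ} (s0 : 0 < s) (s1 : s ≤ 1) (t0 : 0 < t) (t1 : t ≤ 1)
    (σ0 : 0 < σ) (hFd : dimH F < ENNReal.ofReal σ) (hAd : ∀ p ∈ K, ENNReal.ofReal s < dimH (A p)) (hKd : ENNReal.ofReal t < dimH K) :
    ∃ (C : ℝ) (m : ℕ), ∀ k0 : ℕ, ∃ k : ℕ, k0 ≤ k ∧ (2:ℝ) ^ (k * (3 * s + t)) ≤ C * ((k:ℝ) + 1) ^ m * (2 ^ (k * σ)) ^ 3 ∧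
      (t ≤ s → (2:ℝ) ^ (k * (s + t)) ≤ C * ((k:ℝ) + 1) ^ m * 2 ^ (k * σ)) := by
  obtain ⟨c0, c00, c01, pig⟩ := cont_pig
  -- uniformize
  obtain ⟨κ, K', hκ, hκ1, hK', hK'c, hK'A⟩ : ∃ (κ : ℝ) (K' : Set (Fin 3 → ℝ)), 0 < κ ∧ κ ≤ 1 ∧ K' ⊆ K ∧ ENNReal.ofReal κ ≤ cont t K' ∧
      ∀ p ∈ K', ENNReal.ofReal κ ≤ cont s (A p) := by
    let Kn : ℕ → Set (Fin 3 → ℝ) := fun n => {p | p ∈ K ∧ ENNReal.ofReal (1 / ((n:ℝ) + 1)) ≤ cont s (A p)}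
    have small : ∀ x : ℝ≥0∞, 0 < x → ∃ n : ℕ, ENNReal.ofReal (1 / ((n:ℝ) + 1)) ≤ x := by
      intro x hx
      obtain ⟨n, hn⟩ := ENNReal.exists_inv_nat_lt hx.ne'
      refine ⟨n, le_trans ?_ hn.le⟩
      rw [one_div, ENNReal.ofReal_inv_of_pos (by positivity), ENNReal.inv_le_inv]
      calc (n : ℝ≥0∞) = ENNReal.ofReal n := by simp
        _ ≤ _ := ENNReal.ofReal_le_ofReal (by linarith)
    have hcov : K ⊆ ⋃ n, Kn n := by
      intro p hp
      obtain ⟨n, hn⟩ := small _ (cont_pos s0 (hAd p hp))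
      exact mem_iUnion.2 ⟨n, hp, hn⟩
    have h1 : ENNReal.ofReal t < dimH (⋃ n, Kn n) := hKd.trans_le (dimH_mono hcov)
    rw [dimH_iUnion, lt_iSup_iff] at h1
    obtain ⟨n, hn⟩ := h1
    obtain ⟨m, hm⟩ := small _ (cont_pos t0 hn)
    refine ⟨1 / ((max n m : ℕ) + 1), Kn n, by positivity, ?_, fun p hp => hp.1, ?_, ?_⟩
    · rw [div_le_one (by positivity)]
      have : (0:ℝ) ≤ (max n m : ℕ) := Nat.cast_nonneg _
      linarith
    · refine le_trans (ENNReal.ofReal_le_ofReal ?_) hm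
      gcongr
      exact le_max_right _ _
    · intro p hp
      refine le_trans (ENNReal.ofReal_le_ofReal ?_) hp.2
      gcongr
      exact le_max_left _ _
  obtain ⟨n, hn⟩ : ∃ n : ℕ, 1 ≤ n * s := by
    obtain ⟨n, hn⟩ := exists_nat_ge (1 / s)
    exact ⟨n, by rwa [div_le_iff₀ s0] at hn⟩
  set B : ℝ := 10000 / (κ * c0) with hB
  have hκc : κ * c0 ≤ 1 := by nlinarith
  have hB1 : 10000 ≤ B := by
    rw [hB, le_div_iff₀ (by positivity)]; nlinarith
  refine ⟨B ^ (23 + 16 * n) * 3 ^ 6, 2 * (23 + 16 * n), fun k0 => ?_⟩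
  obtain ⟨E, Q, hFE, hE0, hEQ, hQc⟩ := cover_levels F σ σ0 hFd k0
  let D : ℕ → Set (Fin 3 → ℝ) := fun k => {p | ENNReal.ofReal (κ * (c0 / ((k:ℝ) + 1) ^ 2)) ≤ cont s (A p ∩ E k)}
  have hD : K' ⊆ ⋃ k, D k := by
    intro p hp
    obtain ⟨k, hk⟩ := pig s κ (A p) E hκ (hK'A p hp) ((hAF p (hK' hp)).trans hFE)
    exact mem_iUnion.2 ⟨k, hk⟩
  obtain ⟨k, hk⟩ := pig t κ K' D hκ hK'c hD
  have hkpos : 0 < κ * (c0 / ((k:ℝ) + 1) ^ 2) := by positivity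
  have hk0 : k0 ≤ k := by
    by_contra hlt
    push Not at hlt
    have : K' ∩ D k = ∅ := by
      ext p
      simp only [mem_inter_iff, mem_empty_iff_false, iff_false, not_and]
      intro _ hp
      have hp' : ENNReal.ofReal (κ * (c0 / ((k:ℝ) + 1) ^ 2)) ≤ cont s (A p ∩ E k) := hp
      rw [hE0 k hlt, inter_empty, measure_empty, nonpos_iff_eq_zero, ENNReal.ofReal_eq_zero] at hp'
      linarith
    rw [this, measure_empty, nonpos_iff_eq_zero, ENNReal.ofReal_eq_zero] at hk
    linarith
  set Λ : ℝ := B * ((k:ℝ) + 1) ^ 2 with hΛ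
  have hk1 : (1:ℝ) ≤ ((k:ℝ) + 1) ^ 2 := by
    have : (0:ℝ) ≤ k := Nat.cast_nonneg _
    nlinarith
  have hΛ1 : 10000 ≤ Λ := by rw [hΛ]; nlinarith
  obtain ⟨P, ξ, y, T, H⟩ := mk_disc C (K := K' ∩ D k) (fun p hp => hKU (hK' hp.1)) (fun p hp q hq => hK p (hK' hp.1) q (hK' hq.1))
    (fun p => A p ∩ E k) (fun p hp z hz => hA p (hK' hp.1) z hz.1) s0 s1 t0 t1 hkpos k (Q k) (fun p hp z hz => hEQ k z hz.2)
    (fun p hp => hp.2) hk (Λ := Λ) hΛ1 (by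
      have : Λ * (κ * (c0 / ((k:ℝ) + 1) ^ 2)) = 10000 := by rw [hΛ, hB]; field_simp
      rw [this]; norm_num)
  have hδ3 : ∀ r : ℝ, (1 / (1 / 2 : ℝ) ^ k) ^ r = 2 ^ (k * r) := by
    intro r
    rw [Real.rpow_mul (by norm_num), Real.rpow_natCast, one_div_pow, one_div_one_div]
  have hΛpow : Λ ^ (23 + 16 * n) = B ^ (23 + 16 * n) * ((k:ℝ) + 1) ^ (2 * (23 + 16 * n)) := by
    rw [hΛ, mul_pow, ← pow_mul]
  have big : ∀ a b : ℕ, a ≤ b → Λ ^ a ≤ Λ ^ b := fun a b h => pow_le_pow_right₀ (by linarith) h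
  have hΛ0 : 0 < Λ := by linarith
  refine ⟨k, hk0, ?_, fun hts => ?_⟩
  · have h1 := H.disc1 n hn
    rw [hδ3] at h1
    calc _ ≤ _ := h1
      _ ≤ Λ ^ (23 + 16 * n) * (3 ^ 2 * 2 ^ (k * σ)) ^ 3 := by
          have := hQc k
          have := big (6 + 16 * n) (23 + 16 * n) (by omega)
          gcongr
      _ = _ := by rw [hΛpow]; ring
  · have h1 := H.disc2 hts k rfl (by
      have : (0:ℝ) ≤ k := Nat.cast_nonneg _
      rw [hΛ]; nlinarith) n hn
    rw [hδ3] at h1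
    have hB0 : 0 < B := by linarith
    calc _ ≤ _ := h1
      _ ≤ Λ ^ (23 + 16 * n) * (3 ^ 2 * 2 ^ (k * σ)) := by
          have := hQc k
          have := big (23 + 10 * n) (23 + 16 * n) (by omega)
          gcongr
      _ = B ^ (23 + 16 * n) * 3 ^ 2 * ((k:ℝ) + 1) ^ (2 * (23 + 16 * n)) * 2 ^ (k * σ) := by rw [hΛpow]; ring
      _ ≤ _ := by
          gcongr <;> norm_num

/-- the local theorem for cinematic families -/
lemma loc_main {f f1 f2 : (Fin 3 → ℝ) → ℝ → ℝ} {U : Set (Fin 3 → ℝ)} {lo hi : ℝ} (C : Cine f f1 f2 U lo hi)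
    {K : Set (Fin 3 → ℝ)} (hKU : K ⊆ U) (hK : ∀ p ∈ K, ∀ q ∈ K, dist p q ≤ 1) (F : Set (Fin 2 → ℝ)) (A : (Fin 3 → ℝ) → Set (Fin 2 → ℝ))
    (hAF : ∀ p ∈ K, A p ⊆ F)
    (hA : ∀ p ∈ K, ∀ z ∈ A p, z 0 ∈ Icc lo hi ∧ z 1 = f p (z 0)) {s t σ : ℝ} (s0 : 0 < s) (s1 : s ≤ 1) (t0 : 0 < t) (t1 : t ≤ 1)
    (σ0 : 0 < σ) (hFd : dimH F < ENNReal.ofReal σ) (hAd : ∀ p ∈ K, ENNReal.ofReal s < dimH (A p)) (hKd : ENNReal.ofReal t < dimH K) :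
    s + t / 3 ≤ σ ∧ (t ≤ s → s + t ≤ σ) := by
  obtain ⟨B, m, h⟩ := loc_core C hKU hK F A hAF hA s0 s1 t0 t1 σ0 hFd hAd hKd
  constructor
  · by_contra hlt
    push Not at hlt
    obtain ⟨k0, hk0⟩ := poly_exp B (3 * s + t - 3 * σ) (by linarith) m
    obtain ⟨k, hk, h1, -⟩ := h k0
    have h2 := hk0 k hk
    have h3 : (2:ℝ) ^ (k * (3 * s + t)) = 2 ^ (k * (3 * s + t - 3 * σ)) * (2 ^ (k * σ)) ^ 3 := by
      rw [← Real.rpow_natCast (2 ^ ((k:ℝ) * σ)), ← Real.rpow_mul (by norm_num), ← Real.rpow_add (by norm_num)]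
      congr 1; push_cast; ring
    rw [h3] at h1
    have := le_of_mul_le_mul_right h1 (by positivity)
    linarith
  · intro hts
    by_contra hlt
    push Not at hlt
    obtain ⟨k0, hk0⟩ := poly_exp B (s + t - σ) (by linarith) m
    obtain ⟨k, hk, -, h1⟩ := h k0
    have h1 := h1 hts
    have h2 := hk0 k hk
    have h3 : (2:ℝ) ^ (k * (s + t)) = 2 ^ (k * (s + t - σ)) * 2 ^ (k * σ) := by
      rw [← Real.rpow_add (by norm_num)]
      congr 1; ring
    rw [h3] at h1
    have := le_of_mul_le_mul_right h1 (by positivity)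
    linarith

noncomputable def cQ (u : Fin 3 → ℝ) (x : ℝ) : ℝ := u 2 * u 2 - (x - u 1) * (x - u 1)
noncomputable def cf (u : Fin 3 → ℝ) (x : ℝ) : ℝ := u 0 - u 2 + √(cQ u x)
noncomputable def cf1 (u : Fin 3 → ℝ) (x : ℝ) : ℝ := (u 1 - x) * (√(cQ u x))⁻¹
noncomputable def cf2 (u : Fin 3 → ℝ) (x : ℝ) : ℝ := - (u 2 * u 2) * ((√(cQ u x))⁻¹) ^ 3

def ubase : Fin 3 → ℝ := ![1, 0, 1]

lemma cproj (i : Fin 3) (p : (Fin 3 → ℝ) × ℝ) : HasStrictFDerivAt (fun q : (Fin 3 → ℝ) × ℝ => q.1 i)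
    ((ContinuousLinearMap.proj i : (Fin 3 → ℝ) →L[ℝ] ℝ).comp (ContinuousLinearMap.fst ℝ (Fin 3 → ℝ) ℝ)) p :=
  ((ContinuousLinearMap.proj i : (Fin 3 → ℝ) →L[ℝ] ℝ).comp (ContinuousLinearMap.fst ℝ (Fin 3 → ℝ) ℝ)).hasStrictFDerivAt

lemma csnd (p : (Fin 3 → ℝ) × ℝ) : HasStrictFDerivAt (fun q : (Fin 3 → ℝ) × ℝ => q.2)
    (ContinuousLinearMap.snd ℝ (Fin 3 → ℝ) ℝ) p :=
  (ContinuousLinearMap.snd ℝ (Fin 3 → ℝ) ℝ).hasStrictFDerivAt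

lemma cQ_base : cQ ubase 0 = 1 := by simp [cQ, ubase]

lemma cQ_strict : ∃ D : ((Fin 3 → ℝ) × ℝ) →L[ℝ] ℝ, HasStrictFDerivAt (fun q : (Fin 3 → ℝ) × ℝ => cQ q.1 q.2) D (ubase, 0) ∧
    ∀ w, D (w, 0) = 2 * w 2 := by
  refine ⟨_, ((cproj 2 _).mul (cproj 2 _)).sub (((csnd _).sub (cproj 1 _)).mul ((csnd _).sub (cproj 1 _))), ?_⟩
  intro w
  simp [ubase]
  ring

lemma sqrt_strict : HasStrictDerivAt (fun q : ℝ => √q) (1 / 2) 1 := by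
  have := Real.hasStrictDerivAt_sqrt (x := 1) (by norm_num)
  simpa using this

lemma isqrt_strict : HasStrictDerivAt (fun q : ℝ => (√q)⁻¹) (- (1 / 2)) 1 := by
  have h := (hasStrictDerivAt_inv (x := √(1:ℝ)) (by norm_num)).comp (1:ℝ) sqrt_strict
  simpa [Function.comp_def] using h

lemma isqrt3_strict : HasStrictDerivAt (fun q : ℝ => ((√q)⁻¹) ^ 3) (- (3 / 2)) 1 := by
  have h := isqrt_strict.pow 3
  norm_num at h
  exact h

lemma cf_strict : ∃ D : ((Fin 3 → ℝ) × ℝ) →L[ℝ] ℝ, HasStrictFDerivAt (fun q : (Fin 3 → ℝ) × ℝ => cf q.1 q.2) D (ubase, 0) ∧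
    ∀ w, D (w, 0) = w 0 := by
  obtain ⟨D, hD, hD2⟩ := cQ_strict
  have h : HasStrictDerivAt (fun q : ℝ => √q) (1 / 2) (cQ (ubase, (0:ℝ)).1 (ubase, (0:ℝ)).2) := by
    simp only [cQ_base]; exact sqrt_strict
  refine ⟨_, ((cproj 0 _).sub (cproj 2 _)).add (HasStrictDerivAt.comp_hasStrictFDerivAt (f := fun q : (Fin 3 → ℝ) × ℝ => cQ q.1 q.2) (ubase, (0:ℝ)) h hD), ?_⟩
  intro w
  simp [hD2]

lemma cf1_strict : ∃ D : ((Fin 3 → ℝ) × ℝ) →L[ℝ] ℝ, HasStrictFDerivAt (fun q : (Fin 3 → ℝ) × ℝ => cf1 q.1 q.2) D (ubase, 0) ∧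
    ∀ w, D (w, 0) = w 1 := by
  obtain ⟨D, hD, hD2⟩ := cQ_strict
  have h : HasStrictDerivAt (fun q : ℝ => (√q)⁻¹) (-(1 / 2)) (cQ (ubase, (0:ℝ)).1 (ubase, (0:ℝ)).2) := by
    simp only [cQ_base]; exact isqrt_strict
  refine ⟨_, ((cproj 1 _).sub (csnd _)).mul (HasStrictDerivAt.comp_hasStrictFDerivAt (f := fun q : (Fin 3 → ℝ) × ℝ => cQ q.1 q.2) (ubase, (0:ℝ)) h hD), ?_⟩
  intro w
  have hb : cQ ![1, 0, 1] 0 = 1 := cQ_base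
  simp [hD2, hb, ubase]

lemma cf2_strict : ∃ D : ((Fin 3 → ℝ) × ℝ) →L[ℝ] ℝ, HasStrictFDerivAt (fun q : (Fin 3 → ℝ) × ℝ => cf2 q.1 q.2) D (ubase, 0) ∧
    ∀ w, D (w, 0) = w 2 := by
  obtain ⟨D, hD, hD2⟩ := cQ_strict
  have h : HasStrictDerivAt (fun q : ℝ => ((√q)⁻¹) ^ 3) (-(3 / 2)) (cQ (ubase, (0:ℝ)).1 (ubase, (0:ℝ)).2) := by
    simp only [cQ_base]; exact isqrt3_strict
  refine ⟨_, ((cproj 2 _).mul (cproj 2 _)).neg.mul (HasStrictDerivAt.comp_hasStrictFDerivAt (f := fun q : (Fin 3 → ℝ) × ℝ => cQ q.1 q.2) (ubase, (0:ℝ)) h hD), ?_⟩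
  intro w
  have hb : cQ ![1, 0, 1] 0 = 1 := cQ_base
  simp [hD2, hb, ubase]
  ring

lemma strict_near {G : (Fin 3 → ℝ) → ℝ → ℝ} {i : Fin 3} (h : ∃ D : ((Fin 3 → ℝ) × ℝ) →L[ℝ] ℝ,
    HasStrictFDerivAt (fun q : (Fin 3 → ℝ) × ℝ => G q.1 q.2) D (ubase, 0) ∧ ∀ w, D (w, 0) = w i) :
    ∃ ρ > 0, ∀ u ∈ ball ubase ρ, ∀ v ∈ ball ubase ρ, ∀ x : ℝ, |x| < ρ → |G v x - G u x - (v i - u i)| ≤ dist u v / 100 := by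
  obtain ⟨D, hD, hw⟩ := h
  have h1 := (hD.isLittleO.def (c := 1 / 100) (by norm_num))
  rw [Metric.eventually_nhds_iff] at h1
  obtain ⟨ρ, ρ0, h2⟩ := h1
  refine ⟨ρ, ρ0, fun u hu v hv x hx => ?_⟩
  have h3 := @h2 ((v, x), (u, x)) (by
    simp only [Prod.dist_eq, max_lt_iff, Real.dist_eq, sub_zero]
    exact ⟨⟨hv, hx⟩, ⟨hu, hx⟩⟩)
  have e : ((v, x) - (u, x) : (Fin 3 → ℝ) × ℝ) = (v - u, 0) := by ext <;> simp
  simp only [e, hw, Real.norm_eq_abs, Pi.sub_apply] at h3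
  have e2 : ‖((v - u, 0) : (Fin 3 → ℝ) × ℝ)‖ = dist u v := by
    rw [Prod.norm_mk, norm_zero, max_eq_left (norm_nonneg _), dist_comm, dist_eq_norm]
  rw [e2] at h3
  linarith

lemma cine_exists : ∃ ρ : ℝ, 0 < ρ ∧ ρ ≤ 1 / 2 ∧ Cine cf cf1 cf2 (ball ubase ρ) (-ρ) ρ := by
  obtain ⟨ρ0, h00, h0⟩ := strict_near cf_strict
  obtain ⟨ρ1, h10, h1⟩ := strict_near cf1_strict
  obtain ⟨ρ2, h20, h2⟩ := strict_near cf2_strict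
  obtain ⟨D, hD, -⟩ := cQ_strict
  obtain ⟨D1, hD1, -⟩ := cf1_strict
  have q1 : ∀ᶠ q : (Fin 3 → ℝ) × ℝ in nhds (ubase, 0), 0 < cQ q.1 q.2 :=
    hD.continuousAt.eventually (lt_mem_nhds (by simp only [cQ_base]; norm_num))
  have q2 : ∀ᶠ q : (Fin 3 → ℝ) × ℝ in nhds (ubase, 0), |cf1 q.1 q.2| < 1 :=
    hD1.continuousAt.abs.eventually (gt_mem_nhds (by simp [cf1, ubase]))
  obtain ⟨ρ3, h30, h3⟩ := Metric.eventually_nhds_iff.1 (q1.and q2)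
  obtain ⟨ρ, hρ, hρ'⟩ : ∃ ρ, 0 < ρ ∧ ρ < min (1/2) (min (min ρ0 ρ1) (min ρ2 ρ3)) :=
    exists_between (by positivity)
  simp only [lt_min_iff] at hρ'
  obtain ⟨a, ⟨b, c⟩, d, e⟩ := hρ'
  have key : ∀ u ∈ ball ubase ρ, ∀ x ∈ Icc (-ρ) ρ, 0 < cQ u x ∧ |cf1 u x| < 1 := by
    intro u hu x hx
    refine @h3 (u, x) ?_
    rw [Prod.dist_eq, max_lt_iff]
    refine ⟨lt_trans hu e, ?_⟩
    simp only [Real.dist_eq, sub_zero]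
    exact (abs_le.2 hx).trans_lt e
  have hQd : ∀ u x, HasDerivAt (fun x => cQ u x) (2 * (u 1 - x)) x := by
    intro u x
    have h := (((hasDerivAt_id x).sub_const (u 1)).mul ((hasDerivAt_id x).sub_const (u 1))).const_sub (u 2 * u 2)
    refine h.congr_deriv ?_
    simp; ring
  have hRd : ∀ u x, 0 < cQ u x → HasDerivAt (fun x => √(cQ u x)) (cf1 u x) x := by
    intro u x h
    have := (hQd u x).sqrt h.ne'
    refine this.congr_deriv ?_
    rw [cf1]; field_simp
  refine ⟨ρ, hρ, a.le, ⟨by linarith, by linarith, ?_, ?_, ?_, ?_, ?_, ?_⟩⟩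
  · intro u hu x hx
    exact (hRd u x (key u hu x hx).1).const_add _
  · intro u hu x hx
    have hq := (key u hu x hx).1
    have hs : 0 < √(cQ u x) := Real.sqrt_pos.2 hq
    have h := ((hasDerivAt_id x).const_sub (u 1)).mul ((hRd u x hq).inv hs.ne')
    refine h.congr_deriv ?_
    have h4 : √(cQ u x) * √(cQ u x) = u 2 * u 2 - (x - u 1) * (x - u 1) := Real.mul_self_sqrt hq.le
    simp only [cf2, cf1, id, Pi.inv_apply]
    set R := √(cQ u x)
    field_simp
    linear_combination -h4
  · intro u hu x hx
    exact (key u hu x hx).2.le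
  · intro u hu v hv x hx
    exact h0 u (ball_subset_ball b.le hu) v (ball_subset_ball b.le hv) x ((abs_le.2 hx).trans_lt b)
  · intro u hu v hv x hx
    exact h1 u (ball_subset_ball c.le hu) v (ball_subset_ball c.le hv) x ((abs_le.2 hx).trans_lt c)
  · intro u hu v hv x hx
    exact h2 u (ball_subset_ball d.le hu) v (ball_subset_ball d.le hv) x ((abs_le.2 hx).trans_lt d)

/-- rotation coordinates -/
noncomputable def L2 (e0 e1 r0 : ℝ) : EuclideanSpace ℝ (Fin 2) →ₗ[ℝ] (Fin 2 → ℝ) where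
  toFun z := ![(-e1 * z 0 + e0 * z 1) / r0, (e0 * z 0 + e1 * z 1) / r0]
  map_add' x y := by ext i; fin_cases i <;> simp <;> ring
  map_smul' c x := by ext i; fin_cases i <;> simp <;> ring

noncomputable def L3 (e0 e1 r0 : ℝ) : EuclideanSpace ℝ (Fin 2) × ℝ →ₗ[ℝ] (Fin 3 → ℝ) where
  toFun p := ![(e0 * p.1 0 + e1 * p.1 1) / r0 + p.2 / r0, (-e1 * p.1 0 + e0 * p.1 1) / r0, p.2 / r0]
  map_add' x y := by ext i; fin_cases i <;> simp <;> ring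
  map_smul' c x := by ext i; fin_cases i <;> simp <;> ring

lemma L2_ker {e0 e1 r0 : ℝ} (he : e0 * e0 + e1 * e1 = 1) (hr : 0 < r0) : (L2 e0 e1 r0).ker = ⊥ := by
  rw [LinearMap.ker_eq_bot']
  intro z hz
  have h0 := congrFun hz 0
  have h1 := congrFun hz 1
  simp [L2, hr.ne'] at h0 h1
  ext i
  fin_cases i
  · simp; linear_combination e0 * h1 - e1 * h0 - z 0 * he
  · simp; linear_combination e1 * h1 + e0 * h0 - z 1 * he

lemma L3_ker {e0 e1 r0 : ℝ} (he : e0 * e0 + e1 * e1 = 1) (hr : 0 < r0) : (L3 e0 e1 r0).ker = ⊥ := by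
  rw [LinearMap.ker_eq_bot']
  rintro ⟨z, r⟩ hz
  have h0 := congrFun hz 0
  have h1 := congrFun hz 1
  have h2 := congrFun hz 2
  simp [L3, hr.ne'] at h0 h1 h2
  subst h2
  simp [hr.ne'] at h0
  refine Prod.ext ?_ rfl
  ext i
  fin_cases i
  · simp; linear_combination e0 * h0 - e1 * h1 - z 0 * he
  · simp; linear_combination e1 * h0 + e0 * h1 - z 1 * he

lemma sphere_eq {c z : EuclideanSpace ℝ (Fin 2)} {r : ℝ} (h : z ∈ sphere c r) :
    (z 0 - c 0) * (z 0 - c 0) + (z 1 - c 1) * (z 1 - c 1) = r * r := by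
  rw [mem_sphere, EuclideanSpace.dist_eq] at h
  have h0 : 0 ≤ ∑ i, dist (z i) (c i) ^ 2 := by positivity
  have := Real.mul_self_sqrt h0
  rw [h] at this
  simp only [Fin.sum_univ_two, Real.dist_eq, sq_abs] at this
  linarith

lemma local_lemma (c0 : EuclideanSpace ℝ (Fin 2)) (r0 : ℝ) (hr : 0 < r0) (z0 : EuclideanSpace ℝ (Fin 2)) (hz : z0 ∈ sphere c0 r0) :
    ∃ U ∈ nhds (c0, r0), ∃ V ∈ nhds z0, ∀ (K : Set (EuclideanSpace ℝ (Fin 2) × ℝ)) (F : Set (EuclideanSpace ℝ (Fin 2))) (s t σ : ℝ),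
      0 < s → s ≤ 1 → 0 < t → t ≤ 1 → 0 < σ → K ⊆ U → dimH F < ENNReal.ofReal σ →
      (∀ p ∈ K, ENNReal.ofReal s < dimH (F ∩ sphere p.1 p.2 ∩ V)) → ENNReal.ofReal t < dimH K →
      s + t / 3 ≤ σ ∧ (t ≤ s → s + t ≤ σ) := by
  obtain ⟨ρ, ρ0, ρ1, C⟩ := cine_exists
  obtain ⟨e0, he0⟩ : ∃ e0, e0 = (z0 0 - c0 0) / r0 := ⟨_, rfl⟩
  obtain ⟨e1, he1⟩ : ∃ e1, e1 = (z0 1 - c0 1) / r0 := ⟨_, rfl⟩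
  have he : e0 * e0 + e1 * e1 = 1 := by
    have := sphere_eq hz
    rw [he0, he1]; field_simp; linarith
  have he0' : e0 * r0 = z0 0 - c0 0 := by rw [he0]; field_simp
  have he1' : e1 * r0 = z0 1 - c0 1 := by rw [he1]; field_simp
  let Φ : EuclideanSpace ℝ (Fin 2) → (Fin 2 → ℝ) := fun z => L2 e0 e1 r0 z - L2 e0 e1 r0 c0
  let Ψ : EuclideanSpace ℝ (Fin 2) × ℝ → (Fin 3 → ℝ) := fun p => L3 e0 e1 r0 p - L3 e0 e1 r0 (c0, 0)
  obtain ⟨k2, -, hk2⟩ := LinearMap.exists_antilipschitzWith _ (L2_ker he hr)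
  obtain ⟨k3, -, hk3⟩ := LinearMap.exists_antilipschitzWith _ (L3_ker he hr)
  have aΦ : AntilipschitzWith k2 Φ := fun x y => by simp only [Φ, edist_sub_right]; exact hk2 x y
  have aΨ : AntilipschitzWith k3 Ψ := fun x y => by simp only [Ψ, edist_sub_right]; exact hk3 x y
  have lΦ : ∃ k, LipschitzWith k Φ := by
    refine ⟨‖LinearMap.toContinuousLinearMap (L2 e0 e1 r0)‖₊, fun x y => ?_⟩
    simp only [Φ, edist_sub_right]
    exact (LinearMap.toContinuousLinearMap (L2 e0 e1 r0)).lipschitz x y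
  obtain ⟨l2, lΦ⟩ := lΦ
  have cΦ : Continuous Φ := lΦ.continuous
  have cΨ : Continuous Ψ := (L3 e0 e1 r0).continuous_of_finiteDimensional.sub continuous_const
  have bΨ : Ψ (c0, r0) = ubase := by
    ext i; fin_cases i <;> simp [Ψ, L3, ubase, hr.ne']
  have bΦ0 : Φ z0 0 = 0 := by
    simp [Φ, L2, ← sub_div, hr.ne']
    linear_combination e1 * he0' - e0 * he1'
  have bΦ1 : Φ z0 1 = 1 := by
    simp [Φ, L2, ← sub_div]
    rw [div_eq_one_iff_eq hr.ne']
    linear_combination - e1 * he1' - e0 * he0' + r0 * he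
  -- neighborhoods
  have hUe : ∀ᶠ p in nhds (c0, r0), Ψ p ∈ ball ubase ρ :=
    cΨ.continuousAt.eventually (by rw [bΨ]; exact ball_mem_nhds _ ρ0)
  have hUe2 : ∀ᶠ p in nhds (c0, r0), Ψ p 0 - Ψ p 2 < 1 / 2 := by
    have : Continuous fun p => Ψ p 0 - Ψ p 2 := by fun_prop
    exact this.continuousAt.eventually (gt_mem_nhds (by beta_reduce; rw [bΨ]; simp [ubase]))
  have hVe : ∀ᶠ z in nhds z0, |Φ z 0| < ρ := by
    have : Continuous fun z => |Φ z 0| := by fun_prop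
    exact this.continuousAt.eventually (gt_mem_nhds (by beta_reduce; rw [bΦ0]; simpa))
  have hVe2 : ∀ᶠ z in nhds z0, 1 / 2 < Φ z 1 := by
    have : Continuous fun z => Φ z 1 := by fun_prop
    exact this.continuousAt.eventually (lt_mem_nhds (by beta_reduce; rw [bΦ1]; norm_num))
  refine ⟨_, hUe.and hUe2, _, hVe.and hVe2, ?_⟩
  set V : Set (EuclideanSpace ℝ (Fin 2)) := {z | |Φ z 0| < ρ ∧ 1 / 2 < Φ z 1} with hV
  intro K F s t σ s0 s1 t0 t1 σ0 hKU hFd hAd hKd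
  refine loc_main C (K := Ψ '' K) ?_ ?_ (Φ '' F) (fun u => {z | z ∈ Φ '' F ∧ z 0 ∈ Icc (-ρ) ρ ∧ z 1 = cf u (z 0)})
    (fun p _ z hz => hz.1) (fun p _ z hz => hz.2) s0 s1 t0 t1 σ0 ((lΦ.dimH_image_le F).trans_lt hFd) ?_
    (hKd.trans_le (aΨ.le_dimH_image K))
  · rintro _ ⟨p, hp, rfl⟩
    exact (hKU hp).1
  · rintro _ ⟨p, hp, rfl⟩ _ ⟨q, hq, rfl⟩
    have h1 : dist (Ψ p) ubase < ρ := (hKU hp).1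
    have h2 : dist (Ψ q) ubase < ρ := (hKU hq).1
    linarith [dist_triangle_right (Ψ p) (Ψ q) ubase]
  · rintro _ ⟨p, hp, rfl⟩
    refine (hAd p hp).trans_le ((aΦ.le_dimH_image _).trans (dimH_mono ?_))
    rintro _ ⟨z, ⟨⟨hzF, hzS⟩, hzV⟩, rfl⟩
    have hzV : |Φ z 0| < ρ ∧ 1 / 2 < Φ z 1 := hzV
    have hb : Ψ p 0 - Ψ p 2 < 1 / 2 := (hKU hp).2
    refine ⟨mem_image_of_mem _ hzF, abs_le.1 hzV.1.le, ?_⟩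
    have hs := sphere_eq hzS
    have key : cQ (Ψ p) (Φ z 0) = (Φ z 1 - (Ψ p 0 - Ψ p 2)) * (Φ z 1 - (Ψ p 0 - Ψ p 2)) := by
      simp only [cQ]
      simp [Φ, Ψ, L2, L3]
      field_simp
      linear_combination (-(e0 * e0 + e1 * e1)) * hs - (p.2 * p.2) * he
    rw [cf, key, Real.sqrt_mul_self (by linarith)]
    ring

lemma global_lemma (K : Set (EuclideanSpace ℝ (Fin 2) × ℝ)) (F : Set (EuclideanSpace ℝ (Fin 2))) (s t σ : ℝ)
    (s0 : 0 < s) (s1 : s ≤ 1) (t0 : 0 < t) (t1 : t ≤ 1) (σ0 : 0 < σ) (hKpos : ∀ p ∈ K, 0 < p.2) (hFd : dimH F < ENNReal.ofReal σ)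
    (hAd : ∀ p ∈ K, ENNReal.ofReal s < dimH (F ∩ sphere p.1 p.2)) (hKd : ENNReal.ofReal t < dimH K) :
      s + t / 3 ≤ σ ∧ (t ≤ s → s + t ≤ σ) := by
  let W : Set ((EuclideanSpace ℝ (Fin 2) × ℝ) × EuclideanSpace ℝ (Fin 2)) := {w | 0 < w.1.2 ∧ w.2 ∈ sphere w.1.1 w.1.2}
  have hW : ∀ w, ∃ U V, w ∈ W → U ∈ nhds w.1 ∧ V ∈ nhds w.2 ∧ ∀ (K : Set (EuclideanSpace ℝ (Fin 2) × ℝ)) (F : Set (EuclideanSpace ℝ (Fin 2))) (s t σ : ℝ),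
      0 < s → s ≤ 1 → 0 < t → t ≤ 1 → 0 < σ → K ⊆ U → dimH F < ENNReal.ofReal σ →
      (∀ p ∈ K, ENNReal.ofReal s < dimH (F ∩ sphere p.1 p.2 ∩ V)) → ENNReal.ofReal t < dimH K →
      s + t / 3 ≤ σ ∧ (t ≤ s → s + t ≤ σ) := by
    intro w
    by_cases hw : w ∈ W
    · obtain ⟨U, hU, V, hV, h⟩ := local_lemma w.1.1 w.1.2 hw.1 w.2 hw.2
      exact ⟨U, V, fun _ => ⟨hU, hV, h⟩⟩
    · exact ⟨∅, ∅, fun h => absurd h hw⟩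
  choose U V hUV using hW
  obtain ⟨T, hTW, hTc, hT⟩ := TopologicalSpace.countable_cover_nhdsWithin (s := W) (f := fun w => U w ×ˢ V w) (by
    intro w hw
    exact mem_nhdsWithin_of_mem_nhds (prod_mem_nhds (hUV w hw).1 (hUV w hw).2.1))
  let Kw : (EuclideanSpace ℝ (Fin 2) × ℝ) × EuclideanSpace ℝ (Fin 2) → Set (EuclideanSpace ℝ (Fin 2) × ℝ) :=
    fun w => {p | p ∈ U w ∧ ENNReal.ofReal s < dimH (F ∩ sphere p.1 p.2 ∩ V w)}
  have hcov : K ⊆ ⋃ w ∈ T, Kw w := by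
    intro p hp
    have h1 : F ∩ sphere p.1 p.2 ⊆ ⋃ w ∈ T ∩ {w | p ∈ U w}, (F ∩ sphere p.1 p.2 ∩ V w) := by
      intro z hz
      have hz' : (p, z) ∈ W := ⟨hKpos p hp, hz.2⟩
      obtain ⟨w, hw, hw2⟩ := mem_iUnion₂.1 (hT hz')
      exact mem_iUnion₂.2 ⟨w, ⟨hw, hw2.1⟩, hz, hw2.2⟩
    have h2 := (hAd p hp).trans_le (dimH_mono h1)
    rw [dimH_bUnion (hTc.mono inter_subset_left), lt_biSup_iff] at h2
    obtain ⟨w, hw, h3⟩ := h2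
    exact mem_iUnion₂.2 ⟨w, hw.1, hw.2, h3⟩
  have h4 := hKd.trans_le (dimH_mono hcov)
  rw [dimH_bUnion hTc, lt_biSup_iff] at h4
  obtain ⟨w, hw, h5⟩ := h4
  exact (hUV w (hTW hw)).2.2 (Kw w) F s t σ s0 s1 t0 t1 σ0 (fun p hp => hp.1) hFd (fun p hp => hp.2) h5

/-- **Dimension estimate for circular `(s,t)`-Furstenberg sets.**
If `F ⊆ ℝ²` is a circular `(s,t)`-Furstenberg set, i.e. there is a parameter set
`K ⊆ ℝ² × (0,∞)` with `dim_H K ≥ t` such that `dim_H (F ∩ S(x,r)) ≥ s` for all `(x,r) ∈ K`,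
then `dim_H F ≥ max {t/3 + s, (2s−1)t + s}`. -/
theorem circular_furstenberg_dim_lower_bound
    (s t : ℝ) (hs0 : 0 < s) (hs1 : s ≤ 1) (ht0 : 0 < t) (ht1 : t ≤ 1)
    (F : Set (EuclideanSpace ℝ (Fin 2)))
    (K : Set (EuclideanSpace ℝ (Fin 2) × ℝ))
    (hKpos : ∀ p ∈ K, 0 < p.2)
    (hKdim : ENNReal.ofReal t ≤ dimH K)
    (hF : ∀ p ∈ K, ENNReal.ofReal s ≤ dimH (F ∩ Metric.sphere p.1 p.2)) :
    ENNReal.ofReal (max (t / 3 + s) ((2 * s - 1) * t + s)) ≤ dimH F := by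
  by_contra hlt
  rw [not_le] at hlt
  obtain ⟨σ', hσ1, hσ2⟩ := ENNReal.lt_iff_exists_nnreal_btwn.1 hlt
  obtain ⟨σ, hσ⟩ : ∃ σ : ℝ, σ = σ' := ⟨_, rfl⟩
  have e : (σ' : ℝ≥0∞) = ENNReal.ofReal σ := by rw [hσ, ENNReal.ofReal_coe_nnreal]
  rw [e] at hσ1 hσ2
  have σ0 : 0 < σ := by
    by_contra h
    rw [ENNReal.ofReal_of_nonpos (by linarith)] at hσ1
    exact not_lt_bot hσ1
  have hσ3 := (ENNReal.ofReal_lt_ofReal_iff_of_nonneg σ0.le).1 hσ2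
  have main : ∀ s' t' : ℝ, 0 < s' → s' < s → 0 < t' → t' < t → s' + t' / 3 ≤ σ ∧ (t' ≤ s' → s' + t' ≤ σ) := by
    intro s' t' a b c d
    exact global_lemma K F s' t' σ a (by linarith) c (by linarith) σ0 hKpos hσ1
      (fun p hp => ((ENNReal.ofReal_lt_ofReal_iff hs0).2 b).trans_le (hF p hp))
      (((ENNReal.ofReal_lt_ofReal_iff ht0).2 d).trans_le hKdim)
  rcases lt_max_iff.1 hσ3 with h | h
  · set ε := min (min (s / 2) (t / 2)) ((t / 3 + s - σ) / 2) with hε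
    have ε0 : 0 < ε := by
      have : 0 < (t / 3 + s - σ) / 2 := by linarith
      positivity
    have h1 : ε ≤ s / 2 := (min_le_left _ _).trans (min_le_left _ _)
    have h2 : ε ≤ t / 2 := (min_le_left _ _).trans (min_le_right _ _)
    have h3 : ε ≤ (t / 3 + s - σ) / 2 := min_le_right _ _
    have := (main (s - ε) (t - ε) (by linarith) (by linarith) (by linarith) (by linarith)).1
    linarith
  · set m := min s t with hm
    have m1 : m ≤ s := min_le_left _ _
    have m2 : m ≤ t := min_le_right _ _
    have m0 : 0 < m := lt_min hs0 ht0
    have hσm : σ < s + m := by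
      refine h.trans_le ?_
      have : (2 * s - 1) * t ≤ m := by
        refine le_min ?_ ?_ <;> nlinarith
      linarith
    set ε := min (m / 2) ((s + m - σ) / 3) with hε
    have ε0 : 0 < ε := by
      have : 0 < (s + m - σ) / 3 := by linarith
      positivity
    have h1 : ε ≤ m / 2 := min_le_left _ _
    have h3 : ε ≤ (s + m - σ) / 3 := min_le_right _ _
    have := (main (s - ε) (m - ε) (by linarith) (by linarith) (by linarith) (by linarith)).2 (by linarith)
    linarith
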